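/- There is a constant-length MSO₂-formula φ such that for every internally 3-connected graph G, the auxiliary labeled graph G̃ satisfies φ if and only if G is S-restricted. -/

import Mathlib

open scoped unitInterval

namespace OnePlanarity

/-- The six crossing types of a crossing in a 1-planar drawing. -/
inductive CrossingType : Type
  | full | almostFull | bowtie | arrow | chair | timesCross
  deriving DecidableEq

/-- The three crossing types in which the four endpoints of the crossing edges
lie on a common 4-cycle using the two crossing edges. -/
def goodTypes : Set CrossingType :=
  {CrossingType.full, CrossingType.almostFull, CrossingType.bowtie}

/-- The three "bad" crossing types. -/
def badTypes : Set CrossingType :=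
  {CrossingType.arrow, CrossingType.chair, CrossingType.timesCross}

variable {V : Type*} {W : Type*}

/-- `HasCrossingType G a b c d t` says that, assuming the edges `ab` and `cd` of `G`
cross, the subgraph of `G` induced by `{a,b,c,d}` witnesses the crossing type `t`. -/
def HasCrossingType (G : SimpleGraph V) (a b c d : V) : CrossingType → Prop
  | .full => G.Adj a c ∧ G.Adj a d ∧ G.Adj b c ∧ G.Adj b d
  | .almostFull =>
      (¬G.Adj a c ∧ G.Adj a d ∧ G.Adj b c ∧ G.Adj b d) ∨
      (G.Adj a c ∧ ¬G.Adj a d ∧ G.Adj b c ∧ G.Adj b d) ∨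
      (G.Adj a c ∧ G.Adj a d ∧ ¬G.Adj b c ∧ G.Adj b d) ∨
      (G.Adj a c ∧ G.Adj a d ∧ G.Adj b c ∧ ¬G.Adj b d)
  | .bowtie =>
      (G.Adj a c ∧ G.Adj b d ∧ ¬G.Adj a d ∧ ¬G.Adj b c) ∨
      (G.Adj a d ∧ G.Adj b c ∧ ¬G.Adj a c ∧ ¬G.Adj b d)
  | .arrow =>
      (G.Adj a c ∧ G.Adj a d ∧ ¬G.Adj b c ∧ ¬G.Adj b d) ∨
      (G.Adj b c ∧ G.Adj b d ∧ ¬G.Adj a c ∧ ¬G.Adj a d) ∨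
      (G.Adj a c ∧ G.Adj b c ∧ ¬G.Adj a d ∧ ¬G.Adj b d) ∨
      (G.Adj a d ∧ G.Adj b d ∧ ¬G.Adj a c ∧ ¬G.Adj b c)
  | .chair =>
      (G.Adj a c ∧ ¬G.Adj a d ∧ ¬G.Adj b c ∧ ¬G.Adj b d) ∨
      (¬G.Adj a c ∧ G.Adj a d ∧ ¬G.Adj b c ∧ ¬G.Adj b d) ∨
      (¬G.Adj a c ∧ ¬G.Adj a d ∧ G.Adj b c ∧ ¬G.Adj b d) ∨
      (¬G.Adj a c ∧ ¬G.Adj a d ∧ ¬G.Adj b c ∧ G.Adj b d)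
  | .timesCross => ¬G.Adj a c ∧ ¬G.Adj a d ∧ ¬G.Adj b c ∧ ¬G.Adj b d

/-- `IsArc A x y` says that `A` is the image of a simple curve from `x` to `y`. -/
def IsArc (A : Set (ℝ × ℝ)) (x y : ℝ × ℝ) : Prop :=
  ∃ f : I → ℝ × ℝ, Continuous f ∧ Function.Injective f ∧
    f 0 = x ∧ f 1 = y ∧ Set.range f = A

/-- A drawing of a graph `G` in the plane: vertices are mapped to distinct points,
every edge is mapped to a simple curve between the images of its endpoints avoiding the
images of all other vertices, and two edges intersect in finitely many points. -/
structure Drawing (G : SimpleGraph V) where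
  pos : V → ℝ × ℝ
  pos_inj : Function.Injective pos
  arc : Sym2 V → Set (ℝ × ℝ)
  arc_curve : ∀ e ∈ G.edgeSet, ∀ u v : V, e = s(u, v) → IsArc (arc e) (pos u) (pos v)
  arc_avoid : ∀ e ∈ G.edgeSet, ∀ w : V, pos w ∈ arc e → w ∈ e
  arc_finite_inter : ∀ e ∈ G.edgeSet, ∀ e' ∈ G.edgeSet, e ≠ e' →
    (arc e ∩ arc e').Finite

variable {G : SimpleGraph V}

/-- `D.Crosses e e' p` : the distinct edges `e` and `e'` of `G` cross at the point `p`
(an intersection point of their curves which is not the image of a vertex). -/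
def Drawing.Crosses (D : Drawing G) (e e' : Sym2 V) (p : ℝ × ℝ) : Prop :=
  e ∈ G.edgeSet ∧ e' ∈ G.edgeSet ∧ e ≠ e' ∧
    p ∈ D.arc e ∧ p ∈ D.arc e' ∧ p ∉ Set.range D.pos

/-- A drawing is 1-planar if every edge is involved in at most one crossing and
adjacent edges do not cross. -/
def Drawing.IsOnePlanar (D : Drawing G) : Prop :=
  (∀ e e₁ e₂ p q, D.Crosses e e₁ p → D.Crosses e e₂ q → e₁ = e₂ ∧ p = q) ∧
  (∀ e e' p, D.Crosses e e' p → ∀ v : V, v ∈ e → v ∉ e')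

/-- A drawing is `S`-restricted if it is 1-planar and every crossing has a type in `S`. -/
def Drawing.IsSRestricted (D : Drawing G) (S : Set CrossingType) : Prop :=
  D.IsOnePlanar ∧
  ∀ a b c d : V, ∀ p : ℝ × ℝ, D.Crosses s(a, b) s(c, d) p →
    ∃ t ∈ S, HasCrossingType G a b c d t

/-- A graph is 1-planar if it admits a 1-planar drawing. -/
def IsOnePlanarGraph (G : SimpleGraph V) : Prop :=
  ∃ D : Drawing G, D.IsOnePlanar

/-- A graph is `S`-restricted if it admits an `S`-restricted drawing. -/
def SRestricted (G : SimpleGraph V) (S : Set CrossingType) : Prop :=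
  ∃ D : Drawing G, D.IsSRestricted S

/-- A planar graph: one admitting a crossing-free drawing. -/
def IsPlanarGraph (G : SimpleGraph V) : Prop :=
  ∃ D : Drawing G, ∀ e e' p, ¬ D.Crosses e e' p

/-- A drawing is geometric if every edge is drawn as a straight-line segment. -/
def Drawing.IsGeometric (D : Drawing G) : Prop :=
  ∀ u v : V, G.Adj u v → D.arc s(u, v) = segment ℝ (D.pos u) (D.pos v)

/-- The point set of a drawing. -/
def Drawing.image (D : Drawing G) : Set (ℝ × ℝ) :=
  Set.range D.pos ∪ ⋃ e ∈ G.edgeSet, D.arc e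

/-- The set of points of the outer (unbounded) face of a point set `A`. -/
def outerRegion (A : Set (ℝ × ℝ)) : Set (ℝ × ℝ) :=
  {x | x ∉ A ∧ ¬ Bornology.IsBounded (connectedComponentIn Aᶜ x)}

/-- `Inside γ x` : the point `x` is separated from the outer face by the closed curve `γ`. -/
def Inside (γ : Set (ℝ × ℝ)) (x : ℝ × ℝ) : Prop :=
  x ∉ γ ∧ Bornology.IsBounded (connectedComponentIn γᶜ x)

/-- A vertex lies on (the boundary of) the outer face of a drawing. -/
def Drawing.OnOuterFace (D : Drawing G) (v : V) : Prop :=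
  D.pos v ∈ closure (outerRegion D.image)

/-- Two vertices are cofacial: they lie on the boundary of a common face. -/
def Drawing.Cofacial (D : Drawing G) (u v : V) : Prop :=
  ∃ p : ℝ × ℝ, p ∉ D.image ∧
    D.pos u ∈ closure (connectedComponentIn D.imageᶜ p) ∧
    D.pos v ∈ closure (connectedComponentIn D.imageᶜ p)

/-- A graph admits a geometric `S`-restricted drawing. -/
def GeoSRestricted (G : SimpleGraph V) (S : Set CrossingType) : Prop :=
  ∃ D : Drawing G, D.IsGeometric ∧ D.IsSRestricted S

/-- `OGeoSRestricted G S O` : the graph `G` admits a geometric `S`-restricted drawing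
in which the vertex of `O` (if any) lies on the outer face. -/
def OGeoSRestricted (G : SimpleGraph V) (S : Set CrossingType) (O : Set V) : Prop :=
  ∃ D : Drawing G, D.IsGeometric ∧ D.IsSRestricted S ∧ ∀ v ∈ O, D.OnOuterFace v

/-- `k`-connectivity. -/
def KConnected (k : ℕ) (G : SimpleGraph V) : Prop :=
  k < Nat.card V ∧ ∀ T : Set V, T.ncard < k → (G.induce Tᶜ).Connected

/-- A vertex has degree exactly two. -/
def DegTwo (G : SimpleGraph V) (w : V) : Prop :=
  ∃ a b : V, a ≠ b ∧ G.neighborSet w = {a, b}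

/-- The simple graph obtained from `G` by suppressing the degree-2 vertices in `W`. -/
def suppress (G : SimpleGraph V) (Ws : Set V) : SimpleGraph {v : V // v ∉ Ws} :=
  SimpleGraph.fromRel (fun a b =>
    G.Adj a.1 b.1 ∨ ∃ w ∈ Ws, G.Adj w a.1 ∧ G.Adj w b.1)

/-- A graph is internally 3-connected if it is obtained from a 3-connected (multi)graph by
subdividing a subset of its edges once each. -/
def InternallyThreeConnected (G : SimpleGraph V) : Prop :=
  ∃ Ws : Set V, (∀ w ∈ Ws, DegTwo G w) ∧ (∀ w ∈ Ws, ∀ u ∈ Ws, ¬ G.Adj w u) ∧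
    KConnected 3 (suppress G Ws)

/-- `IsSeparation G T X₁ X₂` : `(X₁, X₂)` is a separation of `G` induced by the separator `T`. -/
def IsSeparation (G : SimpleGraph V) (T X₁ X₂ : Set V) : Prop :=
  X₁ ∪ X₂ = Set.univ ∧ X₁ ∩ X₂ = T ∧ (X₁ \ T).Nonempty ∧ (X₂ \ T).Nonempty ∧
  ∀ u ∈ X₁ \ T, ∀ v ∈ X₂ \ T, ∀ p : G.Walk u v, ∃ w ∈ T, w ∈ p.support

end OnePlanarity
namespace OnePlanarity

variable {V : Type*}

/-- A graph is chordal if every cycle of length at least 4 has a chord. -/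
def IsChordal (G : SimpleGraph V) : Prop :=
  ∀ (v : V) (c : G.Walk v v), c.IsCycle → 4 ≤ c.length →
    ∃ a b : V, a ∈ c.support ∧ b ∈ c.support ∧ G.Adj a b ∧ s(a, b) ∉ c.edges

/-- `(e, g)` is a chord-tied pair (w.r.t. a chordal completion `Ĝ` of `G` and the set `S`
of admissible crossing types): `e = ab` is the crossing edge of a 4-cycle `a b c d` of `G`
whose vertices induce a crossing type from `S` in which `ab` and `cd` cross, and `g` is a
chord of this 4-cycle in `Ĝ`. -/
def IsChordTiedPair (G Ghat : SimpleGraph V) (S : Set CrossingType) (e g : Sym2 V) : Prop :=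
  ∃ a b c d : V, e = s(a, b) ∧
    G.Adj a b ∧ G.Adj b c ∧ G.Adj c d ∧ G.Adj d a ∧
    (∃ t ∈ S, HasCrossingType G a b c d t) ∧
    g ∈ Ghat.edgeSet ∧ (∀ x ∈ g, x ∈ ({a, b, c, d} : Set V)) ∧
    g ∉ ({s(a, b), s(b, c), s(c, d), s(d, a)} : Set (Sym2 V))

/-- `{e, e'}` is a crossing pair of the set `Ψ` of flagged chord-tied pairs: `e ≠ e'` and
`e` and `e'` are crossing edges of chord-tied pairs in `Ψ` with the same chord edge and
the same flag. -/
def CrossingPairOf (Ψ : Set (Sym2 V × Sym2 V × Bool)) (e e' : Sym2 V) : Prop :=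
  e ≠ e' ∧ ∃ (g : Sym2 V) (b : Bool), (e, g, b) ∈ Ψ ∧ (e', g, b) ∈ Ψ

/-- The graph obtained from `G` by replacing each pair of edges in `CP` by a 4-claw on
their endpoints (with a new centre vertex `Sum.inr P` for each pair `P ∈ CP`). -/
def planarizationBy (G : SimpleGraph V) (CP : Set (Sym2 (Sym2 V))) :
    SimpleGraph (V ⊕ Sym2 (Sym2 V)) :=
  SimpleGraph.fromRel (fun x y =>
    (∃ u w : V, x = Sum.inl u ∧ y = Sum.inl w ∧ G.Adj u w ∧ ∀ P ∈ CP, s(u, w) ∉ P) ∨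
    (∃ (u : V) (P : Sym2 (Sym2 V)), x = Sum.inl u ∧ y = Sum.inr P ∧ P ∈ CP ∧
      ∃ e ∈ P, u ∈ e))

/-- The crossing pairs of `Ψ`, as elements of `Sym2 (Sym2 V)`. -/
def crossingPairsOf (Ψ : Set (Sym2 V × Sym2 V × Bool)) : Set (Sym2 (Sym2 V)) :=
  {P | ∃ e e', CrossingPairOf Ψ e e' ∧ P = s(e, e')}

/-- A chord description of `G` (w.r.t. a chordal completion `Ĝ` and crossing types `S`):
a set `Ψ` of flagged chord-tied pairs `(e, g, b)` such that (1) every chord-tied pair in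
`Ψ` has exactly one partner in `Ψ` with the same chord edge and flag, (2) every edge is
the crossing edge of at most one chord-tied pair in `Ψ`, (3) replacing every crossing pair
of `Ψ` by a 4-claw yields a planar graph, and (4) the endpoints of every crossing pair of
`Ψ` induce a crossing type from `S` in which its two edges cross. -/
def IsChordDescription (G Ghat : SimpleGraph V) (S : Set CrossingType)
    (Ψ : Set (Sym2 V × Sym2 V × Bool)) : Prop :=
  (∀ ψ ∈ Ψ, IsChordTiedPair G Ghat S ψ.1 ψ.2.1) ∧
  (∀ ψ ∈ Ψ, ∃! e' : Sym2 V, e' ≠ ψ.1 ∧ (e', ψ.2.1, ψ.2.2) ∈ Ψ) ∧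
  (∀ (e g g' : Sym2 V) (b b' : Bool), (e, g, b) ∈ Ψ → (e, g', b') ∈ Ψ → g = g' ∧ b = b') ∧
  IsPlanarGraph (planarizationBy G (crossingPairsOf Ψ)) ∧
  (∀ e e', CrossingPairOf Ψ e e' →
    ∃ a b c d : V, e = s(a, b) ∧ e' = s(c, d) ∧ ∃ t ∈ S, HasCrossingType G a b c d t)

end OnePlanarity
namespace OnePlanarity

variable {V : Type*}

/-- The data of a potential chord-tied pair: a 4-tuple of vertices (a 4-cycle `a b c d`
with designated crossing edge `ab`) together with a chord. -/
abbrev CTPData (V : Type*) : Type _ := (V × V × V × V) × Sym2 V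

/-- Validity of a chord-tied pair datum: `a b c d` is a 4-cycle of `G` whose vertex set
induces a crossing type from `S` in which `ab` and `cd` cross, and `g` is a chord of this
4-cycle in the chordal completion `Ĝ`. -/
def ValidCTP (G Ghat : SimpleGraph V) (S : Set CrossingType) : CTPData V → Prop
  | ((a, b, c, d), g) =>
    G.Adj a b ∧ G.Adj b c ∧ G.Adj c d ∧ G.Adj d a ∧
    (∃ t ∈ S, HasCrossingType G a b c d t) ∧
    g ∈ Ghat.edgeSet ∧ (∀ x ∈ g, x ∈ ({a, b, c, d} : Set V)) ∧
    g ∉ ({s(a, b), s(b, c), s(c, d), s(d, a)} : Set (Sym2 V))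

/-- The crossing edge of a chord-tied pair datum. -/
def crEdgeOf : CTPData V → Sym2 V
  | ((a, b, _, _), _) => s(a, b)

/-- The vertex type of the auxiliary graph `G̃`: original vertices, `cr`-vertices (one for
each edge of `G`), `ctp`-vertices (one for each chord-tied pair) and flag pendants. -/
abbrev AuxV (V : Type*) : Type _ := V ⊕ Sym2 V ⊕ CTPData V ⊕ (CTPData V × Bool)

/-- The labels of the vertices of the auxiliary graph. -/
inductive AuxLabel | plain | cr | ctp | flag0 | flag1
  deriving DecidableEq

/-- The labelling of the vertices of the auxiliary graph. -/
def auxLabelOf : AuxV V → AuxLabel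
  | Sum.inl _ => AuxLabel.plain
  | Sum.inr (Sum.inl _) => AuxLabel.cr
  | Sum.inr (Sum.inr (Sum.inl _)) => AuxLabel.ctp
  | Sum.inr (Sum.inr (Sum.inr (_, false))) => AuxLabel.flag0
  | Sum.inr (Sum.inr (Sum.inr (_, true))) => AuxLabel.flag1

/-- The auxiliary graph `G̃` built from a chordal completion `Ĝ` of `G`: the edges of `Ĝ`;
for every edge `e` of `G` a path of length two through the `cr`-vertex of `e`; for every
valid chord-tied pair `(e, g)` a path of length two between the endpoints of `g` through
its `ctp`-vertex, an edge between this `ctp`-vertex and the `cr`-vertex of `e`, and two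
pendant flag vertices attached to the `ctp`-vertex. -/
def auxGraph (G Ghat : SimpleGraph V) (S : Set CrossingType) : SimpleGraph (AuxV V) :=
  SimpleGraph.fromRel (fun x y =>
    (∃ u w : V, x = Sum.inl u ∧ y = Sum.inl w ∧ Ghat.Adj u w) ∨
    (∃ (u : V) (e : Sym2 V), x = Sum.inl u ∧ y = Sum.inr (Sum.inl e) ∧
      e ∈ G.edgeSet ∧ u ∈ e) ∨
    (∃ (u : V) (q : CTPData V), x = Sum.inl u ∧ y = Sum.inr (Sum.inr (Sum.inl q)) ∧
      ValidCTP G Ghat S q ∧ u ∈ q.2) ∨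
    (∃ (e : Sym2 V) (q : CTPData V), x = Sum.inr (Sum.inl e) ∧
      y = Sum.inr (Sum.inr (Sum.inl q)) ∧ ValidCTP G Ghat S q ∧ e = crEdgeOf q) ∨
    (∃ (q : CTPData V) (b : Bool), x = Sum.inr (Sum.inr (Sum.inl q)) ∧
      y = Sum.inr (Sum.inr (Sum.inr (q, b))) ∧ ValidCTP G Ghat S q))

end OnePlanarity
namespace OnePlanarity

/-- Syntax of monadic second-order logic MSO₂ on labelled graphs, with (numbered) vertex,
edge, vertex-set and edge-set variables, adjacency and incidence predicates, and label
predicates. -/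
inductive MSOFormula (L : Type) : Type
  | tt : MSOFormula L
  | adj (x y : ℕ) : MSOFormula L
  | inc (x e : ℕ) : MSOFormula L
  | lab (l : L) (x : ℕ) : MSOFormula L
  | veq (x y : ℕ) : MSOFormula L
  | eeq (e f : ℕ) : MSOFormula L
  | memV (x X : ℕ) : MSOFormula L
  | memE (e F : ℕ) : MSOFormula L
  | not (φ : MSOFormula L) : MSOFormula L
  | and (φ ψ : MSOFormula L) : MSOFormula L
  | exV (x : ℕ) (φ : MSOFormula L) : MSOFormula L
  | exE (e : ℕ) (φ : MSOFormula L) : MSOFormula L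
  | exSetV (X : ℕ) (φ : MSOFormula L) : MSOFormula L
  | exSetE (F : ℕ) (φ : MSOFormula L) : MSOFormula L

/-- An assignment of the MSO₂ variables. -/
structure MSOAssignment (W : Type*) where
  v : ℕ → W
  e : ℕ → Sym2 W
  sv : ℕ → Set W
  se : ℕ → Set (Sym2 W)

/-- The satisfaction relation of MSO₂ over a labelled graph. -/
def MSOSat {W : Type*} {L : Type} (H : SimpleGraph W) (lab : W → L) :
    MSOFormula L → MSOAssignment W → Prop
  | .tt, _ => True
  | .adj x y, ρ => H.Adj (ρ.v x) (ρ.v y)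
  | .inc x e, ρ => ρ.e e ∈ H.edgeSet ∧ ρ.v x ∈ ρ.e e
  | .lab l x, ρ => lab (ρ.v x) = l
  | .veq x y, ρ => ρ.v x = ρ.v y
  | .eeq e f, ρ => ρ.e e = ρ.e f
  | .memV x X, ρ => ρ.v x ∈ ρ.sv X
  | .memE e F, ρ => ρ.e e ∈ ρ.se F
  | .not φ, ρ => ¬ MSOSat H lab φ ρ
  | .and φ ψ, ρ => MSOSat H lab φ ρ ∧ MSOSat H lab ψ ρ
  | .exV x φ, ρ => ∃ w : W, MSOSat H lab φ {ρ with v := Function.update ρ.v x w}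
  | .exE e φ, ρ => ∃ f ∈ H.edgeSet, MSOSat H lab φ {ρ with e := Function.update ρ.e e f}
  | .exSetV X φ, ρ => ∃ A : Set W, MSOSat H lab φ {ρ with sv := Function.update ρ.sv X A}
  | .exSetE F φ, ρ => ∃ B : Set (Sym2 W), B ⊆ H.edgeSet ∧
      MSOSat H lab φ {ρ with se := Function.update ρ.se F B}

/-- A labelled graph models a (sentence of) MSO₂ if it is satisfied under every
assignment of the variables. -/
def MSOModels {W : Type*} {L : Type} (H : SimpleGraph W) (lab : W → L)
    (φ : MSOFormula L) : Prop :=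
  ∀ ρ : MSOAssignment W, MSOSat H lab φ ρ

end OnePlanarity

namespace OnePlanarity

lemma exists_log_lift {A : Type*} [TopologicalSpace A] [SimplyConnectedSpace A]
    [LocallyPathConnectedSpace A] (f : A → ℂ) (hf : Continuous f) (h0 : ∀ a, f a ≠ 0) :
    ∃ L : A → ℂ, Continuous L ∧ ∀ a, Complex.exp (L a) = f a := by
  obtain ⟨a₀⟩ : Nonempty A := inferInstance
  obtain ⟨F, hF, -⟩ := Complex.isCoveringMapOn_exp.existsUnique_continuousMap_lifts
    (f := ⟨f, hf⟩) (a₀ := a₀) (e₀ := Complex.log (f a₀)) (Complex.exp_log (h0 a₀))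
    (fun a => h0 a)
  exact ⟨F, F.continuous, fun a => congrFun hF.2 a⟩

lemma log_lift_sub {L L' : ℝ → ℂ} (hL : Continuous L) (hL' : Continuous L')
    (h : ∀ t, Complex.exp (L t) = Complex.exp (L' t)) (s t : ℝ) :
    L s - L t = L' s - L' t := by
  have := Complex.isCoveringMap_exp.eq_of_comp_eq (g₁ := fun t => L t)
    (g₂ := fun s => L' s + (L t - L' t)) hL (by fun_prop) (by
      funext s
      apply Subtype.ext
      simp only [Function.comp]
      rw [Complex.exp_add, Complex.exp_sub, h t, div_self (Complex.exp_ne_zero _), mul_one, h s])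
    t (by ring)
  have := congrFun this s
  rw [this]; ring

/-- `w` is the total change of the logarithm of `γ - p` along the path `γ`. -/
def IsTurn {a b : ℂ} (γ : Path a b) (p w : ℂ) : Prop :=
  ∃ L : ℝ → ℂ, Continuous L ∧ (∀ t, Complex.exp (L t) = γ.extend t - p) ∧ L 1 - L 0 = w

lemma IsTurn.unique {a b : ℂ} {γ : Path a b} {p w w' : ℂ} (h : IsTurn γ p w)
    (h' : IsTurn γ p w') : w = w' := by
  obtain ⟨L, hL, hLe, rfl⟩ := h
  obtain ⟨L', hL', hLe', rfl⟩ := h'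
  exact log_lift_sub hL hL' (fun t => by rw [hLe, hLe']) 1 0

lemma exists_isTurn {a b : ℂ} (γ : Path a b) (p : ℂ) (h : p ∉ Set.range γ) :
    ∃ w, IsTurn γ p w := by
  obtain ⟨L, hL, hLe⟩ := exists_log_lift (fun t => γ.extend t - p) (by fun_prop) (by
    intro t ht
    apply h
    rw [← γ.extend_range]
    exact ⟨t, sub_eq_zero.1 ht⟩)
  exact ⟨_, L, hL, hLe, rfl⟩

/-- The homotopy identity for the turns of two disjoint paths around each other's ends. -/
lemma isTurn_add {a b c d : ℂ} (γ : Path a b) (δ : Path c d)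
    (h : Disjoint (Set.range γ) (Set.range δ)) {wc wd wa wb : ℂ}
    (hc : IsTurn γ c wc) (hd : IsTurn γ d wd) (ha : IsTurn δ a wa) (hb : IsTurn δ b wb) :
    wc + wb = wa + wd := by
  obtain ⟨L, hL, hLe⟩ := exists_log_lift (fun x : ℝ × ℝ => γ.extend x.1 - δ.extend x.2)
    (by fun_prop) (by
      intro t ht
      refine (Set.disjoint_left.1 h : ∀ ⦃a⦄, _) (a := γ.extend t.1) ?_ ?_
      · rw [← γ.extend_range]; exact ⟨_, rfl⟩
      · rw [← δ.extend_range, sub_eq_zero.1 ht]; exact ⟨_, rfl⟩)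
  have h1 : IsTurn γ c (L (1, 0) - L (0, 0)) :=
    ⟨fun t => L (t, 0), by fun_prop, fun t => by simp [hLe], rfl⟩
  have h2 : IsTurn γ d (L (1, 1) - L (0, 1)) :=
    ⟨fun t => L (t, 1), by fun_prop, fun t => by simp [hLe], rfl⟩
  have h3 : IsTurn δ a (L (0, 1) - L (0, 0)) :=
    ⟨fun t => L (0, t) + Real.pi * Complex.I, by fun_prop,
      fun t => by rw [Complex.exp_add, hLe, Complex.exp_pi_mul_I]; simp, by ring⟩
  have h4 : IsTurn δ b (L (1, 1) - L (1, 0)) :=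
    ⟨fun t => L (1, t) + Real.pi * Complex.I, by fun_prop,
      fun t => by rw [Complex.exp_add, hLe, Complex.exp_pi_mul_I]; simp, by ring⟩
  rw [hc.unique h1, hd.unique h2, ha.unique h3, hb.unique h4]
  ring

/-- Parity data of a system of paths between points of the plane such that independent
paths are disjoint. -/
lemma exists_crossing_numbers {m : ℕ} (p : Fin m → ℂ) (adj : Fin m → Fin m → Prop)
    (γ : ∀ i j, adj i j → Path (p i) (p j))
    (hp : Function.Injective p)
    (hγ : ∀ i j (h : adj i j) k, k ≠ i → k ≠ j → p k ∉ Set.range (γ i j h))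
    (hd : ∀ i j (h : adj i j) k l (h' : adj k l), i ≠ k → i ≠ l → j ≠ k → j ≠ l →
      Disjoint (Set.range (γ i j h)) (Set.range (γ k l h'))) :
    ∃ n : Fin m → Fin m → Fin m → ℤ, ∀ i j k l, adj i j → adj k l →
      i ≠ k → i ≠ l → j ≠ k → j ≠ l →
      2 * (n i j k + n k l j - n i j l - n k l i) +
        ((if j < k then -1 else 1) + (if k < i then -1 else 1) +
          (if l < j then -1 else 1) + (if i < l then -1 else 1)) = 0 := by
  classical
  set A : Fin m → Fin m → ℂ := fun i k =>
    if i < k then Complex.log (p i - p k) else Complex.log (p k - p i) + Real.pi * Complex.I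
    with hA
  have hAe : ∀ i k, i ≠ k → Complex.exp (A i k) = p i - p k := by
    intro i k hik
    have h0 : p i - p k ≠ 0 := sub_ne_zero.2 (hp.ne hik)
    have h1 : p k - p i ≠ 0 := sub_ne_zero.2 (hp.ne hik.symm)
    simp only [hA]
    split_ifs
    · exact Complex.exp_log h0
    · rw [Complex.exp_add, Complex.exp_log h1, Complex.exp_pi_mul_I]; ring
  have hAs : ∀ i k, i ≠ k → A i k - A k i = Real.pi * Complex.I * ((if i < k then -1 else 1 : ℤ))
      := by
    intro i k hik
    simp only [hA]
    rcases lt_or_gt_of_ne hik with h | h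
    · rw [if_pos h, if_neg h.not_gt, if_pos h]; push_cast; ring
    · rw [if_neg h.not_gt, if_pos h, if_neg h.not_gt]; push_cast; ring
  have key : ∀ i j k, ∃ n : ℤ, ∀ h : adj i j, k ≠ i → k ≠ j →
      IsTurn (γ i j h) (p k) (A j k - A i k + n * (2 * Real.pi * Complex.I)) := by
    intro i j k
    by_cases h : adj i j ∧ k ≠ i ∧ k ≠ j
    · obtain ⟨h, hi, hj⟩ := h
      obtain ⟨w, L, hL, hLe, hw⟩ := exists_isTurn (γ i j h) (p k) (hγ i j h k hi hj)
      have e0 := hLe 0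
      have e1 := hLe 1
      rw [(γ i j h).extend_zero, ← hAe i k hi.symm] at e0
      rw [(γ i j h).extend_one, ← hAe j k hj.symm] at e1
      obtain ⟨n0, hn0⟩ := Complex.exp_eq_exp_iff_exists_int.1 e0
      obtain ⟨n1, hn1⟩ := Complex.exp_eq_exp_iff_exists_int.1 e1
      refine ⟨n1 - n0, fun _ _ _ => ⟨L, hL, hLe, ?_⟩⟩
      rw [hn0, hn1]; push_cast; ring
    · exact ⟨0, fun h1 h2 h3 => (h ⟨h1, h2, h3⟩).elim⟩
  choose n hn using key
  refine ⟨n, fun i j k l h h' hik hil hjk hjl => ?_⟩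
  have := isTurn_add (γ i j h) (γ k l h') (hd i j h k l h' hik hil hjk hjl)
    (hn i j k h hik.symm hjk.symm) (hn i j l h hil.symm hjl.symm)
    (hn k l i h' hik hil) (hn k l j h' hjk hjl)
  have e1 := hAs j k hjk
  have e2 := hAs k i hik.symm
  have e3 := hAs l j hjl.symm
  have e4 := hAs i l hil
  have hpi : (Real.pi * Complex.I : ℂ) ≠ 0 :=
    mul_ne_zero (Complex.ofReal_ne_zero.2 Real.pi_ne_zero) Complex.I_ne_zero
  have : (Real.pi * Complex.I : ℂ) * ((2 * (n i j k + n k l j - n i j l - n k l i) +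
        ((if j < k then -1 else 1) + (if k < i then -1 else 1) +
          (if l < j then -1 else 1) + (if i < l then -1 else 1)) : ℤ) : ℂ) = 0 := by
    push_cast at e1 e2 e3 e4 ⊢
    linear_combination this - e1 - e2 - e3 - e4
  have := (mul_eq_zero.1 this).resolve_left hpi
  exact_mod_cast this

lemma exists_crossing_numbers_of_joinedIn {m : ℕ} (p : Fin m → ℝ × ℝ) (S : Fin m → Set (ℝ × ℝ))
    (adj : Fin m → Fin m → Prop) (hS : ∀ i j, i ≠ j → Disjoint (S i) (S j))
    (hp : ∀ i, p i ∈ S i) (h : ∀ i j, adj i j → JoinedIn (S i ∪ S j) (p i) (p j)) :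
    ∃ n : Fin m → Fin m → Fin m → ℤ, ∀ i j k l, adj i j → adj k l →
      i ≠ k → i ≠ l → j ≠ k → j ≠ l →
      2 * (n i j k + n k l j - n i j l - n k l i) +
        ((if j < k then -1 else 1) + (if k < i then -1 else 1) +
          (if l < j then -1 else 1) + (if i < l then -1 else 1)) = 0 := by
  have hφ : Continuous Complex.equivRealProdCLM.symm := Complex.equivRealProdCLM.symm.continuous
  have hi := Complex.equivRealProdCLM.symm.injective
  have hr : ∀ i j (h' : adj i j), Set.range ((h i j h').somePath.map hφ) ⊆
      Complex.equivRealProdCLM.symm '' (S i ∪ S j) := by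
    rintro i j h' _ ⟨t, rfl⟩
    exact ⟨_, (h i j h').somePath_mem t, rfl⟩
  refine exists_crossing_numbers (fun i => Complex.equivRealProdCLM.symm (p i)) adj
    (fun i j h' => (h i j h').somePath.map hφ) ?_ ?_ ?_
  · intro i j hij
    by_contra hne
    refine Set.disjoint_left.1 (hS i j hne) (hp i) ?_
    rw [hi hij]; exact hp j
  · intro i j h' k hki hkj hk
    obtain ⟨x, hx, hxe⟩ := hr i j h' hk
    rw [hi hxe] at hx
    rcases hx with hx | hx
    · exact Set.disjoint_left.1 (hS k i hki) (hp k) hx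
    · exact Set.disjoint_left.1 (hS k j hkj) (hp k) hx
  · intro i j h1 k l h2 hik hil hjk hjl
    refine Set.disjoint_of_subset (hr i j h1) (hr k l h2) ?_
    rw [Set.disjoint_image_iff hi]
    simp only [Set.disjoint_union_left, Set.disjoint_union_right]
    exact ⟨⟨hS _ _ hik, hS _ _ hjk⟩, hS _ _ hil, hS _ _ hjl⟩

/-- `K₅` cannot be represented by disjoint path-connected touching sets in the plane. -/
theorem no_planar_five (p : Fin 5 → ℝ × ℝ) (S : Fin 5 → Set (ℝ × ℝ))
    (hS : ∀ i j, i ≠ j → Disjoint (S i) (S j)) (hp : ∀ i, p i ∈ S i)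
    (h : ∀ i j, i < j → JoinedIn (S i ∪ S j) (p i) (p j)) : False := by
  obtain ⟨n, hn⟩ := exists_crossing_numbers_of_joinedIn p S (· < ·) hS hp h
  have a1 := hn 0 1 2 3 (by decide) (by decide) (by decide) (by decide) (by decide) (by decide)
  have a2 := hn 0 2 1 3 (by decide) (by decide) (by decide) (by decide) (by decide) (by decide)
  have a3 := hn 0 3 1 2 (by decide) (by decide) (by decide) (by decide) (by decide) (by decide)
  have b1 := hn 0 1 2 4 (by decide) (by decide) (by decide) (by decide) (by decide) (by decide)
  have b2 := hn 0 2 1 4 (by decide) (by decide) (by decide) (by decide) (by decide) (by decide)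
  have b3 := hn 0 4 1 2 (by decide) (by decide) (by decide) (by decide) (by decide) (by decide)
  have c1 := hn 0 1 3 4 (by decide) (by decide) (by decide) (by decide) (by decide) (by decide)
  have c2 := hn 0 3 1 4 (by decide) (by decide) (by decide) (by decide) (by decide) (by decide)
  have c3 := hn 0 4 1 3 (by decide) (by decide) (by decide) (by decide) (by decide) (by decide)
  have d1 := hn 0 2 3 4 (by decide) (by decide) (by decide) (by decide) (by decide) (by decide)
  have d2 := hn 0 3 2 4 (by decide) (by decide) (by decide) (by decide) (by decide) (by decide)
  have d3 := hn 0 4 2 3 (by decide) (by decide) (by decide) (by decide) (by decide) (by decide)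
  have e1 := hn 1 2 3 4 (by decide) (by decide) (by decide) (by decide) (by decide) (by decide)
  have e2 := hn 1 3 2 4 (by decide) (by decide) (by decide) (by decide) (by decide) (by decide)
  have e3 := hn 1 4 2 3 (by decide) (by decide) (by decide) (by decide) (by decide) (by decide)
  simp at a1 a2 a3 b1 b2 b3 c1 c2 c3 d1 d2 d3 e1 e2 e3
  omega

/-- `K₃,₃` cannot be represented by disjoint path-connected touching sets in the plane. -/
theorem no_planar_three_three (p : Fin 6 → ℝ × ℝ) (S : Fin 6 → Set (ℝ × ℝ))
    (hS : ∀ i j, i ≠ j → Disjoint (S i) (S j)) (hp : ∀ i, p i ∈ S i)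
    (h : ∀ i j, i < 3 → 3 ≤ j → JoinedIn (S i ∪ S j) (p i) (p j)) : False := by
  obtain ⟨n, hn⟩ := exists_crossing_numbers_of_joinedIn p S (fun i j => i < 3 ∧ 3 ≤ j) hS hp
    (fun i j hij => h i j hij.1 hij.2)
  have a1 := hn 0 3 1 4 (by decide) (by decide) (by decide) (by decide) (by decide) (by decide)
  have a2 := hn 0 3 1 5 (by decide) (by decide) (by decide) (by decide) (by decide) (by decide)
  have a3 := hn 0 4 1 3 (by decide) (by decide) (by decide) (by decide) (by decide) (by decide)
  have a4 := hn 0 4 1 5 (by decide) (by decide) (by decide) (by decide) (by decide) (by decide)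
  have a5 := hn 0 5 1 3 (by decide) (by decide) (by decide) (by decide) (by decide) (by decide)
  have a6 := hn 0 5 1 4 (by decide) (by decide) (by decide) (by decide) (by decide) (by decide)
  have b1 := hn 0 3 2 4 (by decide) (by decide) (by decide) (by decide) (by decide) (by decide)
  have b2 := hn 0 3 2 5 (by decide) (by decide) (by decide) (by decide) (by decide) (by decide)
  have b3 := hn 0 4 2 3 (by decide) (by decide) (by decide) (by decide) (by decide) (by decide)
  have b4 := hn 0 4 2 5 (by decide) (by decide) (by decide) (by decide) (by decide) (by decide)
  have b5 := hn 0 5 2 3 (by decide) (by decide) (by decide) (by decide) (by decide) (by decide)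
  have b6 := hn 0 5 2 4 (by decide) (by decide) (by decide) (by decide) (by decide) (by decide)
  have c1 := hn 1 3 2 4 (by decide) (by decide) (by decide) (by decide) (by decide) (by decide)
  have c2 := hn 1 3 2 5 (by decide) (by decide) (by decide) (by decide) (by decide) (by decide)
  have c3 := hn 1 4 2 3 (by decide) (by decide) (by decide) (by decide) (by decide) (by decide)
  have c4 := hn 1 4 2 5 (by decide) (by decide) (by decide) (by decide) (by decide) (by decide)
  have c5 := hn 1 5 2 3 (by decide) (by decide) (by decide) (by decide) (by decide) (by decide)
  have c6 := hn 1 5 2 4 (by decide) (by decide) (by decide) (by decide) (by decide) (by decide)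
  simp at a1 a2 a3 a4 a5 a6 b1 b2 b3 b4 b5 b6 c1 c2 c3 c4 c5 c6
  omega
end OnePlanarity

namespace OnePlanarity

section Minors

variable {V W ι : Type*}

/-- The set `A` of vertices is nonempty and connected in `G`. -/
def Conn (G : SimpleGraph V) (A : Set V) : Prop :=
  A.Nonempty ∧ ∀ X : Set V, (∃ u ∈ A, u ∈ X) →
    (∀ u ∈ A, u ∈ X → ∀ v ∈ A, G.Adj u v → v ∈ X) → ∀ v ∈ A, v ∈ X

lemma Conn.mono {G G' : SimpleGraph V} (h : G ≤ G') {A : Set V} (hA : Conn G A) : Conn G' A :=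
  ⟨hA.1, fun X hX hc => hA.2 X hX fun u hu hux v hv huv => hc u hu hux v hv (h huv)⟩

lemma conn_singleton (G : SimpleGraph V) (v : V) : Conn G {v} := by
  refine ⟨⟨v, rfl⟩, ?_⟩
  rintro X ⟨u, rfl, hu⟩ - _ rfl
  exact hu

lemma conn_biUnion {J : SimpleGraph W} {G : SimpleGraph V} {B : Set W} (hB : Conn J B)
    (F : W → Set V) (hF : ∀ w ∈ B, Conn G (F w))
    (hadj : ∀ w ∈ B, ∀ w' ∈ B, J.Adj w w' → ∃ u ∈ F w, ∃ v ∈ F w', G.Adj u v) :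
    Conn G (⋃ w ∈ B, F w) := by
  obtain ⟨w, hw⟩ := hB.1
  obtain ⟨v, hv⟩ := (hF w hw).1
  refine ⟨⟨v, Set.mem_biUnion hw hv⟩, ?_⟩
  rintro X ⟨u, hu, huX⟩ hX
  have hX' : ∀ w ∈ B, (∃ u ∈ F w, u ∈ X) → ∀ v ∈ F w, v ∈ X := fun w hw h =>
    (hF w hw).2 X h fun u hu hux v hv huv =>
      hX u (Set.mem_biUnion hw hu) hux v (Set.mem_biUnion hw hv) huv
  have := hB.2 {w | ∀ v ∈ F w, v ∈ X} (by
      obtain ⟨w, hw, huw⟩ := Set.mem_iUnion₂.1 hu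
      exact ⟨w, hw, hX' w hw ⟨u, huw, huX⟩⟩) (by
      intro w hw hwX w' hw' hww'
      obtain ⟨u, hu, v, hv, huv⟩ := hadj w hw w' hw' hww'
      exact hX' w' hw' ⟨v, hv, hX u (Set.mem_biUnion hw hu) (hwX u hu) v
        (Set.mem_biUnion hw' hv) huv⟩)
  intro v hv
  obtain ⟨w, hw, hvw⟩ := Set.mem_iUnion₂.1 hv
  exact this w hw v hvw

lemma Conn.image {G : SimpleGraph V} {J : SimpleGraph W} {A : Set V} (hA : Conn G A) (f : V → W)
    (hf : ∀ u ∈ A, ∀ v ∈ A, G.Adj u v → f u = f v ∨ J.Adj (f u) (f v)) : Conn J (f '' A) := by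
  refine ⟨hA.1.image f, ?_⟩
  rintro X ⟨_, ⟨u, hu, rfl⟩, huX⟩ hX
  have := hA.2 (f ⁻¹' X) ⟨u, hu, huX⟩ (by
    intro u hu huX v hv huv
    rcases hf u hu v hv huv with h | h
    · rwa [Set.mem_preimage, ← h]
    · exact hX _ ⟨u, hu, rfl⟩ huX _ ⟨v, hv, rfl⟩ h)
  rintro _ ⟨v, hv, rfl⟩
  exact this v hv

lemma Conn.union_inter {G : SimpleGraph V} {A B : Set V} (hA : Conn G A) (hB : Conn G B)
    (h : ∃ v ∈ A, v ∈ B) : Conn G (A ∪ B) := by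
  obtain ⟨w, hwA, hwB⟩ := h
  refine ⟨hA.1.mono Set.subset_union_left, ?_⟩
  rintro X ⟨u, hu, huX⟩ hX
  have hXA : (∃ u ∈ A, u ∈ X) → ∀ v ∈ A, v ∈ X := fun h => hA.2 X h
    fun u hu hux v hv huv => hX u (.inl hu) hux v (.inl hv) huv
  have hXB : (∃ u ∈ B, u ∈ X) → ∀ v ∈ B, v ∈ X := fun h => hB.2 X h
    fun u hu hux v hv huv => hX u (.inr hu) hux v (.inr hv) huv
  have hw : w ∈ X := by
    rcases hu with hu | hu
    · exact hXA ⟨u, hu, huX⟩ w hwA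
    · exact hXB ⟨u, hu, huX⟩ w hwB
  rintro v (hv | hv)
  · exact hXA ⟨w, hwA, hw⟩ v hv
  · exact hXB ⟨w, hwB, hw⟩ v hv

lemma conn_pair {G : SimpleGraph V} {u v : V} (h : G.Adj u v) : Conn G {u, v} := by
  refine ⟨⟨u, .inl rfl⟩, ?_⟩
  rintro X ⟨w, hw, hwX⟩ hX
  have h1 := hX u (.inl rfl)
  have h2 := hX v (.inr rfl)
  rcases hw with rfl | rfl
  · rintro _ (rfl | rfl)
    exacts [hwX, h1 hwX _ (.inr rfl) h]
  · rintro _ (rfl | rfl)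
    exacts [h2 hwX _ (.inl rfl) h.symm, hwX]

lemma Conn.union {G : SimpleGraph V} {A B : Set V} (hA : Conn G A) (hB : Conn G B)
    {u v : V} (hu : u ∈ A) (hv : v ∈ B) (h : G.Adj u v) : Conn G (A ∪ B) := by
  have := (hA.union_inter (conn_pair h) ⟨u, hu, .inl rfl⟩).union_inter hB ⟨v, .inr (.inr rfl), hv⟩
  convert this using 1
  ext w
  simp only [Set.mem_union, Set.mem_insert_iff, Set.mem_singleton_iff]
  constructor
  · tauto
  · rintro ((h | rfl | rfl) | h) <;> tauto

lemma Conn.insert {G : SimpleGraph V} {A : Set V} (hA : Conn G A) {u v : V} (hu : u ∈ A)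
    (h : G.Adj u v) : Conn G (insert v A) := by
  rw [Set.insert_eq, Set.union_comm]
  exact hA.union (conn_singleton G v) hu rfl h

/-- The connected component of `v` in `G[A]`. -/
def comp (G : SimpleGraph V) (A : Set V) (v : V) : Set V :=
  {w | Relation.ReflTransGen (fun x y => G.Adj x y ∧ y ∈ A) v w}

lemma mem_comp_self (G : SimpleGraph V) (A : Set V) (v : V) : v ∈ comp G A v := .refl

lemma comp_subset {G : SimpleGraph V} {A : Set V} {v : V} (hv : v ∈ A) : comp G A v ⊆ A := by
  intro w hw
  induction hw with
  | refl => exact hv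
  | tail _ h _ => exact h.2

lemma comp_closed {G : SimpleGraph V} {A : Set V} {v u w : V} (hu : u ∈ comp G A v)
    (h : G.Adj u w) (hw : w ∈ A) : w ∈ comp G A v := hu.tail ⟨h, hw⟩

lemma conn_comp (G : SimpleGraph V) (A : Set V) (v : V) : Conn G (comp G A v) := by
  have key : ∀ X : Set V,
      (∀ u ∈ comp G A v, u ∈ X → ∀ w ∈ comp G A v, G.Adj u w → w ∈ X) →
      ∀ u ∈ comp G A v, (v ∈ X ↔ u ∈ X) := by
    intro X hX u hu
    induction hu with
    | refl => exact Iff.rfl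
    | @tail b c hb h ih =>
      rw [ih]
      exact ⟨fun h' => hX b hb h' c (hb.tail h) h.1,
        fun h' => hX c (hb.tail h) h' b hb h.1.symm⟩
  refine ⟨⟨v, mem_comp_self G A v⟩, ?_⟩
  rintro X ⟨u, hu, huX⟩ hX w hw
  exact (key X hX w hw).1 ((key X hX u hu).2 huX)

lemma Conn.subset_comp {G : SimpleGraph V} {A C : Set V} {v : V} (hC : Conn G C) (hCA : C ⊆ A)
    (hv : v ∈ C) : C ⊆ comp G A v :=
  fun w hw => hC.2 (comp G A v) ⟨v, hv, mem_comp_self G A v⟩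
    (fun _ _ hx _ hy hxy => comp_closed hx hxy (hCA hy)) w hw

/-- A connected set that meets `X` but is not contained in it has an edge leaving `X`. -/
lemma Conn.exists_adj {G : SimpleGraph V} {A X : Set V} (hA : Conn G A) {u w : V} (hu : u ∈ A)
    (huX : u ∈ X) (hw : w ∈ A) (hwX : w ∉ X) :
    ∃ x ∈ A, x ∈ X ∧ ∃ y ∈ A, y ∉ X ∧ G.Adj x y := by
  by_contra! h
  exact hwX (hA.2 X ⟨u, hu, huX⟩ (fun x hx hxX y hy hxy => by
    by_contra hyX
    exact h x hx hxX y hy hyX hxy) w hw)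

lemma exists_split_of_not_conn {G : SimpleGraph V} {A : Set V} (hne : A.Nonempty)
    (h : ¬ Conn G A) : ∃ C : Set V, C ⊆ A ∧ C.Nonempty ∧ (A \ C).Nonempty ∧ Conn G C ∧
      ∀ u ∈ C, ∀ v ∈ A, G.Adj u v → v ∈ C := by
  obtain ⟨v, hv⟩ := hne
  refine ⟨comp G A v, comp_subset hv, ⟨v, mem_comp_self G A v⟩, ?_, conn_comp G A v,
    fun u hu w hw huw => comp_closed hu huw hw⟩
  rw [Set.nonempty_iff_ne_empty]
  intro h'
  apply h
  rw [← (comp_subset hv).antisymm (Set.sdiff_eq_empty.1 h')]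
  exact conn_comp G A v

lemma conn_iff_induce {G : SimpleGraph V} {A : Set V} : Conn G A ↔ (G.induce A).Connected := by
  constructor
  · intro h
    obtain ⟨v, hv⟩ := h.1
    have : Nonempty A := ⟨⟨v, hv⟩⟩
    refine SimpleGraph.Connected.mk fun x y => ?_
    have := h.2 {w | ∃ hw : w ∈ A, (G.induce A).Reachable x ⟨w, hw⟩} ⟨x, x.2, x.2, .rfl⟩
      (fun u hu ⟨_, hux⟩ v hv huv => ⟨hv, hux.trans (SimpleGraph.Adj.reachable
          (by simpa using huv))⟩)
      y y.2
    exact this.2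
  · intro h
    obtain ⟨v⟩ := h.nonempty
    refine ⟨⟨v, v.2⟩, ?_⟩
    rintro X ⟨u, hu, huX⟩ hX w hw
    obtain ⟨p⟩ := h.preconnected ⟨u, hu⟩ ⟨w, hw⟩
    have : ∀ x y : A, (G.induce A).Walk x y → x.1 ∈ X → y.1 ∈ X := by
      intro x y p
      induction p with
      | nil => exact id
      | cons h p ih => exact fun hx => ih (hX _ (Subtype.prop _) hx _ (Subtype.prop _) h)
    exact this _ _ p huX

/-- `B` is a model of `H` as a minor of `G`. -/
structure IsModel (H : SimpleGraph ι) (G : SimpleGraph V) (B : ι → Set V) : Prop where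
  disj : ∀ i j v, v ∈ B i → v ∈ B j → i = j
  conn : ∀ i, Conn G (B i)
  adj : ∀ i j, H.Adj i j → ∃ u ∈ B i, ∃ v ∈ B j, G.Adj u v

/-- The complete bipartite graph `K₃,₃`. -/
def K33 : SimpleGraph (Fin 6) where
  Adj i j := (i < 3 ∧ 3 ≤ j) ∨ (j < 3 ∧ 3 ≤ i)
  symm := ⟨fun _ _ h => h.symm⟩
  loopless := ⟨fun i h => by omega⟩

/-- `G` has neither `K₅` nor `K₃,₃` as a minor. -/
def Free (G : SimpleGraph V) : Prop :=
  (∀ B, ¬ IsModel (⊤ : SimpleGraph (Fin 5)) G B) ∧ ∀ B, ¬ IsModel K33 G B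

/-- The properties of `K₅` and `K₃,₃` needed for gluing along small separators. -/
structure IsObstruction (H : SimpleGraph ι) : Prop where
  three : ∀ i, ∃ a b c, a ≠ b ∧ a ≠ c ∧ b ≠ c ∧ H.Adj i a ∧ H.Adj i b ∧ H.Adj i c
  four : ∀ i j k, H.Adj i j → H.Adj i k → H.Adj j k →
    ∃ a b, a ≠ b ∧ a ≠ j ∧ a ≠ k ∧ b ≠ j ∧ b ≠ k ∧ H.Adj i a ∧ H.Adj i b
  cross : ∀ i i' j j', i ≠ i' → i ≠ j → i ≠ j' → i' ≠ j → i' ≠ j' → j ≠ j' →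
    ∃ x y x' y', (x = i ∨ x = i') ∧ (y = j ∨ y = j') ∧ (x' = i ∨ x' = i') ∧ (y' = j ∨ y' = j') ∧
      (x ≠ x' ∨ y ≠ y') ∧ H.Adj x y ∧ H.Adj x' y'

lemma isObstruction_five : IsObstruction (⊤ : SimpleGraph (Fin 5)) where
  three := by decide
  four := by decide
  cross i i' j j' h1 h2 h3 h4 h5 h6 := ⟨i, j, i', j', by tauto, by tauto, by tauto, by tauto,
    .inl h1, h2, h5⟩

instance : DecidableRel K33.Adj := fun i j =>
  inferInstanceAs (Decidable ((i < 3 ∧ 3 ≤ j) ∨ (j < 3 ∧ 3 ≤ i)))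

set_option maxRecDepth 4000 in
lemma isObstruction_three_three : IsObstruction K33 where
  three := by decide
  four i j k h1 h2 h3 := by
    simp only [K33] at h1 h2 h3; omega
  cross i i' j j' h1 h2 h3 h4 h5 h6 := by
    have key : (K33.Adj i j ∧ K33.Adj i j') ∨ (K33.Adj i j ∧ K33.Adj i' j) ∨
        (K33.Adj i j ∧ K33.Adj i' j') ∨ (K33.Adj i j' ∧ K33.Adj i' j) ∨
        (K33.Adj i j' ∧ K33.Adj i' j') ∨ (K33.Adj i' j ∧ K33.Adj i' j') := by
      have e1 : ¬(i < 3 ∧ i' < 3 ∧ j < 3 ∧ j' < 3) := by omega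
      have e2 : ¬(3 ≤ i ∧ 3 ≤ i' ∧ 3 ≤ j ∧ 3 ≤ j') := by omega
      simp only [K33, ← not_lt] at e2 ⊢
      by_cases a : i < 3 <;> by_cases b : i' < 3 <;> by_cases c : j < 3 <;> by_cases d : j' < 3 <;>
        simp_all
    rcases key with h | h | h | h | h | h
    · exact ⟨i, j, i, j', by tauto, by tauto, by tauto, by tauto, by tauto, h⟩
    · exact ⟨i, j, i', j, by tauto, by tauto, by tauto, by tauto, by tauto, h⟩
    · exact ⟨i, j, i', j', by tauto, by tauto, by tauto, by tauto, by tauto, h⟩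
    · exact ⟨i, j', i', j, by tauto, by tauto, by tauto, by tauto, by tauto, h⟩
    · exact ⟨i, j', i', j', by tauto, by tauto, by tauto, by tauto, by tauto, h⟩
    · exact ⟨i', j, i', j', by tauto, by tauto, by tauto, by tauto, by tauto, h⟩

/-- If obstructions of `G` give obstructions of `G'`, then freeness is inherited. -/
lemma Free.of_models {G : SimpleGraph V} {G' : SimpleGraph W} (h : Free G')
    (key : ∀ {k : ℕ} {H : SimpleGraph (Fin k)} {B : Fin k → Set V}, IsObstruction H →
      IsModel H G B → ∃ B', IsModel H G' B') : Free G :=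
  ⟨fun _ hB => (key isObstruction_five hB).elim fun B' hB' => h.1 B' hB',
    fun _ hB => (key isObstruction_three_three hB).elim fun B' hB' => h.2 B' hB'⟩

lemma IsModel.mono {H : SimpleGraph ι} {G G' : SimpleGraph V} {B : ι → Set V}
    (hB : IsModel H G B) (h : G ≤ G') : IsModel H G' B :=
  ⟨hB.disj, fun i => (hB.conn i).mono h, fun i j hij =>
    let ⟨u, hu, v, hv, huv⟩ := hB.adj i j hij; ⟨u, hu, v, hv, h huv⟩⟩

lemma Free.mono {G G' : SimpleGraph V} (hG : Free G') (h : G ≤ G') : Free G :=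
  hG.of_models fun _ hB => ⟨_, hB.mono h⟩

lemma IsModel.exists_adj {H : SimpleGraph ι} (hH : IsObstruction H) {G : SimpleGraph V}
    {B : ι → Set V} (hB : IsModel H G B) {i : ι} {v : V} (hv : v ∈ B i) : ∃ w, G.Adj v w := by
  by_cases h : ∀ w ∈ B i, w = v
  · obtain ⟨j, _, _, _, _, _, hj, _⟩ := hH.three i
    obtain ⟨u, hu, w, -, huw⟩ := hB.adj i j hj
    exact ⟨w, h u hu ▸ huw⟩
  · push Not at h
    obtain ⟨w, hw, hwv⟩ := h
    obtain ⟨x, -, hx, y, -, -, hxy⟩ := (hB.conn i).exists_adj (X := {v}) hv rfl hw hwv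
    exact ⟨y, Set.mem_singleton_iff.1 hx ▸ hxy⟩

/-- Freeness is inherited by minors. -/
lemma Free.of_minor {G : SimpleGraph V} {J : SimpleGraph W} (hG : Free G) (F : W → Set V)
    (hF : ∀ w w', J.Adj w w' → Conn G (F w))
    (hdisj : ∀ w w' v, v ∈ F w → v ∈ F w' → w = w')
    (hadj : ∀ w w', J.Adj w w' → ∃ u ∈ F w, ∃ v ∈ F w', G.Adj u v) : Free J := by
  refine hG.of_models fun {k H B} hH hB => ⟨fun i => ⋃ w ∈ B i, F w, ⟨?_, ?_, ?_⟩⟩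
  · intro i j v hi hj
    obtain ⟨w, hw, hvw⟩ := Set.mem_iUnion₂.1 hi
    obtain ⟨w', hw', hvw'⟩ := Set.mem_iUnion₂.1 hj
    exact hB.disj i j w hw (hdisj w w' v hvw hvw' ▸ hw')
  · intro i
    refine conn_biUnion (hB.conn i) F (fun w hw => ?_) (fun w _ w' _ => hadj w w')
    obtain ⟨w', h⟩ := hB.exists_adj hH hw
    exact hF w w' h
  · intro i j hij
    obtain ⟨w, hw, w', hw', hww'⟩ := hB.adj i j hij
    obtain ⟨u, hu, v, hv, huv⟩ := hadj w w' hww'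
    exact ⟨u, Set.mem_biUnion hw hu, v, Set.mem_biUnion hw' hv, huv⟩

end Minors

end OnePlanarity

namespace OnePlanarity

section Sweep

variable {V E : Type}

/-- A sweep: the records `(v, d, u)` of `l` successively replace the consecutive block `d` of the
current list of edges by the block `u`. -/
inductive Run : List (V × List E × List E) → List E → List E → Prop
  | nil (C : List E) : Run [] C C
  | cons {v : V} {d u L R : List E} {l : List (V × List E × List E)} {C' : List E} :
      Run l (L ++ u ++ R) C' → Run ((v, d, u) :: l) (L ++ d ++ R) C'

/-- The edge `e` of a sweep is present at height `y`. -/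
def Alive (l : List (V × List E × List E)) (C : List E) (h : V → ℝ) (e : E) (y : ℝ) : Prop :=
  (e ∈ C ∨ ∃ r ∈ l, e ∈ r.2.2 ∧ h r.1 < y) ∧ ∀ r ∈ l, e ∈ r.2.1 → y < h r.1

/-- A geometric realization of a sweep in the half-plane above height `0`. -/
structure Geo [DecidableEq E] (l : List (V × List E × List E)) (C : List E) (X h : V → ℝ)
    (f : E → ℝ → ℝ) : Prop where
  cont : ∀ e, Continuous (f e)
  start : ∀ e ∈ C, f e 0 = C.idxOf e
  height_pos : ∀ r ∈ l, 0 < h r.1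
  height_lt : l.Pairwise fun r r' => h r.1 < h r'.1
  down : ∀ r ∈ l, ∀ e ∈ r.2.1, f e (h r.1) = X r.1
  up : ∀ r ∈ l, ∀ e ∈ r.2.2, f e (h r.1) = X r.1
  down_alive : ∀ r ∈ l, ∀ e ∈ r.2.1, e ∈ C ∨ ∃ r' ∈ l, e ∈ r'.2.2 ∧ h r'.1 < h r.1
  sep : ∀ e e' y, 0 ≤ y → e ≠ e' → Alive l C h e y → Alive l C h e' y → f e y ≠ f e' y
  sep_vertex : ∀ r ∈ l, ∀ e, Alive l C h e (h r.1) → f e (h r.1) ≠ X r.1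

open Classical in
/-- The horizontal position of an edge at the height of the vertex being swept. -/
noncomputable def midPos (L R : List E) (w : ℝ) (e : E) : ℝ :=
  if e ∈ L then L.idxOf e else if e ∈ R then L.length + w + R.idxOf e else L.length - 1 / 2

lemma midPos_left [DecidableEq E] {L R : List E} {w : ℝ} {e : E} (h : e ∈ L) :
    midPos L R w e = L.idxOf e := by
  simp only [midPos, if_pos h]
  congr!

lemma midPos_right [DecidableEq E] {L R : List E} {w : ℝ} {e : E} (h : e ∉ L) (h' : e ∈ R) :
    midPos L R w e = L.length + w + R.idxOf e := by
  simp only [midPos, if_neg h, if_pos h']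
  congr!

lemma midPos_mid {L R : List E} {w : ℝ} {e : E} (h : e ∉ L) (h' : e ∉ R) :
    midPos L R w e = L.length - 1 / 2 := by
  simp only [midPos, if_neg h, if_neg h']

lemma midPos_ne {L R : List E} {w : ℝ} (hw : 0 ≤ w) {e : E} (h : e ∈ L ∨ e ∈ R) :
    midPos L R w e ≠ L.length - 1 / 2 := by
  classical
  by_cases hL : e ∈ L
  · rw [midPos_left hL]
    have : L.idxOf e + 1 ≤ L.length := List.idxOf_lt_length_of_mem hL
    have : (L.idxOf e : ℝ) + 1 ≤ L.length := by exact_mod_cast this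
    intro h; linarith
  · rw [midPos_right hL (h.resolve_left hL)]
    have : (0 : ℝ) ≤ R.idxOf e := Nat.cast_nonneg _
    intro h; linarith

lemma midPos_le [DecidableEq E] {L D R : List E} {w : ℝ} (hw : 0 ≤ w) (hn : (L ++ D ++ R).Nodup)
    {e e' : E} (he : e ∈ L ++ D ++ R) (he' : e' ∈ L ++ D ++ R)
    (hlt : (L ++ D ++ R).idxOf e < (L ++ D ++ R).idxOf e') :
    midPos L R w e ≤ midPos L R w e' ∧ (e ∉ D → e' ∉ D → midPos L R w e < midPos L R w e') := by
  have key : ∀ e ∈ L ++ D ++ R,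
      (e ∈ L ∧ e ∉ D ∧ (L ++ D ++ R).idxOf e = L.idxOf e ∧ L.idxOf e < L.length ∧
        midPos L R w e = L.idxOf e) ∨
      (e ∈ D ∧ (L ++ D ++ R).idxOf e = L.length + D.idxOf e ∧ D.idxOf e < D.length ∧
        midPos L R w e = L.length - 1 / 2) ∨
      (e ∈ R ∧ e ∉ D ∧ (L ++ D ++ R).idxOf e = L.length + D.length + R.idxOf e ∧
        midPos L R w e = L.length + w + R.idxOf e) := by
    intro e he
    rw [List.nodup_append, List.nodup_append] at hn
    obtain ⟨⟨-, -, hLD⟩, -, hR⟩ := hn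
    by_cases hL : e ∈ L
    · exact .inl ⟨hL, fun hD => hLD e hL e hD rfl, by rw [List.append_assoc,
        List.idxOf_append_of_mem hL],
        List.idxOf_lt_length_of_mem hL, midPos_left hL⟩
    · by_cases hD : e ∈ D
      · refine .inr (.inl ⟨hD, ?_, List.idxOf_lt_length_of_mem hD, midPos_mid hL fun h =>
          hR e (List.mem_append.2 (.inr hD)) e h rfl⟩)
        rw [List.append_assoc, List.idxOf_append_of_notMem hL, List.idxOf_append_of_mem hD]
      · have h : e ∈ R := by simpa [hL, hD] using he
        refine .inr (.inr ⟨h, hD, ?_, midPos_right hL h⟩)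
        rw [List.append_assoc, List.idxOf_append_of_notMem hL, List.idxOf_append_of_notMem hD]
        omega
  rcases key e he with ⟨h1, h1', h2, h3, h4⟩ | ⟨h1, h2, h3, h4⟩ | ⟨h1, h1', h2, h4⟩ <;>
  rcases key e' he' with ⟨k1, k1', k2, k3, k4⟩ | ⟨k1, k2, k3, k4⟩ | ⟨k1, k1', k2, k4⟩ <;>
  rw [h2, k2] at hlt <;> rw [h4, k4] <;> try (exfalso; omega)
  · have : (L.idxOf e : ℝ) < L.idxOf e' := by exact_mod_cast hlt
    exact ⟨this.le, fun _ _ => this⟩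
  · have : (L.idxOf e : ℝ) + 1 ≤ L.length := by exact_mod_cast h3
    exact ⟨by linarith, fun _ h => absurd k1 h⟩
  · have : (L.idxOf e : ℝ) + 1 ≤ L.length := by exact_mod_cast h3
    have h0 : (0 : ℝ) ≤ R.idxOf e' := Nat.cast_nonneg _
    exact ⟨by linarith, fun _ _ => by linarith⟩
  · exact ⟨le_rfl, fun h => absurd h1 h⟩
  · have h0 : (0 : ℝ) ≤ R.idxOf e' := Nat.cast_nonneg _
    exact ⟨by linarith, fun h => absurd h1 h⟩
  · have : R.idxOf e < R.idxOf e' := by omega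
    have : (R.idxOf e : ℝ) < R.idxOf e' := by exact_mod_cast this
    exact ⟨by linarith, fun _ _ => by linarith⟩

lemma midPos_sep [DecidableEq E] {L D R : List E} {w : ℝ} (hw : 0 ≤ w) (hn : (L ++ D ++ R).Nodup)
    {e e' : E} (hne : e ≠ e') (he : e ∈ L ++ D ++ R) (he' : e' ∈ L ++ D ++ R) {t : ℝ} (h0 : 0 ≤ t)
    (ht : 0 < t ∨ (e ∉ D ∧ e' ∉ D)) (h1 : t ≤ 1) :
    (1 - t) * midPos L R w e + t * (L ++ D ++ R).idxOf e ≠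
      (1 - t) * midPos L R w e' + t * (L ++ D ++ R).idxOf e' := by
  have key : ∀ {e e' : E}, e ∈ L ++ D ++ R → e' ∈ L ++ D ++ R →
      (L ++ D ++ R).idxOf e < (L ++ D ++ R).idxOf e' → (0 < t ∨ (e ∉ D ∧ e' ∉ D)) →
      (1 - t) * midPos L R w e + t * (L ++ D ++ R).idxOf e <
      (1 - t) * midPos L R w e' + t * (L ++ D ++ R).idxOf e' := by
    intro e e' he he' hlt ht
    obtain ⟨h2, h3⟩ := midPos_le hw hn he he' hlt
    have h4 : ((L ++ D ++ R).idxOf e : ℝ) < (L ++ D ++ R).idxOf e' := by exact_mod_cast hlt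
    rcases h0.lt_or_eq with h0 | rfl
    · have := mul_le_mul_of_nonneg_left h2 (sub_nonneg.2 h1)
      have := mul_lt_mul_of_pos_left h4 h0
      linarith
    · obtain ⟨hd, hd'⟩ := ht.resolve_left (lt_irrefl _)
      simpa using h3 hd hd'
  rcases lt_trichotomy ((L ++ D ++ R).idxOf e) ((L ++ D ++ R).idxOf e') with h | h | h
  · exact (key he he' h ht).ne
  · exact absurd ((List.idxOf_inj he).1 h) hne
  · exact (key he' he h (ht.imp id And.symm)).ne'

lemma Run.exists_geo [DecidableEq V] [DecidableEq E] {l : List (V × List E × List E)}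
    {C C' : List E}
    (hr : Run l C C') (hn : (C ++ l.flatMap fun r => r.2.2).Nodup) (hv : (l.map Prod.fst).Nodup) :
    ∃ X h f, Geo l C X h f := by
  induction hr with
  | nil C =>
    refine ⟨0, 0, fun e _ => C.idxOf e, fun _ => continuous_const, fun _ _ => rfl, by simp, by simp,
      by simp, by simp, by simp, ?_, by simp⟩
    intro e e' y _ hne he he' heq
    have he : e ∈ C := by simpa [Alive] using he
    exact hne ((List.idxOf_inj he).1 (by exact_mod_cast heq))
  | @cons v d u L R l C' hr ih =>
    have hn1 : (L ++ u ++ R ++ l.flatMap fun r => r.2.2).Nodup := by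
      rw [List.nodup_iff_count_le_one] at hn ⊢
      intro a
      have := hn a
      simp only [List.flatMap_cons, List.count_append] at this ⊢
      omega
    simp only [List.map_cons, List.nodup_cons] at hv
    obtain ⟨X, h, f, g⟩ := ih hn1 hv.2
    have hnC : (L ++ d ++ R).Nodup := (List.nodup_append.1 hn).1
    have hnC1 : (L ++ u ++ R).Nodup := (List.nodup_append.1 hn1).1
    have hdu : ∀ e ∈ d, e ∉ u := fun e hed heu => (List.nodup_append.1 hn).2.2 e
      (by simp [hed]) e (by simp [heu]) rfl
    have hvl : ∀ r ∈ l, r.1 ≠ v := fun r hr hrv => hv.1 (hrv ▸ List.mem_map_of_mem hr)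
    have hw : (0 : ℝ) ≤ ((d.length : ℝ) + u.length) / 2 := by positivity
    set w : ℝ := ((d.length : ℝ) + u.length) / 2 with hwdef
    let s : E → ℝ := fun e => ((L ++ d ++ R).idxOf e : ℝ)
    let m : E → ℝ := midPos L R w
    let F : E → ℝ → ℝ := fun e y =>
      if y ≤ 1 / 2 then (1 - (1 - 2 * y)) * m e + (1 - 2 * y) * s e
      else if y ≤ 1 then (1 - (2 * y - 1)) * m e + (2 * y - 1) * f e 0 else f e (y - 1)
    have F1 : ∀ e y, y ≤ 1 / 2 → F e y = (1 - (1 - 2 * y)) * m e + (1 - 2 * y) * s e :=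
      fun e y hy => if_pos hy
    have F2 : ∀ e y, 1 / 2 ≤ y → y ≤ 1 → F e y = (1 - (2 * y - 1)) * m e + (2 * y - 1) * f e 0 := by
      intro e y hy hy1
      rcases hy.lt_or_eq with hy | rfl
      · simp only [F]; rw [if_neg (not_le.2 hy), if_pos hy1]
      · rw [F1 _ _ le_rfl]; ring
    have F3 : ∀ e y, 1 ≤ y → F e y = f e (y - 1) := by
      intro e y hy
      rcases hy.lt_or_eq with hy | rfl
      · simp only [F]; rw [if_neg (not_le.2 (by linarith)), if_neg (not_le.2 hy)]
      · rw [F2 _ _ (by norm_num) le_rfl]; norm_num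
    let h' : V → ℝ := Function.update (fun z => h z + 1) v (1 / 2)
    let X' : V → ℝ := Function.update X v (L.length - 1 / 2)
    have hv' : h' v = 1 / 2 := Function.update_self ..
    have Xv' : X' v = L.length - 1 / 2 := Function.update_self ..
    have hl' : ∀ r ∈ l, h' r.1 = h r.1 + 1 := fun r hr => Function.update_of_ne (hvl r hr) ..
    have Xl' : ∀ r ∈ l, X' r.1 = X r.1 := fun r hr => Function.update_of_ne (hvl r hr) ..
    have mu : ∀ e, e ∉ L → e ∉ R → m e = L.length - 1 / 2 := fun e => midPos_mid
    have hdLR : ∀ e ∈ d, e ∉ L ∧ e ∉ R := by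
      intro e he
      simp only [List.nodup_append, List.mem_append] at hnC
      exact ⟨fun h => hnC.1.2.2 e h e he rfl, fun h => hnC.2.2 e (.inr he) e h rfl⟩
    have huLR : ∀ e ∈ u, e ∉ L ∧ e ∉ R := by
      intro e he
      simp only [List.nodup_append, List.mem_append] at hnC1
      exact ⟨fun h => hnC1.1.2.2 e h e he rfl, fun h => hnC1.2.2 e (.inr he) e h rfl⟩
    have al : ∀ e y, Alive ((v, d, u) :: l) (L ++ d ++ R) h' e y → 1 ≤ y →
        Alive l (L ++ u ++ R) h e (y - 1) := by
      rintro e y ⟨ha, hb⟩ hy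
      refine ⟨?_, fun r hr her => ?_⟩
      · rcases ha with ha | ⟨r, hr, her, hlt⟩
        · have : e ∉ d := fun hed => by
            have := hb _ (List.mem_cons_self ..) hed
            simp only [hv'] at this; linarith
          left; simp only [List.mem_append] at ha ⊢; tauto
        · rcases List.mem_cons.1 hr with rfl | hr
          · left; simp only [List.mem_append]; tauto
          · exact .inr ⟨r, hr, her, by rw [hl' r hr] at hlt; linarith⟩
      · have := hb r (List.mem_cons_of_mem _ hr) her
        rw [hl' r hr] at this; linarith
    have al1 : ∀ e y, Alive ((v, d, u) :: l) (L ++ d ++ R) h' e y → y ≤ 1 / 2 →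
        e ∈ L ++ d ++ R ∧ (y = 1 / 2 → e ∉ d) := by
      rintro e y ⟨ha, hb⟩ hy
      refine ⟨?_, fun hy hed => ?_⟩
      · rcases ha with ha | ⟨r, hr, her, hlt⟩
        · exact ha
        · exfalso
          rcases List.mem_cons.1 hr with rfl | hr
          · simp only [hv'] at hlt; linarith
          · rw [hl' r hr] at hlt
            have := g.height_pos r hr; linarith
      · have := hb _ (List.mem_cons_self ..) hed
        simp only [hv'] at this; linarith
    have al2 : ∀ e y, Alive ((v, d, u) :: l) (L ++ d ++ R) h' e y → 1 / 2 ≤ y → y ≤ 1 →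
        e ∈ L ++ u ++ R := by
      rintro e y ⟨ha, hb⟩ hy hy1
      rcases ha with ha | ⟨r, hr, her, hlt⟩
      · have : e ∉ d := fun hed => by
          have := hb _ (List.mem_cons_self ..) hed
          simp only [hv'] at this; linarith
        simp only [List.mem_append] at ha ⊢; tauto
      · rcases List.mem_cons.1 hr with rfl | hr
        · simp only [List.mem_append]; tauto
        · rw [hl' r hr] at hlt
          have := g.height_pos r hr; linarith
    refine ⟨X', h', F, ?_, ?_, ?_, ?_, ?_, ?_, ?_, ?_, ?_⟩
    · intro e
      have hc := g.cont e
      refine Continuous.if_le (by fun_prop) ?_ continuous_id continuous_const ?_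
      · refine Continuous.if_le (by fun_prop) (by fun_prop) continuous_id continuous_const ?_
        rintro y rfl; norm_num
      · rintro y rfl; norm_num
    · intro e he
      rw [F1 _ _ (by norm_num)]; simp [s]
    · intro r hr
      rcases List.mem_cons.1 hr with rfl | hr
      · rw [hv']; norm_num
      · rw [hl' r hr]; have := g.height_pos r hr; linarith
    · refine List.Pairwise.cons ?_ (g.height_lt.imp_of_mem fun {r r'} hr hr' hlt => ?_)
      · intro r hr
        rw [hv', hl' r hr]; have := g.height_pos r hr; linarith
      · rw [hl' r hr, hl' r' hr']; linarith
    · intro r hr e her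
      rcases List.mem_cons.1 hr with rfl | hr
      · obtain ⟨h1, h2⟩ := hdLR e her
        rw [hv', F1 _ _ le_rfl, Xv', mu e h1 h2]; ring
      · rw [hl' r hr, Xl' r hr, F3 _ _ (by have := g.height_pos r hr; linarith),
          add_sub_cancel_right, g.down r hr e her]
    · intro r hr e her
      rcases List.mem_cons.1 hr with rfl | hr
      · obtain ⟨h1, h2⟩ := huLR e her
        rw [hv', F1 _ _ le_rfl, Xv', mu e h1 h2]; ring
      · rw [hl' r hr, Xl' r hr, F3 _ _ (by have := g.height_pos r hr; linarith),
          add_sub_cancel_right, g.up r hr e her]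
    · intro r hr e her
      rcases List.mem_cons.1 hr with rfl | hr
      · left; simp only [List.mem_append]; tauto
      · rcases g.down_alive r hr e her with hC | ⟨r', hr', her', hlt⟩
        · by_cases heu : e ∈ u
          · refine .inr ⟨_, List.mem_cons_self .., heu, ?_⟩
            rw [hv', hl' r hr]; have := g.height_pos r hr; linarith
          · left; simp only [List.mem_append] at hC ⊢; tauto
        · exact .inr ⟨r', List.mem_cons_of_mem _ hr', her', by rw [hl' r hr, hl' r' hr']; linarith⟩
    · intro e e' y hy0 hne ha ha'
      rcases le_total y (1 / 2) with hy | hy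
      · rw [F1 _ _ hy, F1 _ _ hy]
        obtain ⟨hm, hd⟩ := al1 e y ha hy
        obtain ⟨hm', hd'⟩ := al1 e' y ha' hy
        refine midPos_sep hw hnC hne hm hm' (by linarith) ?_ (by linarith)
        rcases hy.lt_or_eq with hy | hy
        · left; linarith
        · exact .inr ⟨hd hy, hd' hy⟩
      · rcases le_total y 1 with hy1 | hy1
        · have hm := al2 e y ha hy hy1
          have hm' := al2 e' y ha' hy hy1
          rw [F2 _ _ hy hy1, F2 _ _ hy hy1, g.start e hm, g.start e' hm']
          refine midPos_sep hw hnC1 hne hm hm' (by linarith) ?_ (by linarith)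
          rcases hy.lt_or_eq with hy | hy
          · left; linarith
          · obtain ⟨hd, hd1⟩ := al1 e y ha hy.ge
            obtain ⟨hd', hd1'⟩ := al1 e' y ha' hy.ge
            have hd1 := hd1 hy.symm
            have hd1' := hd1' hy.symm
            refine .inr ⟨fun h => ?_, fun h => ?_⟩
            · have := huLR e h; simp only [List.mem_append] at hd; tauto
            · have := huLR e' h; simp only [List.mem_append] at hd'; tauto
        · rw [F3 _ _ hy1, F3 _ _ hy1]
          exact g.sep e e' _ (by linarith) hne (al e y ha hy1) (al e' y ha' hy1)
    · intro r hr e ha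
      rcases List.mem_cons.1 hr with rfl | hr
      · simp only [hv', Xv'] at ha ⊢
        obtain ⟨hd, hd1⟩ := al1 e _ ha le_rfl
        have hd1 := hd1 rfl
        rw [F1 _ _ le_rfl]
        have := midPos_ne (L := L) (R := R) hw (e := e) (by
          simp only [List.mem_append] at hd; tauto)
        intro h; apply this; rw [← h]; ring
      · have h1 : 1 ≤ h' r.1 := by
          rw [hl' r hr]; have := g.height_pos r hr; linarith
        have := al e _ ha h1
        rw [hl' r hr] at h1 this ⊢
        rw [F3 _ _ h1, Xl' r hr]
        rw [add_sub_cancel_right] at this ⊢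
        exact g.sep_vertex r hr e this

end Sweep

end OnePlanarity

namespace OnePlanarity

section Curves

lemma IsArc.symm {A : Set (ℝ × ℝ)} {x y : ℝ × ℝ} (h : IsArc A x y) : IsArc A y x := by
  obtain ⟨f, hf, hi, h0, h1, hr⟩ := h
  refine ⟨f ∘ unitInterval.symm, hf.comp unitInterval.continuous_symm,
    hi.comp unitInterval.symm_bijective.injective, by simpa using h1, by simpa using h0, ?_⟩
  rw [Set.range_comp, unitInterval.symm_bijective.surjective.range_eq, Set.image_univ, hr]

lemma isArc_graph {g : ℝ → ℝ} (hg : Continuous g) {a b : ℝ} (h : a < b) :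
    IsArc ((fun y => (g y, y)) '' Set.Icc a b) (g a, a) (g b, b) := by
  have hb : 0 < b - a := sub_pos.2 h
  refine ⟨fun t => (g (a + t * (b - a)), a + t * (b - a)), by fun_prop, fun s t hst => ?_,
    by simp, by simp, ?_⟩
  · have := congrArg Prod.snd hst
    simp only [add_right_inj] at this
    exact Subtype.ext (mul_right_cancel₀ hb.ne' this)
  · ext p
    constructor
    · rintro ⟨t, rfl⟩
      exact ⟨_, ⟨by nlinarith [t.2.1], by nlinarith [t.2.2]⟩, rfl⟩
    · rintro ⟨y, ⟨h1, h2⟩, rfl⟩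
      have hy : a + (y - a) / (b - a) * (b - a) = y := by field_simp; ring
      exact ⟨⟨(y - a) / (b - a), div_nonneg (by linarith) hb.le, (div_le_one hb).2 (by linarith)⟩,
          by simp [hy]⟩

/-- A curve can be reparametrized over the line, with its ends at the two ends of `[0, 1]`. -/
lemma IsArc.exists_param {A : Set (ℝ × ℝ)} {x y : ℝ × ℝ} (h : IsArc A x y) :
    ∃ F : ℝ → ℝ × ℝ, Continuous F ∧ Set.InjOn F (Set.Icc 0 1) ∧ F 0 = x ∧ F 1 = y ∧
      F '' Set.Icc 0 1 = A := by
  obtain ⟨f, hf, hi, h0, h1, hr⟩ := h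
  have hF : ∀ t (ht : t ∈ Set.Icc (0 : ℝ) 1), Set.projIcc 0 1 zero_le_one t = ⟨t, ht⟩ :=
    fun t ht => Set.projIcc_of_mem _ ht
  refine ⟨fun t => f (Set.projIcc 0 1 zero_le_one t), hf.comp continuous_projIcc,
    fun s hs t ht hst => ?_, ?_, ?_, ?_⟩
  · simp only [hF s hs, hF t ht] at hst
    exact congrArg Subtype.val (hi hst)
  · simpa using h0
  · simpa using h1
  · rw [← hr]
    ext p
    constructor
    · rintro ⟨t, ht, rfl⟩
      exact ⟨_, rfl⟩
    · rintro ⟨t, rfl⟩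
      exact ⟨t, t.2, by simp [hF t t.2]⟩

lemma isArc_of_param {F : ℝ → ℝ × ℝ} (hc : Continuous F) (hi : Set.InjOn F (Set.Icc 0 1)) :
    IsArc (F '' Set.Icc 0 1) (F 0) (F 1) :=
  ⟨fun t => F t, hc.comp continuous_subtype_val, fun s t hst => Subtype.ext (hi s.2 t.2 hst),
    by simp, by simp, by ext p; simp⟩

lemma IsArc.left_mem {A : Set (ℝ × ℝ)} {x y : ℝ × ℝ} (h : IsArc A x y) : x ∈ A := by
  obtain ⟨f, -, -, h0, -, hr⟩ := h
  exact hr ▸ ⟨0, h0⟩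

lemma IsArc.trans {A B : Set (ℝ × ℝ)} {x y z : ℝ × ℝ} (hA : IsArc A x y) (hB : IsArc B y z)
    (hAB : A ∩ B ⊆ {y}) : IsArc (A ∪ B) x z := by
  obtain ⟨F, hFc, hFi, hF0, hF1, hFr⟩ := hA.exists_param
  obtain ⟨K, hKc, hKi, hK0, hK1, hKr⟩ := hB.exists_param
  set M : ℝ → ℝ × ℝ := fun t => if t ≤ 1 / 2 then F (2 * t) else K (2 * t - 1) with hM
  have hMc : Continuous M := by
    refine Continuous.if_le (by fun_prop) (by fun_prop) (by fun_prop) (by fun_prop) ?_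
    rintro t rfl
    norm_num [hF1, hK0]
  have hMF : ∀ t ∈ Set.Icc (0 : ℝ) 1, t ≤ 1 / 2 → M t = F (2 * t) ∧ M t ∈ A := by
    intro t ht h
    have : M t = F (2 * t) := if_pos h
    exact ⟨this, this ▸ hFr ▸ ⟨_, ⟨by linarith [ht.1], by linarith⟩, rfl⟩⟩
  have hMK : ∀ t ∈ Set.Icc (0 : ℝ) 1, ¬ t ≤ 1 / 2 → M t = K (2 * t - 1) ∧ M t ∈ B := by
    intro t ht h
    have : M t = K (2 * t - 1) := if_neg h
    exact ⟨this, this ▸ hKr ▸ ⟨_, ⟨by linarith, by linarith [ht.2]⟩, rfl⟩⟩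
  have key : ∀ s ∈ Set.Icc (0 : ℝ) 1, ∀ t ∈ Set.Icc (0 : ℝ) 1, s ≤ 1 / 2 → ¬ t ≤ 1 / 2 →
      M s ≠ M t := by
    intro s hs t ht h h' hst
    have hy : M t = y := hAB ⟨hst ▸ (hMF s hs h).2, (hMK t ht h').2⟩
    rw [(hMK t ht h').1, ← hK0] at hy
    have := hKi ⟨by linarith, by linarith [ht.2]⟩ (by simp) hy
    linarith
  have hMi : Set.InjOn M (Set.Icc 0 1) := by
    intro s hs t ht hst
    by_cases h : s ≤ 1 / 2 <;> by_cases h' : t ≤ 1 / 2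
    · rw [(hMF s hs h).1, (hMF t ht h').1] at hst
      have := hFi ⟨by linarith [hs.1], by linarith⟩ ⟨by linarith [ht.1], by linarith⟩ hst
      linarith
    · exact absurd hst (key s hs t ht h h')
    · exact absurd hst.symm (key t ht s hs h' h)
    · rw [(hMK s hs h).1, (hMK t ht h').1] at hst
      have := hKi ⟨by linarith, by linarith [hs.2]⟩ ⟨by linarith, by linarith [ht.2]⟩ hst
      linarith
  have hr : M '' Set.Icc 0 1 = A ∪ B := by
    ext p
    constructor
    · rintro ⟨t, ht, rfl⟩
      by_cases h : t ≤ 1 / 2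
      exacts [Or.inl (hMF t ht h).2, Or.inr (hMK t ht h).2]
    · rintro (hp | hp)
      · obtain ⟨t, ht, rfl⟩ := hFr ▸ hp
        have h1 : t / 2 ∈ Set.Icc (0 : ℝ) 1 := ⟨by linarith [ht.1], by linarith [ht.2]⟩
        exact ⟨t / 2, h1, by rw [(hMF _ h1 (by linarith [ht.2])).1]; ring_nf⟩
      · obtain ⟨t, ht, rfl⟩ := hKr ▸ hp
        rcases ht.1.eq_or_lt with rfl | h0
        · refine ⟨1 / 2, by norm_num, ?_⟩
          rw [(hMF _ (by norm_num) le_rfl).1]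
          norm_num [hF1, hK0]
        · have h1 : (t + 1) / 2 ∈ Set.Icc (0 : ℝ) 1 := ⟨by linarith [ht.1], by linarith [ht.2]⟩
          exact ⟨(t + 1) / 2, h1, by rw [(hMK _ h1 (by linarith)).1]; ring_nf⟩
  have := isArc_of_param hMc hMi
  rwa [hr, (hMF 0 (by norm_num) (by norm_num)).1, (hMK 1 (by norm_num) (by norm_num)).1,
    mul_zero, hF0, show (2 : ℝ) * 1 - 1 = 1 by norm_num, hK1] at this

/-- An interior point of a curve is joined to the start of the curve and to all other interior
points, avoiding the ends. -/
lemma IsArc.joinedIn {A : Set (ℝ × ℝ)} {x y : ℝ × ℝ} (h : IsArc A x y) {p q : ℝ × ℝ}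
    (hp : p ∈ A) (hq : q ∈ A) (hpy : p ≠ y) (hqy : q ≠ y) (hqx : q ≠ x) :
    (p = x → JoinedIn (insert x (A \ {x, y})) p q) ∧ (p ≠ x → JoinedIn (A \ {x, y}) p q) := by
  obtain ⟨F, hFc, hFi, hF0, hF1, rfl⟩ := h.exists_param
  obtain ⟨s, hs, rfl⟩ := hp
  obtain ⟨t, ht, rfl⟩ := hq
  have h0 : (0 : ℝ) ∈ Set.Icc (0 : ℝ) 1 := by simp
  have h1 : (1 : ℝ) ∈ Set.Icc (0 : ℝ) 1 := by simp
  have hlt : ∀ r ∈ Set.Icc (0 : ℝ) 1, F r ≠ y → r < 1 := fun r hr hry =>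
    hr.2.lt_of_ne (by rintro rfl; exact hry hF1)
  have hpos : ∀ r ∈ Set.Icc (0 : ℝ) 1, F r ≠ x → 0 < r := fun r hr hry =>
    hr.1.lt_of_ne (by rintro rfl; exact hry hF0)
  have hin : ∀ r ∈ Set.Ioo (0 : ℝ) 1, F r ∈ F '' Set.Icc 0 1 \ {x, y} := by
    intro r hr
    have hr' : r ∈ Set.Icc (0 : ℝ) 1 := ⟨hr.1.le, hr.2.le⟩
    refine ⟨⟨r, hr', rfl⟩, ?_⟩
    rintro (h | h)
    · exact hr.1.ne' (hFi hr' h0 (h.trans hF0.symm))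
    · exact hr.2.ne (hFi hr' h1 ((Set.mem_singleton_iff.1 h).trans hF1.symm))
  constructor
  · intro hsx
    have hs0 : s = 0 := hFi hs h0 (hsx.trans hF0.symm)
    subst hs0
    have hc : IsPathConnected (F '' Set.Ico 0 1) :=
      ((convex_Ico 0 1).isPathConnected ⟨0, by simp⟩).image hFc
    refine (hc.joinedIn _ ⟨0, by simp, rfl⟩ _ ⟨t, ⟨ht.1, hlt t ht hqy⟩, rfl⟩).mono ?_
    rintro _ ⟨r, hr, rfl⟩
    rcases hr.1.eq_or_lt with rfl | hr0
    · exact Or.inl hF0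
    · exact Or.inr (hin r ⟨hr0, hr.2⟩)
  · intro hsx
    have hc : IsPathConnected (F '' Set.Ioo 0 1) :=
      ((convex_Ioo 0 1).isPathConnected ⟨1 / 2, by norm_num⟩).image hFc
    refine (hc.joinedIn _ ⟨s, ⟨hpos s hs hsx, hlt s hs hpy⟩, rfl⟩ _
      ⟨t, ⟨hpos t ht hqx, hlt t ht hqy⟩, rfl⟩).mono ?_
    rintro _ ⟨r, hr, rfl⟩
    exact hin r hr

end Curves

end OnePlanarity

namespace OnePlanarity

section ClosedModels

variable {V : Type*}

/-- The graph on the vertices and edges of `G` in which a vertex is adjacent to its incident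
edges, and two edges are adjacent when they are related by `R`. -/
def crossGraph (G : SimpleGraph V) (R : Sym2 V → Sym2 V → Prop) : SimpleGraph (V ⊕ Sym2 V) where
  Adj
    | .inl u, .inr e => e ∈ G.edgeSet ∧ u ∈ e
    | .inr e, .inl u => e ∈ G.edgeSet ∧ u ∈ e
    | .inr e, .inr e' => e ∈ G.edgeSet ∧ e' ∈ G.edgeSet ∧ e ≠ e' ∧ (R e e' ∨ R e' e)
    | .inl _, .inl _ => False
  symm := ⟨by
    rintro (u | e) (v | e') h
    · exact h
    · exact h
    · exact h
    · exact ⟨h.2.1, h.1, h.2.2.1.symm, h.2.2.2.symm⟩⟩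
  loopless := ⟨by
    rintro (u | e) h
    · exact h
    · exact h.2.2.1 rfl⟩

/-- A set of vertices and edges is closed if it contains, with every edge, all edges related
to it. -/
def RClosed (R : Sym2 V → Sym2 V → Prop) (A : Set (V ⊕ Sym2 V)) : Prop :=
  ∀ e e', R e e' → (Sum.inr e ∈ A ↔ Sum.inr e' ∈ A)

/-- There are no closed models of the two Kuratowski graphs. -/
def ClosedFree (G : SimpleGraph V) (R : Sym2 V → Sym2 V → Prop) : Prop :=
  (∀ B : Fin 5 → Set (V ⊕ Sym2 V), (∀ i, RClosed R (B i)) → ¬ IsModel ⊤ (crossGraph G R) B) ∧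
  ∀ B : Fin 6 → Set (V ⊕ Sym2 V), (∀ i, RClosed R (B i)) → ¬ IsModel K33 (crossGraph G R) B

variable {G : SimpleGraph V} (D : Drawing G)

/-- The part of a drawing occupied by a set of vertices and edges. -/
def Drawing.region (A : Set (V ⊕ Sym2 V)) : Set (ℝ × ℝ) :=
  {p | ∃ u, Sum.inl u ∈ A ∧ p = D.pos u} ∪
    {p | ∃ e ∈ G.edgeSet, Sum.inr e ∈ A ∧ p ∈ D.arc e ∧ p ∉ Set.range D.pos}

lemma Drawing.region_union (A A' : Set (V ⊕ Sym2 V)) :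
    D.region (A ∪ A') = D.region A ∪ D.region A' := by
  ext p
  simp only [Drawing.region, Set.mem_union, Set.mem_ofPred_eq]
  grind

lemma Drawing.mem_range_iff {u v : V} (h : G.Adj u v) {p : ℝ × ℝ} (hp : p ∈ D.arc s(u, v)) :
    p ∈ Set.range D.pos ↔ p = D.pos u ∨ p = D.pos v := by
  constructor
  · rintro ⟨w, rfl⟩
    have := D.arc_avoid s(u, v) h w hp
    rcases Sym2.mem_iff.1 this with rfl | rfl <;> simp
  · rintro (rfl | rfl) <;> simp

lemma Drawing.exists_inner (e : Sym2 V) (he : e ∈ G.edgeSet) :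
    ∃ p ∈ D.arc e, p ∉ Set.range D.pos := by
  induction e with | _ u v
  obtain ⟨F, hFc, hFi, hF0, hF1, hFr⟩ := (D.arc_curve _ he u v rfl).exists_param
  have hm : F (1 / 2) ∈ D.arc s(u, v) := hFr ▸ ⟨1 / 2, by norm_num, rfl⟩
  refine ⟨_, hm, fun h => ?_⟩
  rcases (D.mem_range_iff he hm).1 h with h | h
  · have := hFi (by norm_num) (by norm_num) (h.trans hF0.symm)
    norm_num at this
  · have := hFi (by norm_num) (by norm_num) (h.trans hF1.symm)
    norm_num at this

lemma Drawing.joinedIn_inner {A : Set (V ⊕ Sym2 V)} {e : Sym2 V} (he : e ∈ G.edgeSet)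
    (hA : Sum.inr e ∈ A) {p q : ℝ × ℝ} (hp : p ∈ D.arc e) (hq : q ∈ D.arc e)
    (hp' : p ∉ Set.range D.pos) (hq' : q ∉ Set.range D.pos) : JoinedIn (D.region A) p q := by
  induction e with | _ u v
  rw [D.mem_range_iff he hp, not_or] at hp'
  rw [D.mem_range_iff he hq, not_or] at hq'
  refine (((D.arc_curve _ he u v rfl).joinedIn hp hq hp'.2 hq'.2 hq'.1).2 hp'.1).mono ?_
  rintro r ⟨hr, hr'⟩
  exact Or.inr ⟨_, he, hA, hr, fun h => hr' ((D.mem_range_iff he hr).1 h)⟩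

lemma Drawing.joinedIn_end {A : Set (V ⊕ Sym2 V)} {e : Sym2 V} (he : e ∈ G.edgeSet)
    (hA : Sum.inr e ∈ A) {u : V} (hu : u ∈ e) (hA' : Sum.inl u ∈ A) {q : ℝ × ℝ}
    (hq : q ∈ D.arc e) (hq' : q ∉ Set.range D.pos) : JoinedIn (D.region A) (D.pos u) q := by
  obtain ⟨v, rfl⟩ := hu
  rw [D.mem_range_iff he hq, not_or] at hq'
  have hc := D.arc_curve _ he u v rfl
  have huv : D.pos u ≠ D.pos v := fun h => G.ne_of_adj he (D.pos_inj h)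
  refine ((hc.joinedIn hc.left_mem hq huv hq'.2 hq'.1).1 rfl).mono ?_
  rintro r (rfl | ⟨hr, hr'⟩)
  · exact Or.inl ⟨u, hA', rfl⟩
  · exact Or.inr ⟨_, he, hA, hr, fun h => hr' ((D.mem_range_iff he hr).1 h)⟩

lemma Drawing.exists_points {R : Sym2 V → Sym2 V → Prop}
    (h1 : ∀ e e' p, D.Crosses e e' p → R e e') (h2 : ∀ e e', R e e' → ∃ p, D.Crosses e e' p)
    {m : ℕ} {H : SimpleGraph (Fin m)} (hH : ∀ i, ∃ j, H.Adj i j)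
    {B : Fin m → Set (V ⊕ Sym2 V)} (hB : ∀ i, RClosed R (B i)) (hM : IsModel H (crossGraph G R) B) :
    (∀ i j, i ≠ j → Disjoint (D.region (B i)) (D.region (B j))) ∧
    ∃ p : Fin m → ℝ × ℝ, (∀ i, p i ∈ D.region (B i)) ∧
      ∀ i j, H.Adj i j → JoinedIn (D.region (B i) ∪ D.region (B j)) (p i) (p j) := by
  classical
  constructor
  · intro i j hij
    have hd : ∀ x, x ∈ B i → x ∈ B j → False := fun x hx hy => hij (hM.disj i j x hx hy)
    rw [Set.disjoint_left]
    rintro p (⟨u, hu, rfl⟩ | ⟨e, he, hei, hpe, hp⟩) (⟨w, hw, hw'⟩ | ⟨e', he', hej, hpe', hp'⟩)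
    · exact hd _ hu (D.pos_inj hw' ▸ hw)
    · exact hp' ⟨u, rfl⟩
    · exact hp ⟨w, hw'.symm⟩
    · by_cases hee : e = e'
      · exact hd _ hei (hee ▸ hej)
      · exact hd _ ((hB i _ _ (h1 e e' p ⟨he, he', hee, hpe, hpe', hp⟩)).1 hei) hej
  choose! c hc hc' using D.exists_inner
  let rep : V ⊕ Sym2 V → ℝ × ℝ := Sum.elim D.pos c
  let Val : V ⊕ Sym2 V → Prop := fun x => ∀ e, x = Sum.inr e → e ∈ G.edgeSet
  have hval : ∀ x y, (crossGraph G R).Adj x y → Val x := by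
    rintro (u | e) (v | e') h f hf
    all_goals cases hf
    all_goals exact h.1
  have hstep : ∀ A : Set (V ⊕ Sym2 V), ∀ x ∈ A, ∀ y ∈ A, (crossGraph G R).Adj x y →
      JoinedIn (D.region A) (rep x) (rep y) := by
    rintro A (u | e) hx (v | e') hy h
    · exact h.elim
    · exact D.joinedIn_end h.1 hy h.2 hx (hc _ h.1) (hc' _ h.1)
    · exact (D.joinedIn_end h.1 hx h.2 hy (hc _ h.1) (hc' _ h.1)).symm
    · have : ∃ p, p ∈ D.arc e ∧ p ∈ D.arc e' ∧ p ∉ Set.range D.pos := by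
        rcases h.2.2.2 with h | h <;> obtain ⟨p, hp⟩ := h2 _ _ h
        exacts [⟨p, hp.2.2.2⟩, ⟨p, hp.2.2.2.2.1, hp.2.2.2.1, hp.2.2.2.2.2⟩]
      obtain ⟨p, hp, hp', hpr⟩ := this
      exact (D.joinedIn_inner h.1 hx (hc _ h.1) hp (hc' _ h.1) hpr).trans
        (D.joinedIn_inner h.2.1 hy hp' (hc _ h.2.1) hpr (hc' _ h.2.1))
  have hjoin : ∀ A : Set (V ⊕ Sym2 V), Conn (crossGraph G R) A → ∀ x ∈ A, Val x →
      ∀ y ∈ A, JoinedIn (D.region A) (rep x) (rep y) := by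
    intro A hA x hx hv y hy
    refine hA.2 {z | JoinedIn (D.region A) (rep x) (rep z)} ⟨x, hx, ?_⟩
      (fun u hu hu' v hv h => hu'.trans (hstep A u hu v hv h)) y hy
    refine JoinedIn.refl ?_
    rcases x with u | e
    · exact Or.inl ⟨u, hx, rfl⟩
    · exact Or.inr ⟨e, hv e rfl, hx, hc _ (hv e rfl), hc' _ (hv e rfl)⟩
  have hex : ∀ i, ∃ x ∈ B i, Val x := by
    intro i
    obtain ⟨j, hj⟩ := hH i
    obtain ⟨x, hx, y, hy, h⟩ := hM.adj i j hj
    exact ⟨x, hx, hval x y h⟩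
  choose x hx hxv using hex
  refine ⟨fun i => rep (x i), fun i => (hjoin _ (hM.conn i) _ (hx i) (hxv i) _ (hx i)).mem.1, ?_⟩
  intro i j hij
  rw [← D.region_union]
  obtain ⟨a, ha, b, hb, h⟩ := hM.adj i j hij
  exact hjoin _ ((hM.conn i).union (hM.conn j) ha hb h) _ (Or.inl (hx i)) (hxv i) _ (Or.inr (hx j))

theorem Drawing.closedFree {R : Sym2 V → Sym2 V → Prop}
    (h1 : ∀ e e' p, D.Crosses e e' p → R e e') (h2 : ∀ e e', R e e' → ∃ p, D.Crosses e e' p) :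
    ClosedFree G R := by
  constructor
  · intro B hB hM
    obtain ⟨hd, p, hp, hj⟩ := D.exists_points h1 h2 (H := ⊤) (by decide) hB hM
    exact no_planar_five p _ hd hp fun i j hij => hj i j hij.ne
  · intro B hB hM
    obtain ⟨hd, p, hp, hj⟩ := D.exists_points h1 h2 (H := K33) (by decide) hB hM
    refine no_planar_three_three p _ hd hp fun i j hi hj' => hj i j ?_
    exact by revert i j; decide

/-- A graph with a crossing-free drawing has no Kuratowski minor. -/
theorem Drawing.free (h : ∀ e e' p, ¬ D.Crosses e e' p) : Free G := by
  classical
  have hcf : Free (crossGraph G fun _ _ => False) := by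
    have := D.closedFree (R := fun _ _ => False) (fun e e' p hp => h e e' p hp)
      (fun _ _ h => h.elim)
    exact ⟨fun B => this.1 B fun i e e' h => h.elim, fun B => this.2 B fun i e e' h => h.elim⟩
  let _ : LinearOrder V := WellOrderingRel.isWellOrder.linearOrder
  let F : V → Set (V ⊕ Sym2 V) := fun v =>
    {x | x = Sum.inl v ∨ ∃ w, v < w ∧ G.Adj v w ∧ x = Sum.inr s(v, w)}
  refine hcf.of_minor F (fun v _ _ => ?_) ?_ ?_
  · refine ⟨⟨_, Or.inl rfl⟩, fun X ⟨x, hx, hxX⟩ hX y hy => ?_⟩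
    have hv : Sum.inl v ∈ X := by
      rcases hx with rfl | ⟨w, hw, ha, rfl⟩
      · exact hxX
      · exact hX _ (Or.inr ⟨w, hw, ha, rfl⟩) hxX _ (Or.inl rfl) ⟨ha, Sym2.mem_mk_left _ _⟩
    rcases hy with rfl | ⟨w, hw, ha, rfl⟩
    · exact hv
    · exact hX _ (Or.inl rfl) hv _ (Or.inr ⟨w, hw, ha, rfl⟩) ⟨ha, Sym2.mem_mk_left _ _⟩
  · rintro v v' x (rfl | ⟨w, hw, ha, rfl⟩) (h | ⟨w', hw', ha', h⟩)
    · exact Sum.inl_injective h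
    · cases h
    · cases h
    · rcases Sym2.eq_iff.1 (Sum.inr_injective h) with h | ⟨rfl, rfl⟩
      · exact h.1
      · exact absurd hw hw'.asymm
  · intro v w hvw
    rcases lt_or_gt_of_ne hvw.ne with h | h
    · exact ⟨_, Or.inr ⟨w, h, hvw, rfl⟩, _, Or.inl rfl, ⟨hvw, Sym2.mem_mk_right _ _⟩⟩
    · exact ⟨_, Or.inl rfl, _, Or.inr ⟨v, h, hvw.symm, rfl⟩, ⟨hvw.symm, Sym2.mem_mk_right _ _⟩⟩

end ClosedModels

end OnePlanarity

namespace OnePlanarity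

section Certificates

variable {V E : Type}

lemma Run.perm {l : List (V × List E × List E)} {C C' : List E} (hr : Run l C C') :
    (C ++ l.flatMap fun r => r.2.2).Perm (C' ++ l.flatMap fun r => r.2.1) := by
  induction hr with
  | nil C => simp
  | @cons v d u L R l C' _ ih =>
    classical
    rw [List.perm_iff_count] at ih ⊢
    intro a
    have := ih a
    simp only [List.flatMap_cons, List.count_append] at this ⊢
    omega

/-- A sweep without initial and final edges is a planarity certificate of a graph if all its
edges are represented in it. -/
structure IsCert (G : SimpleGraph V) (l : List (V × List E × List E)) : Prop where
  run : Run l [] []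
  nodup_vertex : (l.map Prod.fst).Nodup
  mem : ∀ v, v ∈ l.map Prod.fst
  nodup_up : (l.flatMap fun r => r.2.2).Nodup
  adj : ∀ a b, G.Adj a b → ∃ e, ∃ r ∈ l, ∃ r' ∈ l, s(a, b) = s(r.1, r'.1) ∧
    e ∈ r.2.2 ∧ e ∈ r'.2.1

/-- A graph with a planarity certificate. -/
def Cert (G : SimpleGraph V) : Prop :=
  ∃ (E : Type) (l : List (V × List E × List E)), IsCert G l

lemma Cert.mono {G G' : SimpleGraph V} (hG : Cert G') (h : G ≤ G') : Cert G := by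
  obtain ⟨E, l, hl⟩ := hG
  exact ⟨E, l, hl.run, hl.nodup_vertex, hl.mem, hl.nodup_up, fun a b hab => hl.adj a b (h hab)⟩

lemma eq_of_mem_flatMap_nodup {α β : Type*} {l : List α} {f : α → List β}
    (h : (l.flatMap f).Nodup) {r r' : α} (hr : r ∈ l) (hr' : r' ∈ l) {b : β}
    (hb : b ∈ f r) (hb' : b ∈ f r') : r = r' := by
  by_contra hne
  have : Std.Symm (Function.onFun List.Disjoint f) := ⟨fun _ _ h => List.Disjoint.symm h⟩
  exact (List.nodup_flatMap.1 h).2.forall hr hr' hne hb hb'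

variable {G : SimpleGraph V} {l : List (V × List E × List E)}

lemma IsCert.nodup_down (hl : IsCert G l) : (l.flatMap fun r => r.2.1).Nodup := by
  have := hl.run.perm
  simp only [List.nil_append] at this
  exact this.nodup_iff.1 hl.nodup_up

/-- A graph with a planarity certificate has a crossing-free drawing. -/
theorem Cert.exists_drawing (h : Cert G) : ∃ D : Drawing G, ∀ e e' p, ¬ D.Crosses e e' p := by
  classical
  obtain ⟨E, l, hl⟩ := h
  obtain ⟨X, h, f, geo⟩ := hl.run.exists_geo hl.nodup_up hl.nodup_vertex
  have hrec : ∀ v, ∃ r ∈ l, r.1 = v := fun v => List.mem_map.1 (hl.mem v)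
  have hinj : ∀ v w, h v = h w → v = w := by
    intro v w hvw
    obtain ⟨r, hr, rfl⟩ := hrec v
    obtain ⟨r', hr', rfl⟩ := hrec w
    by_contra hne
    have : Std.Symm fun r r' : V × List E × List E => h r.1 ≠ h r'.1 := ⟨fun _ _ h => Ne.symm h⟩
    exact (geo.height_lt.imp fun {r r'} (h : h r.1 < h r'.1) => h.ne).forall hr hr'
      (fun h => hne (congrArg Prod.fst h)) hvw
  have hup : ∀ {r r' : V × List E × List E} {e : E}, r ∈ l → r' ∈ l → e ∈ r.2.2 → e ∈ r'.2.2 →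
      r = r' := fun hr hr' => eq_of_mem_flatMap_nodup hl.nodup_up hr hr'
  have hdown : ∀ {r r' : V × List E × List E} {e : E}, r ∈ l → r' ∈ l → e ∈ r.2.1 → e ∈ r'.2.1 →
      r = r' := fun hr hr' => eq_of_mem_flatMap_nodup hl.nodup_down hr hr'
  have hedge : ∀ e ∈ G.edgeSet, ∃ (x : E) (r r' : V × List E × List E), r ∈ l ∧ r' ∈ l ∧
      e = s(r.1, r'.1) ∧ x ∈ r.2.2 ∧ x ∈ r'.2.1 := by
    intro e he
    induction e with | _ a b
    obtain ⟨x, r, hr, r', hr', h⟩ := hl.adj a b he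
    exact ⟨x, r, r', hr, hr', h⟩
  have hwit : ∀ e : Sym2 V, ∃ (x : E → Prop) (a b : V), e ∈ G.edgeSet →
      ∃ (y : E) (r r' : V × List E × List E), r ∈ l ∧ r' ∈ l ∧ a = r.1 ∧ b = r'.1 ∧
      e = s(a, b) ∧ y ∈ r.2.2 ∧ y ∈ r'.2.1 ∧ x = (· = y) := by
    intro e
    by_cases he : e ∈ G.edgeSet
    · obtain ⟨x, r, r', h⟩ := hedge e he
      exact ⟨(· = x), r.1, r'.1, fun _ => ⟨x, r, r', h.1, h.2.1, rfl, rfl, h.2.2.1, h.2.2.2.1,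
        h.2.2.2.2, rfl⟩⟩
    · induction e with | _ a b
      exact ⟨fun _ => False, a, b, fun h => absurd h he⟩
  choose x a b hx using hwit
  let pos : V → ℝ × ℝ := fun v => (X v, h v)
  have hpos : Function.Injective pos := fun v w hvw => hinj v w (congrArg Prod.snd hvw)
  let arc : Sym2 V → Set (ℝ × ℝ) := fun e =>
    {p | ∃ y, x e y ∧ p ∈ (fun t => (f y t, t)) '' Set.Icc (h (a e)) (h (b e))}
  have harc : ∀ e ∈ G.edgeSet, ∃ (y : E) (u v : V), e = s(u, v) ∧ h u < h v ∧ f y (h u) = X u ∧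
      f y (h v) = X v ∧ arc e = (fun t => (f y t, t)) '' Set.Icc (h u) (h v) ∧
      (∀ t, h u < t → t < h v → Alive l [] h y t) ∧
      ∃ r ∈ l, ∃ r' ∈ l, u = r.1 ∧ v = r'.1 ∧ y ∈ r.2.2 ∧ y ∈ r'.2.1 := by
    intro e he
    obtain ⟨y, r, r', hr, hr', ha, hb, hab, hy, hy', hxy⟩ := hx e he
    refine ⟨y, a e, b e, hab, ?_, ?_, ?_, ?_, ?_, r, hr, r', hr', ha, hb, hy, hy'⟩
    · rw [ha, hb]
      rcases geo.down_alive r' hr' y hy' with h | ⟨r'', hr'', hy'', hlt⟩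
      · simp at h
      · rwa [hup hr hr'' hy hy'']
    · rw [ha]; exact geo.up r hr y hy
    · rw [hb]; exact geo.down r' hr' y hy'
    · ext p
      simp only [arc, hxy, Set.mem_ofPred_eq, exists_eq_left]
    · intro t h1 h2
      refine ⟨Or.inr ⟨r, hr, hy, ha ▸ h1⟩, fun r'' hr'' hy'' => ?_⟩
      rw [← hdown hr' hr'' hy' hy'', ← hb]
      exact h2
  have hpos0 : ∀ v, 0 < h v := by
    intro v
    obtain ⟨r, hr, rfl⟩ := hrec v
    exact geo.height_pos r hr
  have havoid : ∀ e ∈ G.edgeSet, ∀ w : V, pos w ∈ arc e → w ∈ e := by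
    intro e he w hw
    obtain ⟨y, u, v, rfl, huv, hu, hv, hA, hal, -⟩ := harc e he
    rw [hA] at hw
    obtain ⟨t, ⟨h1, h2⟩, ht⟩ := hw
    obtain ⟨ht1, rfl⟩ := Prod.ext_iff.1 ht
    simp only [pos] at ht1
    rcases h1.eq_or_lt with h1 | h1
    · rw [hinj _ _ h1]; simp
    rcases h2.eq_or_lt with h2 | h2
    · rw [hinj _ _ h2]; simp
    obtain ⟨r, hr, rfl⟩ := hrec w
    exact absurd ht1 (geo.sep_vertex r hr y (hal _ h1 h2))
  have hcross : ∀ e ∈ G.edgeSet, ∀ e' ∈ G.edgeSet, e ≠ e' → ∀ p, p ∈ arc e → p ∈ arc e' →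
      p ∈ pos '' {w | w ∈ e} := by
    intro e he e' he' hne p hp hp'
    obtain ⟨y, u, v, rfl, huv, hu, hv, hA, hal, r, hr, r', hr', hur, hvr, hy⟩ := harc e he
    obtain ⟨y', u', v', rfl, huv', hu', hv', hA', hal', q, hq, q', hq', huq, hvq, hy'⟩ :=
      harc e' he'
    have hends : ∀ z, pos z = p → p ∈ pos '' {w | w ∈ s(u, v)} := by
      rintro z rfl
      exact ⟨z, havoid _ he z hp, rfl⟩
    rw [hA] at hp
    rw [hA'] at hp'
    obtain ⟨t, ⟨h1, h2⟩, rfl⟩ := hp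
    obtain ⟨t', ⟨h1', h2'⟩, ht⟩ := hp'
    obtain ⟨ht1, rfl⟩ := Prod.ext_iff.1 ht
    simp only at ht1
    rcases h1.eq_or_lt with rfl | h1
    · exact hends u (by simp [pos, hu])
    rcases h2.eq_or_lt with rfl | h2
    · exact hends v (by simp [pos, hv])
    rcases h1'.eq_or_lt with rfl | h1'
    · exact hends u' (by simp [pos, hu', ← ht1])
    rcases h2'.eq_or_lt with rfl | h2'
    · exact hends v' (by simp [pos, hv', ← ht1])
    refine absurd ht1.symm (geo.sep y y' t' ((hpos0 u).trans h1).le ?_ (hal _ h1 h2)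
        (hal' _ h1' h2'))
    rintro rfl
    rw [hup hr hq hy.1 hy'.1, ← huq] at hur
    rw [hdown hr' hq' hy.2 hy'.2, ← hvq] at hvr
    exact hne (by rw [hur, hvr])
  have hfin : ∀ e : Sym2 V, {w | w ∈ e}.Finite := by
    intro e
    induction e with | _ u v
    exact (Set.toFinite {u, v}).subset fun w hw => by simpa using hw
  refine ⟨⟨pos, hpos, arc, ?_, havoid, fun e he e' he' hne =>
    ((hfin e).image pos).subset fun p hp => hcross e he e' he' hne p hp.1 hp.2⟩, ?_⟩
  · intro e he u v huv
    obtain ⟨y, u', v', rfl, hlt, hu, hv, hA, -⟩ := harc e he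
    have := isArc_graph (geo.cont y) hlt
    rw [← hA, hu, hv] at this
    rcases Sym2.eq_iff.1 huv with ⟨rfl, rfl⟩ | ⟨rfl, rfl⟩
    exacts [this, this.symm]
  · rintro e e' p ⟨he, he', hne, hp, hp', hr⟩
    obtain ⟨w, -, hw⟩ := hcross e he e' he' hne p hp hp'
    exact hr ⟨w, hw⟩

lemma Cert.free (h : Cert G) : Free G := by
  obtain ⟨D, hD⟩ := h.exists_drawing
  exact D.free hD

end Certificates

end OnePlanarity

namespace OnePlanarity

section Exact

variable {V E F : Type}

lemma Run.flatMap {l : List (V × List E × List E)} {C C' : List E} (hr : Run l C C')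
    (f : E → List F) :
    Run (l.map fun r => (r.1, r.2.1.flatMap f, r.2.2.flatMap f)) (C.flatMap f) (C'.flatMap f) := by
  induction hr with
  | nil C => exact .nil _
  | cons _ ih =>
    simp only [List.flatMap_append, List.map_cons] at ih ⊢
    exact .cons ih

lemma Run.filter {l : List (V × List E × List E)} {C C' : List E} (hr : Run l C C')
    {p : V × List E × List E → Bool} (hp : ∀ r ∈ l, ¬ p r → r.2 = ([], [])) :
    Run (l.filter p) C C' := by
  induction hr with
  | nil C => exact .nil _
  | @cons v d u L R l C' _ ih =>
    have ih := ih fun r hr => hp r (List.mem_cons_of_mem _ hr)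
    by_cases h : p (v, d, u)
    · rw [List.filter_cons_of_pos h]
      exact .cons ih
    · rw [List.filter_cons_of_neg h]
      have := hp _ List.mem_cons_self h
      simp only [Prod.mk.injEq] at this
      rwa [this.1, ← this.2]

lemma run_append {l l' : List (V × List E × List E)} {C C' : List E} :
    Run (l ++ l') C C' ↔ ∃ M, Run l C M ∧ Run l' M C' := by
  constructor
  · intro h
    induction l generalizing C with
    | nil => exact ⟨C, .nil _, h⟩
    | cons r l ih =>
      cases h with
      | cons h =>
        obtain ⟨M, hM, hM'⟩ := ih h
        exact ⟨M, .cons hM, hM'⟩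
  · rintro ⟨M, h, h'⟩
    induction h with
    | nil => exact h'
    | cons _ ih => exact .cons (ih h')

/-- A planarity certificate whose labels are exactly the edges of the graph, omitting the isolated
vertex `y`. -/
structure IsExact (J : SimpleGraph V) (y : V) (l : List (V × List (Sym2 V) × List (Sym2 V))) :
    Prop where
  run : Run l [] []
  nodup_vertex : (l.map Prod.fst).Nodup
  mem : ∀ v, v ≠ y → v ∈ l.map Prod.fst
  ne : ∀ r ∈ l, r.1 ≠ y
  nodup_up : (l.flatMap fun r => r.2.2).Nodup
  up : ∀ r ∈ l, ∀ e ∈ r.2.2, e ∈ J.edgeSet ∧ r.1 ∈ e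
  down : ∀ r ∈ l, ∀ e ∈ r.2.1, e ∈ J.edgeSet ∧ r.1 ∈ e
  edge : ∀ e ∈ J.edgeSet, ∃ r ∈ l, ∃ r' ∈ l, e = s(r.1, r'.1) ∧ e ∈ r.2.2 ∧ e ∈ r'.2.1

lemma Cert.exists_exact {J : SimpleGraph V} (hJ : Cert J) {y : V} (hy : ∀ w, ¬ J.Adj y w) :
    ∃ l, IsExact J y l := by
  classical
  obtain ⟨E, l, hl⟩ := hJ
  have hedge : ∀ e ∈ J.edgeSet, ∃ x : E, ∃ r ∈ l, ∃ r' ∈ l, e = s(r.1, r'.1) ∧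
      x ∈ r.2.2 ∧ x ∈ r'.2.1 := by
    intro e he
    induction e with | _ a b
    exact hl.adj a b he
  have : ∀ e, ∃ x : Option E, e ∈ J.edgeSet → ∃ z, x = some z ∧ ∃ r ∈ l, ∃ r' ∈ l,
      e = s(r.1, r'.1) ∧ z ∈ r.2.2 ∧ z ∈ r'.2.1 := by
    intro e
    by_cases he : e ∈ J.edgeSet
    · obtain ⟨x, h⟩ := hedge e he
      exact ⟨some x, fun _ => ⟨x, rfl, h⟩⟩
    · exact ⟨none, fun h => absurd h he⟩
  choose lab hlab using this
  have hup : ∀ {r r' : V × List E × List E} {e : E}, r ∈ l → r' ∈ l → e ∈ r.2.2 → e ∈ r'.2.2 →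
      r = r' := fun hr hr' => eq_of_mem_flatMap_nodup hl.nodup_up hr hr'
  have hdown : ∀ {r r' : V × List E × List E} {e : E}, r ∈ l → r' ∈ l → e ∈ r.2.1 → e ∈ r'.2.1 →
      r = r' := fun hr hr' => eq_of_mem_flatMap_nodup hl.nodup_down hr hr'
  have hinj : ∀ e ∈ J.edgeSet, ∀ e' ∈ J.edgeSet, lab e = lab e' → e = e' := by
    intro e he e' he' h
    obtain ⟨z, hz, r, hr, r', hr', rfl, h1, h2⟩ := hlab e he
    obtain ⟨z', hz', q, hq, q', hq', rfl, h1', h2'⟩ := hlab e' he'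
    obtain rfl : z = z' := Option.some_injective _ (hz.symm.trans (h.trans hz'))
    rw [hup hr hq h1 h1', hdown hr' hq' h2 h2']
  let f : E → List (Sym2 V) := fun z =>
    if h : ∃ e ∈ J.edgeSet, lab e = some z then [h.choose] else []
  have hf : ∀ z e, e ∈ f z ↔ e ∈ J.edgeSet ∧ lab e = some z := by
    intro z e
    by_cases h : ∃ e ∈ J.edgeSet, lab e = some z
    · simp only [f, dif_pos h, List.mem_singleton]
      refine ⟨?_, fun h' => hinj _ h'.1 _ h.choose_spec.1 (h'.2.trans h.choose_spec.2.symm)⟩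
      rintro rfl
      exact h.choose_spec
    · simp only [f, dif_neg h, List.not_mem_nil, false_iff]
      exact fun h' => h ⟨e, h'⟩
  set l' := l.map fun r => (r.1, r.2.1.flatMap f, r.2.2.flatMap f) with hl'
  have hUp : ∀ r ∈ l', ∀ e ∈ r.2.2, e ∈ J.edgeSet ∧ r.1 ∈ e := by
    intro r hr e he
    obtain ⟨q, hq, rfl⟩ := List.mem_map.1 hr
    obtain ⟨z, hz, he⟩ := List.mem_flatMap.1 he
    obtain ⟨he, hze⟩ := (hf z e).1 he
    obtain ⟨z', hz', p, hp, p', hp', rfl, h1, h2⟩ := hlab e he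
    obtain rfl : z = z' := Option.some_injective _ (hze.symm.trans hz')
    refine ⟨he, ?_⟩
    rw [hup hq hp hz h1]
    simp
  have hDown : ∀ r ∈ l', ∀ e ∈ r.2.1, e ∈ J.edgeSet ∧ r.1 ∈ e := by
    intro r hr e he
    obtain ⟨q, hq, rfl⟩ := List.mem_map.1 hr
    obtain ⟨z, hz, he⟩ := List.mem_flatMap.1 he
    obtain ⟨he, hze⟩ := (hf z e).1 he
    obtain ⟨z', hz', p, hp, p', hp', rfl, h1, h2⟩ := hlab e he
    obtain rfl : z = z' := Option.some_injective _ (hze.symm.trans hz')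
    refine ⟨he, ?_⟩
    rw [hdown hq hp' hz h2]
    simp
  have hyJ : ∀ e ∈ J.edgeSet, y ∉ e := by
    rintro e he ⟨w, rfl⟩
    exact hy w he
  have hmap : l'.map Prod.fst = l.map Prod.fst := by simp [hl']
  have hnodup : (l'.flatMap fun r => r.2.2).Nodup := by
    have : (l'.flatMap fun r => r.2.2) = (l.flatMap fun r => r.2.2).flatMap f := by
      rw [hl', List.flatMap_map, List.flatMap_assoc]
    rw [this, List.nodup_flatMap]
    constructor
    · intro z _
      simp only [f]
      split_ifs <;> simp
    · refine hl.nodup_up.imp fun {z z'} hne e he he' => hne ?_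
      exact Option.some_injective _ (((hf _ _).1 he).2.symm.trans ((hf _ _).1 he').2)
  refine ⟨l'.filter fun r => r.1 ≠ y, ?_, ?_, ?_, ?_, ?_, ?_, ?_, ?_⟩
  · refine (hl.run.flatMap f).filter fun r hr hry => ?_
    obtain rfl : r.1 = y := by simpa using hry
    exact Prod.ext (List.eq_nil_iff_forall_not_mem.2 fun e he => hyJ e (hDown r hr e he).1
      (hDown r hr e he).2) (List.eq_nil_iff_forall_not_mem.2 fun e he => hyJ e (hUp r hr e he).1
      (hUp r hr e he).2)
  · exact (hmap ▸ hl.nodup_vertex).sublist (List.filter_sublist.map _)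
  · intro v hv
    obtain ⟨r, hr, rfl⟩ := List.mem_map.1 (hmap ▸ hl.mem v)
    exact List.mem_map_of_mem (List.mem_filter.2 ⟨hr, by simpa using hv⟩)
  · intro r hr
    simpa using (List.mem_filter.1 hr).2
  · exact hnodup.sublist (List.filter_sublist.flatMap _)
  · exact fun r hr => hUp r (List.mem_filter.1 hr).1
  · exact fun r hr => hDown r (List.mem_filter.1 hr).1
  · intro e he
    obtain ⟨z, hz, r, hr, r', hr', rfl, h1, h2⟩ := hlab e he
    have hry := hyJ _ he
    simp only [Sym2.mem_iff, not_or] at hry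
    refine ⟨_, List.mem_filter.2 ⟨List.mem_map_of_mem hr, by simpa using Ne.symm hry.1⟩,
      _, List.mem_filter.2 ⟨List.mem_map_of_mem hr', by simpa using Ne.symm hry.2⟩, rfl, ?_, ?_⟩
    · exact List.mem_flatMap.2 ⟨z, h1, (hf _ _).2 ⟨he, hz⟩⟩
    · exact List.mem_flatMap.2 ⟨z, h2, (hf _ _).2 ⟨he, hz⟩⟩

lemma IsExact.nodup_down {J : SimpleGraph V} {y : V} {l : List (V × List (Sym2 V) × List (Sym2 V))}
    (hl : IsExact J y l) : (l.flatMap fun r => r.2.1).Nodup := by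
  have := hl.run.perm
  simp only [List.nil_append] at this
  exact this.nodup_iff.1 hl.nodup_up

end Exact

section Split

variable {V E : Type}

/-- A vertex of a sweep can be split into two adjacent vertices, along an arc of its rotation. -/
lemma exists_run_split {x y : V} {e₀ : E} {L R D U A Y B : List E}
    (hW : D ++ U.reverse = A ++ Y ++ B) (hd : ∀ e, e ∈ Y → e ∉ A ++ B) :
    ∃ dx ux dy uy, (Run [(x, dx, ux), (y, dy, uy)] (L ++ D ++ R) (L ++ U ++ R) ∨
        Run [(y, dy, uy), (x, dx, ux)] (L ++ D ++ R) (L ++ U ++ R)) ∧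
      (e₀ ∈ ux ∧ e₀ ∈ dy ∨ e₀ ∈ uy ∧ e₀ ∈ dx) ∧ (ux ++ uy).Perm (e₀ :: U) ∧
      (∀ e ∈ A ++ B, (e ∈ D → e ∈ dx) ∧ (e ∈ U → e ∈ ux)) ∧
      ∀ e ∈ Y, (e ∈ D → e ∈ dy) ∧ (e ∈ U → e ∈ uy) := by
  classical
  have hd' : ∀ e, e ∈ A ++ B → e ∉ Y := fun e h h' => hd e h' h
  rw [List.append_assoc, List.append_eq_append_iff] at hW
  rcases hW with ⟨A', hA, hU⟩ | ⟨C, hD, hC⟩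
  · obtain rfl : U = B.reverse ++ Y.reverse ++ A'.reverse := by
      rw [← List.reverse_reverse U, hU]; simp
    subst hA
    refine ⟨D, B.reverse ++ [e₀] ++ A'.reverse, [e₀], Y.reverse, Or.inl ?_, by simp, ?_, ?_, ?_⟩
    · refine .cons ?_
      rw [show L ++ (B.reverse ++ [e₀] ++ A'.reverse) ++ R =
        (L ++ B.reverse) ++ [e₀] ++ (A'.reverse ++ R) by simp]
      refine .cons ?_
      rw [show (L ++ B.reverse) ++ Y.reverse ++ (A'.reverse ++ R) =
        L ++ (B.reverse ++ Y.reverse ++ A'.reverse) ++ R by simp]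
      exact .nil _
    · rw [List.perm_iff_count]
      intro a
      simp only [List.count_append, List.count_cons, List.count_nil]
      omega
    · intro e he
      have := hd' e he
      simp only [List.mem_append, List.mem_reverse, List.mem_cons] at he ⊢
      tauto
    · intro e he
      have := hd e he
      simp only [List.mem_append, List.mem_reverse, List.mem_cons] at this ⊢
      tauto
  · rw [List.append_eq_append_iff] at hC
    rcases hC with ⟨B', rfl, rfl⟩ | ⟨Y', rfl, hU⟩
    · subst hD
      refine ⟨A ++ [e₀] ++ B', U, Y, [e₀], Or.inr ?_, by simp, ?_, ?_, ?_⟩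
      · rw [show L ++ (A ++ (Y ++ B')) ++ R = (L ++ A) ++ Y ++ (B' ++ R) by simp]
        refine .cons ?_
        rw [show (L ++ A) ++ [e₀] ++ (B' ++ R) = L ++ (A ++ [e₀] ++ B') ++ R by simp]
        exact .cons (.nil _)
      · rw [List.perm_iff_count]
        intro a
        simp only [List.count_append, List.count_cons, List.count_nil]
        omega
      · intro e he
        have := hd' e he
        simp only [List.mem_append, List.mem_reverse, List.mem_cons] at he this ⊢
        tauto
      · intro e he
        have := hd e he
        simp only [List.mem_append, List.mem_reverse, List.mem_cons] at this ⊢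
        tauto
    · obtain rfl : U = B.reverse ++ Y'.reverse := by
        rw [← List.reverse_reverse U, hU]; simp
      subst hD
      refine ⟨A, B.reverse ++ [e₀], e₀ :: C, Y'.reverse, Or.inl ?_, by simp, ?_, ?_, ?_⟩
      · rw [show L ++ (A ++ C) ++ R = L ++ A ++ (C ++ R) by simp]
        refine .cons ?_
        rw [show L ++ (B.reverse ++ [e₀]) ++ (C ++ R) =
          (L ++ B.reverse) ++ (e₀ :: C) ++ R by simp]
        refine .cons ?_
        rw [show (L ++ B.reverse) ++ Y'.reverse ++ R = L ++ (B.reverse ++ Y'.reverse) ++ R by simp]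
        exact .nil _
      · rw [List.perm_iff_count]
        intro a
        simp only [List.count_append, List.count_cons, List.count_nil]
        omega
      · intro e he
        have := hd' e he
        simp only [List.mem_append, List.mem_reverse, List.mem_cons] at he this ⊢
        tauto
      · intro e he
        have := hd e he
        simp only [List.mem_append, List.mem_reverse, List.mem_cons] at this ⊢
        tauto

end Split

end OnePlanarity

namespace OnePlanarity

section Split

variable {V : Type}

/-- The word `W` consists of an arc avoiding `q` and an arc avoiding `p`, which may share their
end letters. -/
def IsSplit (p q : V → Prop) (W : List V) : Prop :=
  ∃ P b Q b' P', W = P ++ b ++ Q ++ b' ++ P' ∧ b.length ≤ 1 ∧ b'.length ≤ 1 ∧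
    (∀ w ∈ P ++ P', ¬ q w) ∧ ∀ w ∈ Q, ¬ p w

lemma flatMap_singleton_of {α β : Type*} {l : List α} {f : α → List β} {g : α → β}
    (h : ∀ a ∈ l, f a = [g a]) : l.flatMap f = l.map g := by
  induction l with
  | nil => rfl
  | cons a l ih =>
    rw [List.flatMap_cons, h a List.mem_cons_self,
      ih fun b hb => h b (List.mem_cons_of_mem _ hb)]
    rfl

/-- The labels at a split vertex form two arcs. -/
lemma IsSplit.exists_arcs {p q : V → Prop} {W : List V} (h : IsSplit p q W) (hW : W.Nodup)
    {x y : V} (hxy : x ≠ y) (hx : x ∉ W) (hy : y ∉ W) :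
    ∃ (g : V → List (Sym2 V)) (A Y B : List (Sym2 V)), W.flatMap g = A ++ Y ++ B ∧
      (∀ w ∈ W, (g w).Nodup) ∧ (∀ w ∈ W, ∀ e ∈ g w, e = s(x, w) ∨ e = s(y, w)) ∧
      (∀ e ∈ Y, e ∉ A ++ B) ∧
      (∀ w ∈ W, p w → s(x, w) ∈ g w ∧ s(x, w) ∈ A ++ B) ∧
      ∀ w ∈ W, q w → s(y, w) ∈ g w ∧ s(y, w) ∈ Y := by
  classical
  obtain ⟨P, b, Q, b', P', rfl, hb, hb', hP, hQ⟩ := h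
  let g : V → List (Sym2 V) := fun w => if w ∈ b then [s(x, w), s(y, w)] else
    if w ∈ b' then [s(y, w), s(x, w)] else if w ∈ Q then [s(y, w)] else [s(x, w)]
  have hne : ∀ w, w ∈ P ++ b ++ Q ++ b' ++ P' → s(x, w) ≠ s(y, w) := by
    intro w _ h
    rcases Sym2.eq_iff.1 h with h | h
    · exact hxy h.1
    · exact hxy (h.1.trans h.2)
  simp only [List.nodup_append, List.mem_append] at hW
  obtain ⟨⟨⟨⟨-, -, hPb⟩, -, hPbQ⟩, -, hPbQb⟩, -, hall⟩ := hW
  have gP : ∀ w ∈ P, g w = [s(x, w)] := fun w hw => by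
    rw [show g w = _ from if_neg fun h => hPb w hw w h rfl,
      if_neg fun h => hPbQb w (by simp [hw]) w h rfl,
      if_neg fun h => hPbQ w (by simp [hw]) w h rfl]
  have gP' : ∀ w ∈ P', g w = [s(x, w)] := fun w hw => by
    rw [show g w = _ from if_neg fun h => hall w (by simp [h]) w hw rfl,
      if_neg fun h => hall w (by simp [h]) w hw rfl,
      if_neg fun h => hall w (by simp [h]) w hw rfl]
  have gQ : ∀ w ∈ Q, g w = [s(y, w)] := fun w hw => by
    rw [show g w = _ from if_neg fun h => hPbQ w (by simp [h]) w hw rfl,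
      if_neg fun h => hPbQb w (by simp [hw]) w h rfl, if_pos hw]
  have gb : ∀ w ∈ b, g w = [s(x, w), s(y, w)] := fun w hw => if_pos hw
  have gb' : ∀ w ∈ b', g w = [s(y, w), s(x, w)] := fun w hw => by
    rw [show g w = _ from if_neg fun h => hPbQb w (by simp [h]) w hw rfl, if_pos hw]
  have gbm : b.flatMap g = b.map (fun w => s(x, w)) ++ b.map (fun w => s(y, w)) := by
    rcases b with _ | ⟨a, _ | ⟨a', b⟩⟩
    · rfl
    · simp [gb]
    · simp at hb
  have gbm' : b'.flatMap g = b'.map (fun w => s(y, w)) ++ b'.map (fun w => s(x, w)) := by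
    rcases b' with _ | ⟨a, _ | ⟨a', b⟩⟩
    · rfl
    · simp [gb']
    · simp at hb'
  refine ⟨g, P.map (fun w => s(x, w)) ++ b.map (fun w => s(x, w)),
    b.map (fun w => s(y, w)) ++ Q.map (fun w => s(y, w)) ++ b'.map (fun w => s(y, w)),
    b'.map (fun w => s(x, w)) ++ P'.map (fun w => s(x, w)), ?_, ?_, ?_, ?_, ?_, ?_⟩
  · simp only [List.flatMap_append, gbm, gbm', flatMap_singleton_of gP, flatMap_singleton_of gP',
      flatMap_singleton_of gQ, List.append_assoc]
  · intro w hw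
    have := hne w hw
    simp only [g]
    split_ifs <;> simp [this, this.symm]
  · intro w hw e he
    simp only [g] at he
    split_ifs at he <;> simp at he <;> tauto
  · intro e he he'
    have hey : y ∈ e := by
      simp only [List.mem_append, List.mem_map] at he
      rcases he with (⟨w, _, rfl⟩ | ⟨w, _, rfl⟩) | ⟨w, _, rfl⟩ <;> simp
    have hex : ∃ w ∈ P ++ b ++ Q ++ b' ++ P', s(x, w) = e := by
      simp only [List.mem_append, List.mem_map] at he'
      rcases he' with (⟨w, hw, rfl⟩ | ⟨w, hw, rfl⟩) | ⟨w, hw, rfl⟩ | ⟨w, hw, rfl⟩ <;>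
        exact ⟨w, by simp [hw], rfl⟩
    obtain ⟨w, hw, rfl⟩ := hex
    rcases Sym2.mem_iff.1 hey with h | rfl
    · exact hxy h.symm
    · exact hy hw
  · intro w hw hp
    have hwQ : w ∉ Q := fun h => hQ w h hp
    simp only [List.mem_append] at hw
    rcases hw with (((hw | hw) | hw) | hw) | hw
    · exact ⟨by simp [gP w hw], by simp only [List.mem_append, List.mem_map]; grind⟩
    · exact ⟨by simp [gb w hw], by simp only [List.mem_append, List.mem_map]; grind⟩
    · exact absurd hw hwQ
    · exact ⟨by simp [gb' w hw], by simp only [List.mem_append, List.mem_map]; grind⟩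
    · exact ⟨by simp [gP' w hw], by simp only [List.mem_append, List.mem_map]; grind⟩
  · intro w hw hq
    have hwP : w ∉ P ++ P' := fun h => hP w h hq
    simp only [List.mem_append, not_or] at hw hwP
    rcases hw with (((hw | hw) | hw) | hw) | hw
    · exact absurd hw hwP.1
    · exact ⟨by simp [gb w hw], by simp only [List.mem_append, List.mem_map]; grind⟩
    · exact ⟨by simp [gQ w hw], by simp only [List.mem_append, List.mem_map]; grind⟩
    · exact ⟨by simp [gb' w hw], by simp only [List.mem_append, List.mem_map]; grind⟩
    · exact absurd hw hwP.2

set_option maxHeartbeats 1000000 in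
lemma IsExact.cert_of_isSplit {J : SimpleGraph V} {x y : V} (hxy : x ≠ y)
    {l₁ l₂ : List (V × List (Sym2 V) × List (Sym2 V))} {D U : List (Sym2 V)}
    (hl : IsExact J y (l₁ ++ (x, D, U) :: l₂)) {oth : Sym2 V → V}
    (hoth : ∀ w, J.Adj x w → oth s(x, w) = w) (hJy : ∀ w, ¬ J.Adj y w)
    (hW : ((D ++ U.reverse).map oth).Nodup) (hmem : ∀ w, w ∈ (D ++ U.reverse).map oth ↔ J.Adj x w)
    {G : SimpleGraph V} {x' y' : V} (h : x' = x ∧ y' = y ∨ x' = y ∧ y' = x)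
    (h1 : ∀ a b, G.Adj a b → a ≠ x → a ≠ y → b ≠ x → b ≠ y → J.Adj a b)
    (h2 : ∀ w, w ≠ x → w ≠ y → G.Adj x w → J.Adj x w)
    (h3 : ∀ w, w ≠ x → w ≠ y → G.Adj y w → J.Adj x w)
    (hs : IsSplit (G.Adj x') (G.Adj y') ((D ++ U.reverse).map oth)) : Cert G := by
  classical
  set l := l₁ ++ (x, D, U) :: l₂ with hl_def
  have hxl : (x, D, U) ∈ l := by simp [hl_def]
  have hxy' : x' ≠ y' := by rcases h with ⟨rfl, rfl⟩ | ⟨rfl, rfl⟩ <;> [exact hxy; exact hxy.symm]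
  have hxW : x ∉ (D ++ U.reverse).map oth := fun h => J.irrefl ((hmem x).1 h)
  have hyW : y ∉ (D ++ U.reverse).map oth := fun h => hJy x ((hmem y).1 h).symm
  obtain ⟨g, A, Y, B, hg, hgn, hgm, hd, hA, hY⟩ := hs.exists_arcs hW hxy'
    (by rcases h with ⟨rfl, rfl⟩ | ⟨rfl, rfl⟩ <;> assumption)
    (by rcases h with ⟨rfl, rfl⟩ | ⟨rfl, rfl⟩ <;> assumption)
  have hyJ : ∀ e ∈ J.edgeSet, y ∉ e := by
    rintro e he ⟨w, rfl⟩
    exact hJy w he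
  have hfst : ∀ r ∈ l, r.1 = x → r = (x, D, U) := fun r hr hrx =>
    List.inj_on_of_nodup_map hl.nodup_vertex hr hxl hrx
  let f : Sym2 V → List (Sym2 V) := fun e =>
    if x ∈ e then if e ∈ D then g (oth e) else (g (oth e)).reverse else [e]
  have hfx : ∀ w, J.Adj x w → ∀ e, e ∈ f s(x, w) ↔ e ∈ g w := by
    intro w hw e
    simp only [f, Sym2.mem_iff, true_or, if_true, hoth w hw]
    split_ifs <;> simp
  have hfn : ∀ e, x ∉ e → f e = [e] := fun e he => if_neg he
  have hback : ∀ e ∈ J.edgeSet, ∀ z ∈ f e, Sym2.map (fun v => if v = y then x else v) z = e := by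
    intro e he z hz
    by_cases hxe : x ∈ e
    · obtain ⟨w, rfl⟩ := hxe
      have hw := hgm w ((hmem w).2 he) z ((hfx w he z).1 hz)
      have hwy : w ≠ y := fun h => hJy x (h ▸ (show J.Adj x w from he).symm)
      rcases h with ⟨rfl, rfl⟩ | ⟨rfl, rfl⟩ <;> rcases hw with rfl | rfl <;> simp [hwy, hxy]
    · rw [hfn e hxe, List.mem_singleton] at hz
      subst hz
      have hye := hyJ _ he
      induction z with | _ a b
      simp only [Sym2.mem_iff, not_or] at hye
      simp [Ne.symm hye.1, Ne.symm hye.2]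
  have hxor : ∀ w, J.Adj x w → (s(x, w) ∈ D ∨ s(x, w) ∈ U) := by
    intro w hw
    obtain ⟨e, he, rfl⟩ := List.mem_map.1 ((hmem w).2 hw)
    have hxe : e ∈ J.edgeSet ∧ x ∈ e := by
      rcases List.mem_append.1 he with he | he
      exacts [hl.down _ hxl e he, hl.up _ hxl e (List.mem_reverse.1 he)]
    obtain ⟨hej, v, rfl⟩ := hxe
    rw [hoth v hej]
    simpa using he
  have hDm : ∀ e ∈ D, e ∈ J.edgeSet ∧ x ∈ e := hl.down _ hxl
  have hUm : ∀ e ∈ U, e ∈ J.edgeSet ∧ x ∈ e := hl.up _ hxl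
  have hDU : ∀ e ∈ U, e ∉ D := by
    intro e hU hD
    obtain ⟨r, hr, r', hr', he, hup, hdown⟩ := hl.edge e (hDm e hD).1
    rw [eq_of_mem_flatMap_nodup hl.nodup_up hr hxl hup hU,
      eq_of_mem_flatMap_nodup hl.nodup_down hr' hxl hdown hD] at he
    have hJ := (hDm e hD).1
    rw [he] at hJ
    exact J.irrefl hJ
  have hword : D.flatMap f ++ (U.flatMap f).reverse = A ++ Y ++ B := by
    rw [← hg, List.flatMap_map, List.flatMap_append, List.reverse_flatMap]
    congr 1
    · refine List.flatMap_congr fun e he => ?_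
      simp only [f, if_pos (hDm e he).2, if_pos he]
    · refine List.flatMap_congr fun e he => ?_
      rw [List.mem_reverse] at he
      simp [f, if_pos (hUm e he).2, if_neg (hDU e he)]
  have hrun := hl.run.flatMap f
  rw [hl_def, List.map_append, List.map_cons, run_append] at hrun
  obtain ⟨M, hM1, hM2⟩ := hrun
  cases hM2 with
  | @cons _ _ _ L R _ _ hM2 =>
  obtain ⟨dx, ux, dy, uy, hmid, he₀, hperm, hax, hay⟩ :=
    exists_run_split (x := x') (y := y') (e₀ := s(x, y)) (L := L) (R := R) hword hd
  obtain ⟨mid, hmidrun, hmidp⟩ : ∃ mid, Run mid (L ++ D.flatMap f ++ R) (L ++ U.flatMap f ++ R) ∧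
      mid.Perm [(x', dx, ux), (y', dy, uy)] := by
    rcases hmid with h | h
    exacts [⟨_, h, .refl _⟩, ⟨_, h, .swap _ _ _⟩]
  set φ : V × List (Sym2 V) × List (Sym2 V) → V × List (Sym2 V) × List (Sym2 V) :=
    fun r => (r.1, r.2.1.flatMap f, r.2.2.flatMap f) with hφ
  have hxm : (x', dx, ux) ∈ l₁.map φ ++ (mid ++ l₂.map φ) := by
    simp [hmidp.mem_iff]
  have hym : (y', dy, uy) ∈ l₁.map φ ++ (mid ++ l₂.map φ) := by
    simp [hmidp.mem_iff]
  have hom : ∀ r ∈ l, r.1 ≠ x → φ r ∈ l₁.map φ ++ (mid ++ l₂.map φ) := by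
    intro r hr hrx
    rcases List.mem_append.1 hr with hr | hr
    · exact List.mem_append_left _ (List.mem_map_of_mem hr)
    · rcases List.mem_cons.1 hr with rfl | hr
      · exact absurd rfl hrx
      · exact List.mem_append_right _ (List.mem_append_right _ (List.mem_map_of_mem hr))
  have hvert : ((l₁.map φ ++ (mid ++ l₂.map φ)).map Prod.fst).Perm (y :: l.map Prod.fst) := by
    have h0 := hmidp.map Prod.fst
    rw [List.perm_iff_count] at h0 ⊢
    intro a
    have h0 := h0 a
    have e1 : ∀ l : List (V × List (Sym2 V) × List (Sym2 V)),
      (l.map φ).map Prod.fst = l.map Prod.fst := fun l => by simp [hφ]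
    simp only [hl_def, List.map_append, e1, List.count_append, List.map_cons, List.map_nil,
      List.count_cons, List.count_nil] at h0 ⊢
    rcases h with ⟨rfl, rfl⟩ | ⟨rfl, rfl⟩ <;> omega
  have hups : ((l₁.map φ ++ (mid ++ l₂.map φ)).flatMap fun r => r.2.2).Perm
      (s(x, y) :: (l.flatMap fun r => r.2.2).flatMap f) := by
    have h0 := hmidp.flatMap_right (fun r => r.2.2)
    rw [List.perm_iff_count] at h0 hperm ⊢
    intro a
    have h0 := h0 a
    have h1 := hperm a
    have e1 : ∀ l : List (V × List (Sym2 V) × List (Sym2 V)),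
      ((l.map φ).flatMap fun r => r.2.2) = (l.flatMap fun r => r.2.2).flatMap f := fun l => by
        rw [List.flatMap_map, List.flatMap_assoc]
    simp only [hl_def, List.flatMap_append, e1, List.count_append, List.flatMap_cons,
      List.flatMap_nil, List.count_cons, List.append_nil] at h0 h1 ⊢
    omega
  have hedges : ∀ e ∈ l.flatMap fun r => r.2.2, e ∈ J.edgeSet := by
    intro e he
    obtain ⟨r, hr, he⟩ := List.mem_flatMap.1 he
    exact (hl.up r hr e he).1
  refine ⟨Sym2 V, l₁.map φ ++ (mid ++ l₂.map φ), ?_, ?_, ?_, ?_, ?_⟩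
  · exact run_append.2 ⟨_, hM1, run_append.2 ⟨_, hmidrun, hM2⟩⟩
  · rw [hvert.nodup_iff, List.nodup_cons]
    refine ⟨fun hy => ?_, hl.nodup_vertex⟩
    obtain ⟨r, hr, hry⟩ := List.mem_map.1 hy
    exact hl.ne r hr hry
  · intro v
    rw [hvert.mem_iff, List.mem_cons]
    exact or_iff_not_imp_left.2 (hl.mem v)
  · rw [hups.nodup_iff, List.nodup_cons]
    constructor
    · intro h0
      obtain ⟨e, he, hz⟩ := List.mem_flatMap.1 h0
      have := hback e (hedges e he) _ hz
      simp only [Sym2.map_mk, hxy, if_true, if_false] at this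
      have hJ := hedges e he
      rw [← this] at hJ
      exact J.irrefl hJ
    · rw [List.nodup_flatMap]
      constructor
      · intro e he
        by_cases hxe : x ∈ e
        · obtain ⟨w, rfl⟩ := hxe
          have hw := hedges _ he
          simp only [f, Sym2.mem_iff, true_or, if_true, hoth w hw]
          split_ifs
          · exact hgn w ((hmem w).2 hw)
          · exact List.nodup_reverse.2 (hgn w ((hmem w).2 hw))
        · rw [hfn e hxe]
          simp
      · refine hl.nodup_up.imp_of_mem fun {e e'} he he' hne z hz hz' => hne ?_
        rw [← hback e (hedges e he) z hz, ← hback e' (hedges e' he') z hz']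
  · have hUp : ∀ r ∈ l, ∀ e ∈ r.2.2, ∀ z ∈ f e, r.1 ≠ x ∧ z ∈ (φ r).2.2 ∨
        r.1 = x ∧ (z ∈ A ++ B → z ∈ ux) ∧ (z ∈ Y → z ∈ uy) := by
      intro r hr e he z hz
      by_cases hrx : r.1 = x
      · obtain rfl := hfst r hr hrx
        have hzU : z ∈ U.flatMap f := List.mem_flatMap.2 ⟨e, he, hz⟩
        exact Or.inr ⟨rfl, fun h => (hax z h).2 hzU, fun h => (hay z h).2 hzU⟩
      · exact Or.inl ⟨hrx, List.mem_flatMap.2 ⟨e, he, hz⟩⟩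
    have hDown : ∀ r ∈ l, ∀ e ∈ r.2.1, ∀ z ∈ f e, r.1 ≠ x ∧ z ∈ (φ r).2.1 ∨
        r.1 = x ∧ (z ∈ A ++ B → z ∈ dx) ∧ (z ∈ Y → z ∈ dy) := by
      intro r hr e he z hz
      by_cases hrx : r.1 = x
      · obtain rfl := hfst r hr hrx
        have hzU : z ∈ D.flatMap f := List.mem_flatMap.2 ⟨e, he, hz⟩
        exact Or.inr ⟨rfl, fun h => (hax z h).1 hzU, fun h => (hay z h).1 hzU⟩
      · exact Or.inl ⟨hrx, List.mem_flatMap.2 ⟨e, he, hz⟩⟩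
    have hx' : ∀ w, w ≠ x → w ≠ y → G.Adj x' w → J.Adj x w := by
      rcases h with ⟨rfl, rfl⟩ | ⟨rfl, rfl⟩ <;> assumption
    have hy' : ∀ w, w ≠ x → w ≠ y → G.Adj y' w → J.Adj x w := by
      rcases h with ⟨rfl, rfl⟩ | ⟨rfl, rfl⟩ <;> assumption
    have key : ∀ w, J.Adj x w → ∀ (ρ : V × List (Sym2 V) × List (Sym2 V)),
        ρ ∈ l₁.map φ ++ (mid ++ l₂.map φ) → ∀ z ∈ f s(x, w),
        ((z ∈ A ++ B → z ∈ ux) ∧ (z ∈ Y → z ∈ uy) → z ∈ ρ.2.2) →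
        ((z ∈ A ++ B → z ∈ dx) ∧ (z ∈ Y → z ∈ dy) → z ∈ ρ.2.1) →
        ∃ e, ∃ r ∈ l₁.map φ ++ (mid ++ l₂.map φ), ∃ r' ∈ l₁.map φ ++ (mid ++ l₂.map φ),
          s(ρ.1, w) = s(r.1, r'.1) ∧ e ∈ r.2.2 ∧ e ∈ r'.2.1 := by
      intro w hw ρ hρ z hz hu hdn
      obtain ⟨r, hr, r', hr', he, hup, hdown⟩ := hl.edge s(x, w) hw
      replace hup := hUp r hr _ hup z hz
      replace hdown := hDown r' hr' _ hdown z hz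
      rcases Sym2.eq_iff.1 he with ⟨e1, rfl⟩ | ⟨e1, rfl⟩
      · replace hup := hup.resolve_left fun h => h.1 e1.symm
        replace hdown := hdown.resolve_right fun h => hw.ne h.1.symm
        exact ⟨z, ρ, hρ, φ r', hom r' hr' hdown.1, rfl, hu hup.2, hdown.2⟩
      · replace hdown := hdown.resolve_left fun h => h.1 e1.symm
        replace hup := hup.resolve_right fun h => hw.ne h.1.symm
        exact ⟨z, φ r, hom r hr hup.1, ρ, hρ, Sym2.eq_swap, hup.2, hdn hdown.2⟩
    have keyx : ∀ w, w ≠ x → w ≠ y → G.Adj x' w → ∃ e, ∃ r ∈ l₁.map φ ++ (mid ++ l₂.map φ),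
        ∃ r' ∈ l₁.map φ ++ (mid ++ l₂.map φ), s(x', w) = s(r.1, r'.1) ∧ e ∈ r.2.2 ∧ e ∈ r'.2.1 := by
      intro w hwx hwy hw
      have hJ := hx' w hwx hwy hw
      have h' := hA w ((hmem w).2 hJ) hw
      exact key w hJ _ hxm _ ((hfx w hJ _).2 h'.1) (fun h => h.1 h'.2) (fun h => h.1 h'.2)
    have keyy : ∀ w, w ≠ x → w ≠ y → G.Adj y' w → ∃ e, ∃ r ∈ l₁.map φ ++ (mid ++ l₂.map φ),
        ∃ r' ∈ l₁.map φ ++ (mid ++ l₂.map φ), s(y', w) = s(r.1, r'.1) ∧ e ∈ r.2.2 ∧ e ∈ r'.2.1 := by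
      intro w hwx hwy hw
      have hJ := hy' w hwx hwy hw
      have h' := hY w ((hmem w).2 hJ) hw
      exact key w hJ _ hym _ ((hfx w hJ _).2 h'.1) (fun h => h.2 h'.2) (fun h => h.2 h'.2)
    have hxy_iff : ∀ a, (a = x ∨ a = y) ↔ (a = x' ∨ a = y') := by
      rcases h with ⟨rfl, rfl⟩ | ⟨rfl, rfl⟩ <;> intro a <;> tauto
    have hcase : ∀ a b, (a = x ∨ a = y) → ¬ (b = x ∨ b = y) → G.Adj a b →
        ∃ e, ∃ r ∈ l₁.map φ ++ (mid ++ l₂.map φ), ∃ r' ∈ l₁.map φ ++ (mid ++ l₂.map φ),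
          s(a, b) = s(r.1, r'.1) ∧ e ∈ r.2.2 ∧ e ∈ r'.2.1 := by
      intro a b ha hb hab
      push Not at hb
      rcases (hxy_iff a).1 ha with rfl | rfl
      exacts [keyx b hb.1 hb.2 hab, keyy b hb.1 hb.2 hab]
    intro a b hab
    by_cases ha : a = x ∨ a = y <;> by_cases hb : b = x ∨ b = y
    · have : s(a, b) = s(x', y') := by
        rw [hxy_iff] at ha hb
        rcases ha with rfl | rfl <;> rcases hb with rfl | rfl
        exacts [absurd hab (G.irrefl), rfl, Sym2.eq_swap, absurd hab (G.irrefl)]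
      rw [this]
      rcases he₀ with ⟨h1, h2⟩ | ⟨h1, h2⟩
      exacts [⟨_, _, hxm, _, hym, rfl, h1, h2⟩, ⟨_, _, hym, _, hxm, Sym2.eq_swap, h1, h2⟩]
    · exact hcase a b ha hb hab
    · rw [Sym2.eq_swap]
      exact hcase b a hb ha hab.symm
    · push Not at ha hb
      obtain ⟨r, hr, r', hr', he, hup, hdown⟩ := hl.edge s(a, b) (h1 a b hab ha.1 ha.2 hb.1 hb.2)
      have hf : s(a, b) ∈ f s(a, b) := by
        rw [hfn _ (by simp [ha.1.symm, hb.1.symm])]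
        simp
      have hne : r.1 ≠ x ∧ r'.1 ≠ x := by
        rcases Sym2.eq_iff.1 he with ⟨rfl, rfl⟩ | ⟨rfl, rfl⟩
        exacts [⟨ha.1, hb.1⟩, ⟨hb.1, ha.1⟩]
      exact ⟨s(a, b), φ r, hom r hr hne.1, φ r', hom r' hr' hne.2, he,
        ((hUp r hr _ hup _ hf).resolve_right fun h => hne.1 h.1).2,
        ((hDown r' hr' _ hdown _ hf).resolve_right fun h => hne.2 h.1).2⟩

/-- A vertex `x` of a graph with a planarity certificate has a rotation, along which it can be
split, the isolated vertex `y` becoming the second half. -/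
theorem Cert.exists_split {J : SimpleGraph V} (hJ : Cert J) {x y : V} (hxy : x ≠ y)
    (hy : ∀ w, ¬ J.Adj y w) :
    ∃ W : List V, W.Nodup ∧ (∀ w, w ∈ W ↔ J.Adj x w) ∧ ∀ G : SimpleGraph V,
      (∀ a b, G.Adj a b → a ≠ x → a ≠ y → b ≠ x → b ≠ y → J.Adj a b) →
      (∀ w, w ≠ x → w ≠ y → G.Adj x w → J.Adj x w) →
      (∀ w, w ≠ x → w ≠ y → G.Adj y w → J.Adj x w) →
      IsSplit (G.Adj x) (G.Adj y) W ∨ IsSplit (G.Adj y) (G.Adj x) W → Cert G := by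
  classical
  obtain ⟨l, hl⟩ := hJ.exists_exact hy
  obtain ⟨⟨x, D, U⟩, hr, rfl⟩ := List.mem_map.1 (hl.mem x hxy)
  obtain ⟨l₁, l₂, rfl⟩ := List.append_of_mem hr
  have : ∀ e : Sym2 V, ∃ w, x ∈ e → e = s(x, w) := by
    intro e
    by_cases h : x ∈ e
    · exact ⟨h.choose, fun _ => h.choose_spec⟩
    · exact ⟨x, fun h' => absurd h' h⟩
  choose oth ho using this
  have hoth : ∀ w, J.Adj x w → oth s(x, w) = w := fun w hw => by
    have := ho s(x, w) (Sym2.mem_mk_left _ _)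
    exact (Sym2.congr_right.1 this).symm
  have hDU : ∀ e ∈ D ++ U.reverse, e ∈ J.edgeSet ∧ x ∈ e := by
    intro e he
    rcases List.mem_append.1 he with he | he
    exacts [hl.down _ hr e he, hl.up _ hr e (List.mem_reverse.1 he)]
  have hn : ((D ++ U.reverse).map oth).Nodup := by
    refine (List.nodup_append.2 ⟨?_, ?_, ?_⟩).map_on fun e he e' he' h => ?_
    · exact (List.nodup_flatMap.1 hl.nodup_down).1 _ hr
    · exact List.nodup_reverse.2 ((List.nodup_flatMap.1 hl.nodup_up).1 _ hr)
    · rintro e hD e' hU rfl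
      rw [List.mem_reverse] at hU
      have hJ := (hl.down _ hr e hD).1
      obtain ⟨r, hr', r', hr'', he, hup, hdown⟩ := hl.edge e hJ
      rw [eq_of_mem_flatMap_nodup hl.nodup_up hr' hr hup hU,
        eq_of_mem_flatMap_nodup hl.nodup_down hr'' hr hdown hD] at he
      rw [he] at hJ
      exact J.irrefl hJ
    · rw [ho e (hDU e he).2, ho e' (hDU e' he').2, h]
  have hm : ∀ w, w ∈ (D ++ U.reverse).map oth ↔ J.Adj x w := by
    intro w
    constructor
    · intro h
      obtain ⟨e, he, rfl⟩ := List.mem_map.1 h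
      have := hDU e he
      rw [ho e this.2] at this
      exact this.1
    · intro h
      refine List.mem_map.2 ⟨s(x, w), ?_, hoth w h⟩
      obtain ⟨r, hr', r', hr'', he, hup, hdown⟩ := hl.edge s(x, w) h
      have : r.1 = x ∨ r'.1 = x := by
        rcases Sym2.eq_iff.1 he with h | h
        exacts [Or.inl h.1.symm, Or.inr h.1.symm]
      rcases this with h | h
      · rw [List.inj_on_of_nodup_map hl.nodup_vertex hr' hr h] at hup
        simp [show s(x, w) ∈ U from hup]
      · rw [List.inj_on_of_nodup_map hl.nodup_vertex hr'' hr h] at hdown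
        simp [show s(x, w) ∈ D from hdown]
  refine ⟨_, hn, hm, fun G h1 h2 h3 hs => ?_⟩
  rcases hs with hs | hs
  · exact hl.cert_of_isSplit hxy hoth hy hn hm (Or.inl ⟨rfl, rfl⟩) h1 h2 h3 hs
  · exact hl.cert_of_isSplit hxy hoth hy hn hm (Or.inr ⟨rfl, rfl⟩) h1 h2 h3 hs

end Split

end OnePlanarity

namespace OnePlanarity

section Words

variable {V : Type}

lemma isSplit_of_index {p q : V → Prop} {W : List V} {i j : ℕ} (hij : i ≤ j) (hj : j < W.length)
    (hq : ∀ k (hk : k < W.length), k < i ∨ j < k → ¬ q W[k])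
    (hp : ∀ k (hk : k < W.length), i < k → k < j → ¬ p W[k]) : IsSplit p q W := by
  have hP : ∀ w ∈ W.take i ++ W.drop (j + 1), ¬ q w := by
    intro w hw
    rcases List.mem_append.1 hw with hw | hw
    · obtain ⟨k, hk, rfl⟩ := List.mem_take_iff_getElem.1 hw
      exact hq k (by omega) (by omega)
    · obtain ⟨k, hk, rfl⟩ := List.mem_drop_iff_getElem.1 hw
      exact hq _ (by omega) (by omega)
  rcases hij.eq_or_lt with rfl | hij
  · refine ⟨W.take i, [W[i]], [], [], W.drop (i + 1), ?_, by simp, by simp, hP, by simp⟩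
    simp
  · refine ⟨W.take i, [W[i]], (W.take j).drop (i + 1), [W[j]], W.drop (j + 1), ?_, by simp,
      by simp, hP, ?_⟩
    · have h1 : W.take i ++ [W[i]] = (W.take j).take (i + 1) := by
        rw [List.take_take, min_eq_left (by omega)]
        simp
      rw [h1, List.take_append_drop]
      simp
    · intro w hw
      obtain ⟨k, hk, rfl⟩ := List.mem_drop_iff_getElem.1 hw
      rw [List.getElem_take]
      rw [List.length_take] at hk
      exact hp _ _ (by omega) (by omega)

/-- `IsSplit` up to exchanging the two predicates. -/
def Splits (p q : V → Prop) (W : List V) : Prop := IsSplit p q W ∨ IsSplit q p W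

/-- The letters of two pairs alternate along `W`. -/
def Alternate (W : List V) (a₁ a₂ b₁ b₂ : V) : Prop :=
  Splits (fun w => w = a₁ ∨ w = b₁) (fun w => w = a₂ ∨ w = b₂) W ∧
    Splits (fun w => w = a₁ ∨ w = b₂) (fun w => w = a₂ ∨ w = b₁) W

lemma alternate_of_index {W : List V} (hW : W.Nodup) {i j k l : ℕ} (hij : i < j) (hjk : j < k)
    (hkl : k < l) (hl : l < W.length) : Alternate W W[i] W[k] W[j] W[l] := by
  constructor
  · refine Or.inl (isSplit_of_index (i := k) (j := l) (by omega) (by omega) ?_ ?_)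
    all_goals
      intro m hm hm'
      simp only [hW.getElem_inj_iff]
      omega
  · refine Or.inl (isSplit_of_index (i := j) (j := k) (by omega) (by omega) ?_ ?_)
    all_goals
      intro m hm hm'
      simp only [hW.getElem_inj_iff]
      omega

lemma Alternate.symm {W : List V} {a₁ a₂ b₁ b₂ : V} (h : Alternate W a₁ a₂ b₁ b₂) :
    Alternate W b₁ b₂ a₁ a₂ := by
  obtain ⟨h1, h2⟩ := h
  refine ⟨?_, ?_⟩
  · rw [show (fun w => w = b₁ ∨ w = a₁) = fun w => w = a₁ ∨ w = b₁ from
      funext fun _ => propext or_comm, show (fun w => w = b₂ ∨ w = a₂) = fun w => w = a₂ ∨ w = b₂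
      from funext fun _ => propext or_comm]
    exact h1
  · rw [show (fun w => w = b₁ ∨ w = a₂) = fun w => w = a₂ ∨ w = b₁ from
      funext fun _ => propext or_comm, show (fun w => w = b₂ ∨ w = a₁) = fun w => w = a₁ ∨ w = b₂
      from funext fun _ => propext or_comm]
    exact h2.symm

/-- A word either splits, or contains three letters with both properties, or contains
alternating pairs of letters with the two properties. -/
lemma splits_or {p q : V → Prop} {W : List V} (hW : W.Nodup) :
    Splits p q W ∨
    (∃ a b c, a ∈ W ∧ b ∈ W ∧ c ∈ W ∧ a ≠ b ∧ a ≠ c ∧ b ≠ c ∧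
      (p a ∧ q a) ∧ (p b ∧ q b) ∧ (p c ∧ q c)) ∨
    ∃ a₁ a₂ b₁ b₂, [a₁, a₂, b₁, b₂].Nodup ∧ (∀ w ∈ [a₁, a₂, b₁, b₂], w ∈ W) ∧
      (p a₁ ∧ p a₂) ∧ (q b₁ ∧ q b₂) ∧ Alternate W a₁ a₂ b₁ b₂ := by
  classical
  have hpq : ∀ {i j k l : ℕ} (hij : i < j) (hjk : j < k) (hkl : k < l) (hl : l < W.length),
      p W[i] → q W[j] → p W[k] → q W[l] →
      ∃ a₁ a₂ b₁ b₂, [a₁, a₂, b₁, b₂].Nodup ∧ (∀ w ∈ [a₁, a₂, b₁, b₂], w ∈ W) ∧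
      (p a₁ ∧ p a₂) ∧ (q b₁ ∧ q b₂) ∧ Alternate W a₁ a₂ b₁ b₂ := by
    intro i j k l hij hjk hkl hl h1 h2 h3 h4
    refine ⟨W[i], W[k], W[j], W[l], ?_, by simp, ⟨h1, h3⟩, ⟨h2, h4⟩,
      alternate_of_index hW hij hjk hkl hl⟩
    simp [hW.getElem_inj_iff]
    omega
  have hqp : ∀ {i j k l : ℕ} (hij : i < j) (hjk : j < k) (hkl : k < l) (hl : l < W.length),
      q W[i] → p W[j] → q W[k] → p W[l] →
      ∃ a₁ a₂ b₁ b₂, [a₁, a₂, b₁, b₂].Nodup ∧ (∀ w ∈ [a₁, a₂, b₁, b₂], w ∈ W) ∧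
      (p a₁ ∧ p a₂) ∧ (q b₁ ∧ q b₂) ∧ Alternate W a₁ a₂ b₁ b₂ := by
    intro i j k l hij hjk hkl hl h1 h2 h3 h4
    refine ⟨W[j], W[l], W[i], W[k], ?_, by simp, ⟨h2, h4⟩, ⟨h1, h3⟩,
      (alternate_of_index hW hij hjk hkl hl).symm⟩
    simp [hW.getElem_inj_iff]
    omega
  have hspan : ∀ r : V → Prop, (∀ w ∈ W, ¬ r w) ∨ ∃ i j, ∃ (hij : i ≤ j) (hj : j < W.length),
      r W[i] ∧ r W[j] ∧ ∀ k (hk : k < W.length), k < i ∨ j < k → ¬ r W[k] := by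
    intro r
    by_cases h : ∃ k, ∃ hk : k < W.length, r W[k]
    · right
      set T := (Finset.range W.length).filter fun k => ∃ hk : k < W.length, r W[k]
      have hT : T.Nonempty := by
        obtain ⟨k, hk, h⟩ := h
        exact ⟨k, by simp [T, hk, h]⟩
      have hmem : ∀ k, k ∈ T ↔ ∃ hk : k < W.length, r W[k] := by
        intro k
        simp only [T, Finset.mem_filter, Finset.mem_range]
        exact ⟨fun h => h.2, fun h => ⟨h.1, h⟩⟩
      obtain ⟨h1, h1'⟩ := (hmem _).1 (T.min'_mem hT)
      obtain ⟨h2, h2'⟩ := (hmem _).1 (T.max'_mem hT)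
      refine ⟨T.min' hT, T.max' hT, T.min'_le _ (T.max'_mem hT), h2, h1', h2', ?_⟩
      intro k hk hk' hr
      have := T.min'_le k ((hmem k).2 ⟨hk, hr⟩)
      have := T.le_max' k ((hmem k).2 ⟨hk, hr⟩)
      omega
    · left
      intro w hw hr
      obtain ⟨k, hk, rfl⟩ := List.getElem_of_mem hw
      exact h ⟨k, hk, hr⟩
  rcases hspan q with hq | ⟨fq, lq, hflq, hlq, hfq, hllq, hq⟩
  · exact Or.inl (Or.inl ⟨W, [], [], [], [], by simpa using hq⟩)
  rcases hspan p with hp | ⟨fp, lp, hflp, hlp, hfp, hllp, hp⟩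
  · exact Or.inl (Or.inr ⟨W, [], [], [], [], by simpa using hp⟩)
  by_cases hi : ∃ i, ∃ hi : i < W.length, fq < i ∧ i < lq ∧ p W[i]
  swap
  · exact Or.inl (Or.inl (isSplit_of_index hflq hlq hq fun k hk h1 h2 h3 =>
      hi ⟨k, hk, h1, h2, h3⟩))
  by_cases hj : ∃ i, ∃ hi : i < W.length, fp < i ∧ i < lp ∧ q W[i]
  swap
  · exact Or.inl (Or.inr (isSplit_of_index hflp hlp hp fun k hk h1 h2 h3 =>
      hj ⟨k, hk, h1, h2, h3⟩))
  obtain ⟨i, hi, hi1, hi2, hpi⟩ := hi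
  obtain ⟨j, hj, hj1, hj2, hqj⟩ := hj
  right
  rcases lt_trichotomy fp fq with h | rfl | h
  · exact Or.inr (hpq h hi1 hi2 hlq hfp hfq hpi hllq)
  swap
  · exact Or.inr (hqp h hj1 hj2 hlp hfq hfp hqj hllp)
  rcases lt_trichotomy lp lq with h | rfl | h
  · exact Or.inr (hpq hj1 hj2 h hlq hfp hqj hllp hllq)
  swap
  · exact Or.inr (hqp hi1 hi2 h hlp hfq hpi hllq hllp)
  rcases lt_trichotomy i j with h | rfl | h
  · exact Or.inr (hqp hi1 h hj2 hlp hfq hpi hqj hllp)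
  swap
  · exact Or.inr (hpq hj1 h hi2 hlp hfp hqj hpi hllq)
  refine Or.inl ⟨W[fp], W[i], W[lp], by simp, by simp, by simp, ?_, ?_, ?_, ⟨hfp, hfq⟩,
    ⟨hpi, hqj⟩, hllp, hllq⟩ <;> simp only [ne_eq, hW.getElem_inj_iff] <;> omega

end Words

end OnePlanarity

namespace OnePlanarity

section Glue

variable {V ι : Type*}

lemma IsModel.of_maps {H : SimpleGraph ι} {G G' : SimpleGraph V} {B : ι → Set V}
    (hB : IsModel H G B) (f : ι → V → V)
    (hdisj : ∀ i j, i ≠ j → ∀ u ∈ B i, ∀ v ∈ B j, f i u ≠ f j v)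
    (hconn : ∀ i, ∀ u ∈ B i, ∀ v ∈ B i, G.Adj u v → f i u = f i v ∨ G'.Adj (f i u) (f i v))
    (hadj : ∀ i j, i ≠ j → H.Adj i j → ∀ u ∈ B i, ∀ v ∈ B j, G.Adj u v → G'.Adj (f i u) (f j v)) :
    IsModel H G' fun i => f i '' B i := by
  refine ⟨?_, fun i => (hB.conn i).image _ (hconn i), fun i j hij => ?_⟩
  · rintro i j _ ⟨u, hu, rfl⟩ ⟨v, hv, h⟩
    by_contra hij
    exact hdisj i j hij u hu v hv h.symm
  · obtain ⟨u, hu, v, hv, huv⟩ := hB.adj i j hij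
    exact ⟨_, ⟨u, hu, rfl⟩, _, ⟨v, hv, rfl⟩, hadj i j hij.ne hij u hu v hv huv⟩

lemma IsModel.glue_half {H : SimpleGraph ι} (hH : IsObstruction H) {G G₁ : SimpleGraph V}
    {B : ι → Set V} (hB : IsModel H G B) {A T A' : Set V} {s t a b : V}
    (hcov : ∀ i, ∀ v ∈ B i, v ∈ A ∨ v ∈ T ∨ v ∈ A') (hAA : ∀ v ∈ A, v ∉ A')
    (hTA : ∀ v ∈ T, v ∉ A') (ha : a ∈ A) (hb : b ∈ A')
    (hT : ∀ v ∈ T, v = s ∨ v = t) (hclique : ∀ u ∈ T, ∀ v ∈ T, u ≠ v → G₁.Adj u v)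
    (hcross : ∀ u ∈ A, ∀ v ∈ A', G.Adj u v → u = a ∧ v = b)
    (h1 : ∀ u v, u ∉ A' → v ∉ A' → G.Adj u v → G₁.Adj u v) (h2 : ∀ u ∈ T, G₁.Adj b u)
    (h3 : G₁.Adj a b) (hone : ∀ i j, B i ⊆ A' → B j ⊆ A' → i = j) :
    ∃ B', IsModel H G₁ B' := by
  classical
  have hbA : b ∉ A := fun h => hAA b h hb
  have hbT : b ∉ T := fun h => hTA b h hb
  have hsep : ∀ i, ¬ B i ⊆ A' → (∀ v ∈ B i, v ∉ T) → (∃ v ∈ B i, v ∈ A') → a ∈ B i ∧ b ∈ B i := by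
    intro i hi hiT ⟨v, hv, hvA⟩
    obtain ⟨u, hu, huA⟩ := Set.not_subset.1 hi
    obtain ⟨x, hx, hxX, y, hy, hyX, hxy⟩ := (hB.conn i).exists_adj hv hvA hu huA
    have hyA := ((hcov i y hy).resolve_right fun h => h.elim (hiT y hy) hyX)
    obtain ⟨rfl, rfl⟩ := hcross y hyA x hxX hxy.symm
    exact ⟨hy, hx⟩
  by_cases hβ : ∃ h₀, B h₀ ⊆ A'
  · obtain ⟨h₀, hh₀⟩ := hβ
    have hsub : ∀ i, i ≠ h₀ → ¬ B i ⊆ A' := fun i hi h => hi (hone i h₀ h hh₀)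
    have hN : ∀ k, H.Adj h₀ k → (∀ v ∈ B k, v ∉ T) → a ∈ B k ∧ (b ∈ B h₀ ∨ b ∈ B k) := by
      intro k hk hkT
      obtain ⟨u, hu, v, hv, huv⟩ := hB.adj _ _ hk
      rcases hcov k v hv with hvA | hvT | hvA
      · obtain ⟨rfl, rfl⟩ := hcross v hvA u (hh₀ hu) huv.symm
        exact ⟨hv, .inl hu⟩
      · exact absurd hvT (hkT v hv)
      · have := hsep k (hsub k hk.ne') hkT ⟨v, hv, hvA⟩
        exact ⟨this.1, .inr this.2⟩
    have hpigeon : ∀ i j k, i ≠ j → i ≠ k → j ≠ k → (∃ v ∈ B i, v ∈ T) → (∃ v ∈ B j, v ∈ T) →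
        (∃ v ∈ B k, v ∈ T) → False := by
      rintro i j k hij hik hjk ⟨u, hu, huT⟩ ⟨v, hv, hvT⟩ ⟨w, hw, hwT⟩
      have huv : u ≠ v := fun h => hij (hB.disj i j u hu (h ▸ hv))
      have huw : u ≠ w := fun h => hik (hB.disj i k u hu (h ▸ hw))
      have hvw : v ≠ w := fun h => hjk (hB.disj j k v hv (h ▸ hw))
      rcases hT u huT with h1 | h1 <;> rcases hT v hvT with h2 | h2 <;>
        rcases hT w hwT with h3 | h3 <;>
        first
          | exact huv (h1.trans h2.symm)
          | exact huw (h1.trans h3.symm)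
          | exact hvw (h2.trans h3.symm)
    obtain ⟨k, hk, hkT⟩ : ∃ k, H.Adj h₀ k ∧ ∀ v ∈ B k, v ∉ T := by
      by_contra! hcon
      obtain ⟨i, j, k, hij, hik, hjk, hi, hj, hk⟩ := hH.three h₀
      exact hpigeon i j k hij hik hjk (hcon i hi) (hcon j hj) (hcon k hk)
    obtain ⟨hak, hbk⟩ := hN k hk hkT
    have hka : ∀ i, a ∈ B i → i = k := fun i hi => hB.disj i k a hi hak
    have hbad : ∀ j, j ≠ h₀ → j ≠ k → H.Adj k j → (∃ v ∈ B k, v ∈ A') → ¬ ∃ v ∈ B j, v ∈ T := by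
      intro j hj hjk hkj hkA hjT
      have hbk := (hsep k (hsub k hk.ne') hkT hkA).2
      have hτ : ∀ i, H.Adj h₀ i → i ≠ k → ∃ v ∈ B i, v ∈ T := by
        intro i hi hik
        by_contra! hcon
        exact hik (hka i (hN i hi hcon).1)
      obtain ⟨i₁, i₂, i₃, h12, h13, h23, hi₁, hi₂, hi₃⟩ := hH.three h₀
      have h0j : H.Adj h₀ j := by
        by_contra h0j
        have : ∀ i, H.Adj h₀ i → i ≠ j := fun i hi h => h0j (h ▸ hi)
        rcases eq_or_ne i₁ k with rfl | h1
        · exact hpigeon i₂ i₃ j h23 (this _ hi₂) (this _ hi₃) (hτ _ hi₂ h12.symm)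
            (hτ _ hi₃ h13.symm) hjT
        · rcases eq_or_ne i₂ k with rfl | h2
          · exact hpigeon i₁ i₃ j h13 (this _ hi₁) (this _ hi₃) (hτ _ hi₁ h1)
              (hτ _ hi₃ h23.symm) hjT
          · exact hpigeon i₁ i₂ j h12 (this _ hi₁) (this _ hi₂) (hτ _ hi₁ h1) (hτ _ hi₂ h2) hjT
      obtain ⟨c, d, hcd, hcj, hck, hdj, hdk, hc, hd⟩ := hH.four h₀ j k h0j hk hkj.symm
      exact hpigeon c d j hcd hcj hdj (hτ c hc hck) (hτ d hd hdk) hjT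
    let g : ι → V := fun i => if h : ∃ v ∈ B i, v ∈ T then h.choose else a
    have hg : ∀ i, (∃ v ∈ B i, v ∈ T) → g i ∈ B i ∧ g i ∈ T := fun i h => by
      simp only [g, dif_pos h]
      exact h.choose_spec
    have hgk : g k = a := dif_neg fun ⟨v, hv, h⟩ => hkT v hv h
    have hmeet : ∀ i, i ≠ h₀ → i ≠ k → (∃ v ∈ B i, v ∈ A') → ∃ v ∈ B i, v ∈ T := by
      intro i hi hik hiA
      by_contra! hcon
      exact hik (hka i (hsep i (hsub i hi) hcon hiA).1)
    let f : ι → V → V := fun i v => if i = h₀ then b else if v ∈ A' then g i else v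
    have f0 : ∀ v, f h₀ v = b := fun v => if_pos rfl
    have fA : ∀ i, i ≠ h₀ → ∀ v ∈ A', f i v = g i := fun i hi v hv => by simp [f, hi, hv]
    have fn : ∀ i, i ≠ h₀ → ∀ v, v ∉ A' → f i v = v := fun i hi v hv => by simp [f, hi, hv]
    have fmem : ∀ i, i ≠ h₀ → ∀ v ∈ B i, f i v ∈ B i ∧ f i v ∉ A' := by
      intro i hi v hv
      by_cases hvA : v ∈ A'
      · rw [fA i hi v hvA]
        by_cases hik : i = k
        · subst hik
          rw [hgk]
          exact ⟨hak, hAA a ha⟩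
        · have := hg i (hmeet i hi hik ⟨v, hv, hvA⟩)
          exact ⟨this.1, hTA _ this.2⟩
      · rw [fn i hi v hvA]
        exact ⟨hv, hvA⟩
    have hA : ∀ i, ∀ v ∈ B i, v ∉ A' → v ∉ T → v ∈ A := fun i v hv h h' =>
      (hcov i v hv).resolve_right fun h'' => h''.elim h' h
    have hb0 : ∀ i, i ≠ h₀ → ∀ u ∈ B h₀, ∀ v ∈ B i, G.Adj u v → G₁.Adj b (f i v) := by
      intro i hi u hu v hv huv
      by_cases hvA : v ∈ A'
      · rw [fA i hi v hvA]
        by_cases hik : i = k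
        · rw [hik, hgk]
          exact h3.symm
        · exact h2 _ (hg i (hmeet i hi hik ⟨v, hv, hvA⟩)).2
      · rw [fn i hi v hvA]
        by_cases hvT : v ∈ T
        · exact h2 v hvT
        · obtain ⟨rfl, rfl⟩ := hcross v (hA i v hv hvA hvT) u (hh₀ hu) huv.symm
          exact h3.symm
    -- an edge leaving `A'` towards a part other than the exceptional one
    have hout : ∀ i j, i ≠ h₀ → j ≠ h₀ → (i = j ∨ H.Adj i j) → ∀ u ∈ B i, ∀ v ∈ B j, u ∉ A' →
        v ∈ A' → G.Adj u v → f i u = f j v ∨ G₁.Adj (f i u) (f j v) := by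
      intro i j hi hj hij u hu v hv huA hvA huv
      rw [fn i hi u huA, fA j hj v hvA]
      by_cases huT : u ∈ T
      · have hik : i ≠ k := by
          rintro rfl
          exact hkT u hu huT
        by_cases hjk : j = k
        · subst hjk
          exact absurd ⟨u, hu, huT⟩ (hbad i hi hik ((hij.resolve_left hik).symm) ⟨v, hv, hvA⟩)
        · have := hg j (hmeet j hj hjk ⟨v, hv, hvA⟩)
          exact (eq_or_ne u (g j)).imp_right (hclique u huT _ this.2)
      · obtain ⟨rfl, rfl⟩ := hcross u (hA i u hu huA huT) v hvA huv
        have hik := hka i hu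
        have : j = k := by
          rcases hbk with h | h
          · exact absurd (hB.disj _ _ _ hv h) hj
          · exact hB.disj _ _ _ hv h
        rw [this, hgk]
        exact .inl rfl
    have hall : ∀ i j, i ≠ h₀ → j ≠ h₀ → (i = j ∨ H.Adj i j) → ∀ u ∈ B i, ∀ v ∈ B j,
        G.Adj u v → f i u = f j v ∨ G₁.Adj (f i u) (f j v) := by
      intro i j hi hj hij u hu v hv huv
      by_cases huA : u ∈ A' <;> by_cases hvA : v ∈ A'
      · rw [fA i hi u huA, fA j hj v hvA]
        rcases hij with rfl | hij
        · exact .inl rfl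
        · by_cases hik : i = k
          · subst hik
            exact absurd (hmeet j hj hij.ne' ⟨v, hv, hvA⟩) (hbad j hj hij.ne' hij ⟨u, hu, huA⟩)
          · by_cases hjk : j = k
            · subst hjk
              exact absurd (hmeet i hi hik ⟨u, hu, huA⟩) (hbad i hi hik hij.symm ⟨v, hv, hvA⟩)
            · have h1 := hg i (hmeet i hi hik ⟨u, hu, huA⟩)
              have h2 := hg j (hmeet j hj hjk ⟨v, hv, hvA⟩)
              exact (eq_or_ne _ _).imp_right (hclique _ h1.2 _ h2.2)
      · exact (hout j i hj hi (hij.imp Eq.symm fun h => h.symm) v hv u hu hvA huA huv.symm).imp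
          Eq.symm fun h => h.symm
      · exact hout i j hi hj hij u hu v hv huA hvA huv
      · rw [fn i hi u huA, fn j hj v hvA]
        exact .inr (h1 u v huA hvA huv)
    have hdisj : ∀ i j, i ≠ j → ∀ u ∈ B i, ∀ v ∈ B j, f i u ≠ f j v := by
      intro i j hij u hu v hv h
      by_cases hi : i = h₀
      · subst hi
        rw [f0] at h
        exact (fmem j hij.symm v hv).2 (h ▸ hb)
      · by_cases hj : j = h₀
        · subst hj
          rw [f0] at h
          exact (fmem i hij u hu).2 (h ▸ hb)
        · exact hij (hB.disj i j _ (fmem i hi u hu).1 (h ▸ (fmem j hj v hv).1))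
    refine ⟨_, hB.of_maps f hdisj ?_ ?_⟩
    · intro i u hu v hv huv
      by_cases hi : i = h₀
      · subst hi
        exact .inl ((f0 u).trans (f0 v).symm)
      · exact hall i i hi hi (.inl rfl) u hu v hv huv
    · intro i j hij hH' u hu v hv huv
      by_cases hi : i = h₀
      · subst hi
        rw [f0]
        exact hb0 j hij.symm u hu v hv huv
      · by_cases hj : j = h₀
        · subst hj
          rw [f0]
          exact (hb0 i hij v hv u hu huv.symm).symm
        · exact (hall i j hi hj (.inr hH') u hu v hv huv).resolve_left (hdisj i j hij u hu v hv)
  · push Not at hβ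
    let g : ι → V := fun i => if b ∈ B i then b else if h : ∃ v ∈ B i, v ∈ T then h.choose else a
    have hg : ∀ i, (∃ v ∈ B i, v ∈ A') → g i ∈ B i ∧ (g i ∈ T ∨ g i = b) := by
      intro i hi
      by_cases hbi : b ∈ B i
      · simp [g, hbi]
      · by_cases h : ∃ v ∈ B i, v ∈ T
        · simp only [g, hbi, dif_pos h]
          exact ⟨h.choose_spec.1, .inl h.choose_spec.2⟩
        · exact absurd (hsep i (hβ i) (fun v hv hvT => h ⟨v, hv, hvT⟩) hi).2 hbi
    have hgb : ∀ i, b ∈ B i → g i = b := fun i hi => if_pos hi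
    have hcl : ∀ u v, (u ∈ T ∨ u = b) → (v ∈ T ∨ v = b) → u = v ∨ G₁.Adj u v := by
      rintro u v (hu | rfl) (hv | rfl)
      · exact (eq_or_ne u v).imp_right (hclique u hu v hv)
      · exact .inr (h2 u hu).symm
      · exact .inr (h2 v hv)
      · exact .inl rfl
    let f : ι → V → V := fun i v => if v ∈ A' then g i else v
    have fA : ∀ i, ∀ v ∈ A', f i v = g i := fun i v hv => if_pos hv
    have fn : ∀ i, ∀ v, v ∉ A' → f i v = v := fun i v hv => if_neg hv
    have fmem : ∀ i, ∀ v ∈ B i, f i v ∈ B i := by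
      intro i v hv
      by_cases hvA : v ∈ A'
      · rw [fA i v hvA]
        exact (hg i ⟨v, hv, hvA⟩).1
      · rw [fn i v hvA]
        exact hv
    have hout : ∀ i j, ∀ u ∈ B i, ∀ v ∈ B j, u ∉ A' → v ∈ A' → G.Adj u v →
        f i u = f j v ∨ G₁.Adj (f i u) (f j v) := by
      intro i j u hu v hv huA hvA huv
      rw [fn i u huA, fA j v hvA]
      by_cases huT : u ∈ T
      · exact hcl _ _ (.inl huT) (hg j ⟨v, hv, hvA⟩).2
      · obtain ⟨rfl, rfl⟩ := hcross u ((hcov i u hu).resolve_right fun h =>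
          h.elim huT huA) v hvA huv
        rw [hgb j hv]
        exact .inr h3
    have hall : ∀ i j, ∀ u ∈ B i, ∀ v ∈ B j, G.Adj u v →
        f i u = f j v ∨ G₁.Adj (f i u) (f j v) := by
      intro i j u hu v hv huv
      by_cases huA : u ∈ A' <;> by_cases hvA : v ∈ A'
      · rw [fA i u huA, fA j v hvA]
        exact hcl _ _ (hg i ⟨u, hu, huA⟩).2 (hg j ⟨v, hv, hvA⟩).2
      · exact (hout j i v hv u hu hvA huA huv.symm).imp Eq.symm fun h => h.symm
      · exact hout i j u hu v hv huA hvA huv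
      · rw [fn i u huA, fn j v hvA]
        exact .inr (h1 u v huA hvA huv)
    have hdisj : ∀ i j, i ≠ j → ∀ u ∈ B i, ∀ v ∈ B j, f i u ≠ f j v := fun i j hij u hu v hv h =>
      hij (hB.disj i j _ (fmem i u hu) (h ▸ fmem j v hv))
    exact ⟨_, hB.of_maps f hdisj (fun i => hall i i) fun i j hij _ u hu v hv huv =>
      (hall i j u hu v hv huv).resolve_left (hdisj i j hij u hu v hv)⟩

/-- Gluing two graphs without Kuratowski minors along a clique with at most two vertices and an
additional edge. -/
theorem Free.glue {G G₁ G₂ : SimpleGraph V} {A T A' : Set V} {s t a b : V}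
    (hcov : ∀ u v, G.Adj u v → u ∈ A ∨ u ∈ T ∨ u ∈ A') (hAT : ∀ v ∈ A, v ∉ T)
    (hAA : ∀ v ∈ A, v ∉ A') (hTA : ∀ v ∈ T, v ∉ A') (ha : a ∈ A) (hb : b ∈ A')
    (hT : ∀ v ∈ T, v = s ∨ v = t) (hclique : ∀ u ∈ T, ∀ v ∈ T, u ≠ v → G.Adj u v)
    (hcross : ∀ u ∈ A, ∀ v ∈ A', G.Adj u v → u = a ∧ v = b)
    (h₁ : ∀ u v, u ∉ A' → v ∉ A' → G.Adj u v → G₁.Adj u v) (h₁' : ∀ u ∈ T, G₁.Adj b u)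
    (h₁'' : G₁.Adj a b)
    (h₂ : ∀ u v, u ∉ A → v ∉ A → G.Adj u v → G₂.Adj u v) (h₂' : ∀ u ∈ T, G₂.Adj a u)
    (h₂'' : G₂.Adj a b) (hG₁ : Free G₁) (hG₂ : Free G₂) : Free G := by
  have key : ∀ {k : ℕ} {H : SimpleGraph (Fin k)} {B : Fin k → Set V}, IsObstruction H →
      IsModel H G B → (∃ B', IsModel H G₁ B') ∨ ∃ B', IsModel H G₂ B' := by
    intro k H B hH hB
    have hcov' : ∀ i, ∀ v ∈ B i, v ∈ A ∨ v ∈ T ∨ v ∈ A' := fun i v hv =>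
      let ⟨w, hw⟩ := hB.exists_adj hH hv
      hcov v w hw
    by_cases h1 : ∀ i j, B i ⊆ A' → B j ⊆ A' → i = j
    · exact .inl (hB.glue_half hH hcov' hAA hTA ha hb hT
        (fun u hu v hv huv => h₁ u v (hTA u hu) (hTA v hv) (hclique u hu v hv huv))
        hcross h₁ h₁' h₁'' h1)
    by_cases h2 : ∀ i j, B i ⊆ A → B j ⊆ A → i = j
    · exact .inr (hB.glue_half (A := A') (A' := A) (T := T) hH (fun i v hv => by
        have := hcov' i v hv; tauto) (fun v hv h => hAA v h hv)
        (fun v hv h => hAT v h hv) hb ha hT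
        (fun u hu v hv huv => h₂ u v (fun h => hAT u h hu) (fun h => hAT v h hv)
          (hclique u hu v hv huv))
        (fun u hu v hv huv => (hcross v hv u hu huv.symm).symm) h₂ h₂' h₂''.symm h2)
    push Not at h1 h2
    obtain ⟨j, j', hj, hj', hjj⟩ := h1
    obtain ⟨i, i', hi, hi', hii⟩ := h2
    have hne : ∀ i j, B i ⊆ A → B j ⊆ A' → i ≠ j := by
      rintro i _ hi hj rfl
      obtain ⟨v, hv⟩ := (hB.conn i).1
      exact hAA v (hi hv) (hj hv)
    obtain ⟨x, y, x', y', hx, hy, hx', hy', hxy, h1, h2⟩ := hH.cross i i' j j' hii (hne _ _ hi hj)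
      (hne _ _ hi hj') (hne _ _ hi' hj) (hne _ _ hi' hj') hjj
    have hmem : ∀ x y, (x = i ∨ x = i') → (y = j ∨ y = j') → H.Adj x y → a ∈ B x ∧ b ∈ B y := by
      intro x y hx hy hxy
      obtain ⟨u, hu, v, hv, huv⟩ := hB.adj x y hxy
      have hxA : B x ⊆ A := by rcases hx with rfl | rfl <;> assumption
      have hyA : B y ⊆ A' := by rcases hy with rfl | rfl <;> assumption
      obtain ⟨rfl, rfl⟩ := hcross u (hxA hu) v (hyA hv) huv
      exact ⟨hu, hv⟩
    have m1 := hmem x y hx hy h1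
    have m2 := hmem x' y' hx' hy' h2
    exact absurd (hB.disj _ _ _ m1.1 m2.1) (hxy.resolve_right
      fun h => h (hB.disj _ _ _ m1.2 m2.2))
  refine ⟨fun B hB => ?_, fun B hB => ?_⟩
  · rcases key isObstruction_five hB with ⟨B', h⟩ | ⟨B', h⟩
    exacts [hG₁.1 _ h, hG₂.1 _ h]
  · rcases key isObstruction_three_three hB with ⟨B', h⟩ | ⟨B', h⟩
    exacts [hG₁.2 _ h, hG₂.2 _ h]

end Glue

end OnePlanarity

namespace OnePlanarity

section Contract

variable {V : Type}

lemma cert_bot [Finite V] : Cert (⊥ : SimpleGraph V) := by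
  classical
  have := Fintype.ofFinite V
  have hrun : ∀ l : List V, Run (E := V) (l.map fun v => (v, [], [])) [] [] := by
    intro l
    induction l with
    | nil => exact .nil _
    | cons v l ih => exact .cons (L := []) (R := []) (d := []) (u := []) ih
  refine ⟨V, _, hrun Finset.univ.toList, ?_, ?_, ?_, ?_⟩
  · simpa [Function.comp_def] using Finset.nodup_toList _
  · simp
  · simp [List.flatMap_eq_nil_iff.2]
  · simp

/-- The graph obtained from `G` by contracting `y` into `x`, leaving `y` isolated. -/
def contract (G : SimpleGraph V) (x y : V) : SimpleGraph V where
  Adj u v := u ≠ y ∧ v ≠ y ∧ u ≠ v ∧ (G.Adj u v ∨ (u = x ∧ G.Adj y v) ∨ (v = x ∧ G.Adj y u))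
  symm := ⟨fun u v h => ⟨h.2.1, h.1, h.2.2.1.symm, by
    have := h.2.2.2
    rw [G.adj_comm u v] at this
    tauto⟩⟩
  loopless := ⟨fun _ h => h.2.2.1 rfl⟩

lemma Free.contract {G : SimpleGraph V} (hG : Free G) {x y : V} (hxy : G.Adj x y) :
    Free (contract G x y) := by
  refine hG.of_minor (fun w => {v | w ≠ y ∧ (v = w ∨ w = x ∧ v = y)}) ?_ ?_ ?_
  · intro w w' h
    by_cases hw : w = x
    · subst hw
      convert conn_pair hxy using 1
      ext v
      simp [h.1]
    · convert conn_singleton G w using 1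
      ext v
      simp [h.1, hw]
  · rintro w w' v ⟨h1, h2⟩ ⟨h3, h4⟩
    rcases h2 with rfl | ⟨rfl, rfl⟩ <;> rcases h4 with h4 | ⟨rfl, h4⟩ <;> simp_all
  · rintro u v ⟨hu, hv, -, h | ⟨rfl, h⟩ | ⟨rfl, h⟩⟩
    · exact ⟨u, ⟨hu, .inl rfl⟩, v, ⟨hv, .inl rfl⟩, h⟩
    · exact ⟨y, ⟨hu, .inr ⟨rfl, rfl⟩⟩, v, ⟨hv, .inl rfl⟩, h⟩
    · exact ⟨u, ⟨hu, .inl rfl⟩, y, ⟨hv, .inr ⟨rfl, rfl⟩⟩, h.symm⟩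

/-- If the contraction of an edge has a planarity certificate, then there is a rotation at the
contracted vertex along which it may be split. -/
lemma exists_rotation {G : SimpleGraph V} {x y : V} (hxy : G.Adj x y)
    (hJ : Cert (contract G x y)) :
    ∃ W : List V, W.Nodup ∧ (∀ w, w ∈ W ↔ w ≠ x ∧ w ≠ y ∧ (G.Adj x w ∨ G.Adj y w)) ∧
      ∀ G' : SimpleGraph V,
      (∀ a b, G'.Adj a b → a ≠ x → a ≠ y → b ≠ x → b ≠ y → G.Adj a b) →
      (∀ w, w ≠ x → w ≠ y → G'.Adj x w ∨ G'.Adj y w → G.Adj x w ∨ G.Adj y w) →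
      Splits (G'.Adj x) (G'.Adj y) W → Cert G' := by
  obtain ⟨W, hW, hm, h⟩ := hJ.exists_split hxy.ne (fun w h => h.1 rfl)
  refine ⟨W, hW, fun w => ?_, fun G' h1 h2 hs => h G' ?_ ?_ ?_ hs⟩
  · rw [hm]
    refine ⟨fun ⟨_, h1, h2, h3⟩ => ⟨h2.symm, h1, ?_⟩,
      fun ⟨h1, h2, h3⟩ => ⟨hxy.ne, h2, h1.symm, ?_⟩⟩
    · rcases h3 with h3 | ⟨-, h3⟩ | ⟨h3, -⟩
      exacts [.inl h3, .inr h3, absurd h3.symm h2]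
    · rcases h3 with h3 | h3
      exacts [.inl h3, .inr (.inl ⟨rfl, h3⟩)]
  · exact fun a b hab hax hay hbx hby => ⟨hay, hby, hab.ne, .inl (h1 a b hab hax hay hbx hby)⟩
  · intro w hwx hwy hw
    refine ⟨hxy.ne, hwy, hwx.symm, ?_⟩
    rcases h2 w hwx hwy (.inl hw) with h | h
    exacts [.inl h, .inr (.inl ⟨rfl, h⟩)]
  · intro w hwx hwy hw
    refine ⟨hxy.ne, hwy, hwx.symm, ?_⟩
    rcases h2 w hwx hwy (.inr hw) with h | h
    exacts [.inl h, .inr (.inl ⟨rfl, h⟩)]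

end Contract

section Separation

variable {V : Type}

/-- One side of a separation, together with a clique on the separator `T` and a new vertex `b`
adjacent to `T` and to `a`. -/
def sideGraph (G : SimpleGraph V) (A T : Set V) (a b : V) : SimpleGraph V :=
  SimpleGraph.fromRel fun u v => (u ∈ A ∪ T ∧ v ∈ A ∪ T ∧ G.Adj u v) ∨ (u ∈ T ∧ v ∈ T) ∨
    (u = b ∧ (v ∈ T ∨ v = a))

/-- The graphs on at most `m` vertices without Kuratowski minors have planarity certificates. -/
def SmallCert (V : Type) (m : ℕ) : Prop :=
  ∀ (U : Set V) (G : SimpleGraph V), U.ncard < m → (∀ u v, G.Adj u v → u ∈ U) → Free G → Cert G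

set_option maxHeartbeats 1000000 in
lemma free_sideGraph [Finite V] {m : ℕ} (hm : SmallCert V m) {G : SimpleGraph V} (hG : Free G)
    {A T K : Set V} (hcard : (A ∪ T).ncard < m) (hA : A.Nonempty) (hAT : ∀ v ∈ A, v ∉ T)
    (hT : T = ∅ ∨ (∃ s, T = {s}) ∨ ∃ s t, s ≠ t ∧ T = {s, t}) (hTA : ∀ t ∈ T, ∃ a ∈ A, G.Adj t a)
    (hK : Conn G K) (hKAT : ∀ v ∈ K, v ∉ A ∪ T) (hTK : ∀ t ∈ T, ∃ k ∈ K, G.Adj t k) :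
    ∃ a ∈ A, ∀ b, b ∉ A ∪ T → Free (sideGraph G A T a b) := by
  classical
  let H : SimpleGraph V := SimpleGraph.fromRel fun u v =>
    (u ∈ A ∪ T ∧ v ∈ A ∪ T ∧ G.Adj u v) ∨ (u ∈ T ∧ v ∈ T)
  have hHadj : ∀ u v, H.Adj u v ↔ u ≠ v ∧
      ((u ∈ A ∪ T ∧ v ∈ A ∪ T ∧ G.Adj u v) ∨ (u ∈ T ∧ v ∈ T)) := by
    intro u v
    simp only [H, SimpleGraph.fromRel_adj, G.adj_comm v u]
    tauto
  have hHsupp : ∀ u v, H.Adj u v → u ∈ A ∪ T ∧ v ∈ A ∪ T := by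
    intro u v h
    rcases ((hHadj u v).1 h).2 with h | h
    exacts [⟨h.1, h.2.1⟩, ⟨.inr h.1, .inr h.2⟩]
  have hH : Free H := by
    have hsub : (∀ u ∈ T, ∀ v ∈ T, u = v) → Free H := by
      intro hsub
      refine hG.mono fun u v h => ?_
      rcases (hHadj u v).1 h with ⟨hne, h | h⟩
      exacts [h.2.2, absurd (hsub u h.1 v h.2) hne]
    rcases hT with rfl | ⟨s, rfl⟩ | ⟨s, t, hst, rfl⟩
    · exact hsub (by simp)
    · exact hsub (by simp)
    obtain ⟨k, hk, hsk⟩ := hTK s (by simp)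
    obtain ⟨k', hk', htk'⟩ := hTK t (by simp)
    refine hG.of_minor (fun w => {v | w ∈ A ∪ {s, t} ∧ (v = w ∨ w = s ∧ v ∈ K)}) ?_ ?_ ?_
    · intro w w' h
      have hw := (hHsupp w w' h).1
      by_cases hws : w = s
      · subst hws
        have := (conn_singleton G w).union hK rfl hk hsk
        convert this using 1
        ext v
        simp only [Set.mem_ofPred_eq, Set.mem_union, Set.mem_singleton_iff]
        tauto
      · convert conn_singleton G w using 1
        ext v
        simp only [Set.mem_ofPred_eq, Set.mem_singleton_iff]
        tauto
    · rintro w w' v ⟨h1, h2⟩ ⟨h3, h4⟩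
      have hnK : ∀ u, u ∈ A ∪ {s, t} → u ∉ K := fun u hu hu' => hKAT u hu' hu
      rcases h2 with rfl | ⟨rfl, h2⟩ <;> rcases h4 with h4 | ⟨rfl, h4⟩
      · exact h4
      · exact absurd h4 (hnK _ h1)
      · exact absurd h2 (hnK _ (h4 ▸ h3))
      · rfl
    · intro u v h
      obtain ⟨hne, h | ⟨h1, h2⟩⟩ := (hHadj u v).1 h
      · exact ⟨u, ⟨h.1, .inl rfl⟩, v, ⟨h.2.1, .inl rfl⟩, h.2.2⟩
      · rcases h1 with rfl | rfl <;> rcases h2 with rfl | rfl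
        · exact absurd rfl hne
        · exact ⟨k', ⟨by simp, .inr ⟨rfl, hk'⟩⟩, v, ⟨by simp, .inl rfl⟩, htk'.symm⟩
        · exact ⟨u, ⟨by simp, .inl rfl⟩, k', ⟨by simp, .inr ⟨rfl, hk'⟩⟩, htk'⟩
        · exact absurd rfl hne
  have hHc : Cert H := hm _ H hcard (fun u v h => (hHsupp u v h).1) hH
  obtain ⟨b₀, hb₀⟩ := hK.1
  have hb₀' := hKAT b₀ hb₀
  have hside : ∀ a b u v, (sideGraph G A T a b).Adj u v → u ≠ b → v ≠ b → H.Adj u v := by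
    intro a b u v h hu hv
    rw [sideGraph, SimpleGraph.fromRel_adj] at h
    rw [hHadj]
    rw [G.adj_comm v u] at h
    tauto
  have hsideb : ∀ a b v, (sideGraph G A T a b).Adj b v → b ∉ A ∪ T → v ∈ T ∨ v = a := by
    intro a b v h hb
    rw [sideGraph, SimpleGraph.fromRel_adj] at h
    have : b ∉ T := fun h => hb (.inr h)
    tauto
  suffices ∃ a ∈ A, Cert (sideGraph G A T a b₀) by
    obtain ⟨a, ha, hc⟩ := this
    refine ⟨a, ha, fun b hb => hc.free.of_minor
      (fun w => {v | w = b ∧ v = b₀ ∨ w ∈ A ∪ T ∧ v = w}) ?_ ?_ ?_⟩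
    · intro w w' h
      by_cases hw : w = b
      · subst hw
        convert conn_singleton _ b₀ using 1
        ext v
        simp [show w ∉ A ∪ T from hb]
      · have hwAT : w ∈ A ∪ T := by
          by_cases hw' : w' = b
          · subst hw'
            rcases hsideb a w' w h.symm hb with h | rfl
            exacts [.inr h, .inl ha]
          · exact (hHsupp _ _ (hside a b w w' h hw hw')).1
        convert conn_singleton _ w using 1
        ext v
        simp [hw, hwAT]
    · rintro w w' v h1 h2
      simp only [Set.mem_ofPred_eq] at h1 h2
      rcases h1 with ⟨rfl, rfl⟩ | ⟨h1, rfl⟩ <;> rcases h2 with ⟨rfl, h⟩ | ⟨h2, h⟩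
      · rfl
      · exact absurd (h ▸ h2) hb₀'
      · exact absurd (h ▸ h1) hb₀'
      · exact h
    · have hb' : ∀ v, (sideGraph G A T a b).Adj b v → v ∈ A ∪ T ∧
          (sideGraph G A T a b₀).Adj b₀ v := by
        intro v hv
        have h := hsideb a b v hv hb
        have hv' : v ∈ A ∪ T := by
          rcases h with h | rfl
          exacts [.inr h, .inl ha]
        rw [sideGraph, SimpleGraph.fromRel_adj]
        exact ⟨hv', fun h => hb₀' (h ▸ hv'), .inl (.inr (.inr ⟨rfl, h⟩))⟩
      intro u v huv
      by_cases hu : u = b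
      · subst hu
        obtain ⟨h1, h2⟩ := hb' v huv
        exact ⟨b₀, .inl ⟨rfl, rfl⟩, v, .inr ⟨h1, rfl⟩, h2⟩
      · by_cases hv : v = b
        · subst hv
          obtain ⟨h1, h2⟩ := hb' u huv.symm
          exact ⟨u, .inr ⟨h1, rfl⟩, b₀, .inl ⟨rfl, rfl⟩, h2.symm⟩
        · have h := hside a b u v huv hu hv
          refine ⟨u, .inr ⟨(hHsupp u v h).1, rfl⟩, v, .inr ⟨(hHsupp u v h).2, rfl⟩, ?_⟩
          rw [sideGraph, SimpleGraph.fromRel_adj]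
          have := (hHadj u v).1 h
          tauto
  have hsplit : ∀ x ∈ A ∪ T, ∃ W : List V, W.Nodup ∧ (∀ w, w ∈ W ↔ H.Adj x w) ∧
      ∀ a, (∀ w, w ≠ x → w ∈ T ∨ w = a → H.Adj x w) →
      (∃ i j, ∃ (_ : i ≤ j) (_ : j ≤ i + 1), j ≤ W.length ∧ (W ≠ [] → j < W.length) ∧
        ∀ k (hk : k < W.length), W[k] ∈ T ∨ W[k] = a → k = i ∨ k = j) →
      Cert (sideGraph G A T a b₀) := by
    intro x hx
    have hxb : x ≠ b₀ := fun h => hb₀' (h ▸ hx)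
    obtain ⟨W, hW, hWm, h⟩ := hHc.exists_split hxb (fun w hw => hb₀' (hHsupp _ _ hw).1)
    refine ⟨W, hW, hWm, fun a ha ⟨i, j, hij, hji, hjl, hjl', hk⟩ => h _ ?_ ?_ ?_ (.inl ?_)⟩
    · exact fun u v huv _ hu _ hv => hside a b₀ u v huv hu hv
    · exact fun w _ hw hxw => hside a b₀ x w hxw hxb hw
    · exact fun w hwx hw hbw => ha w hwx (hsideb a b₀ w hbw hb₀')
    · rcases eq_or_ne W [] with rfl | hne
      · exact ⟨[], [], [], [], [], by simp⟩
      · exact isSplit_of_index hij (hjl' hne)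
          (fun k hk' hlt hq => by have := hk k hk' (hsideb a b₀ _ hq hb₀'); omega)
          (fun k hk' h1 h2 => by omega)
  rcases hT with rfl | ⟨s, rfl⟩ | ⟨s, t, hst, rfl⟩
  · obtain ⟨a, ha⟩ := hA
    obtain ⟨W, hW, hWm, h⟩ := hsplit a (.inl ha)
    refine ⟨a, ha, h a (fun w hw h => absurd (h.resolve_left (by simp)) hw) ⟨0, 0, le_rfl,
        by omega, by omega,
      fun h => List.length_pos_of_ne_nil h, fun k hk h => ?_⟩⟩
    have := (hWm W[k]).1 (by simp)
    exact absurd (h.resolve_left (by simp)).symm this.ne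
  · obtain ⟨a, ha, hsa⟩ := hTA s rfl
    obtain ⟨W, hW, hWm, h⟩ := hsplit s (.inr rfl)
    have hHa : H.Adj s a := (hHadj s a).2 ⟨hsa.ne, .inl ⟨.inr rfl, .inl ha, hsa⟩⟩
    obtain ⟨i, hi, rfl⟩ := List.getElem_of_mem ((hWm a).2 hHa)
    refine ⟨W[i], ha, h W[i] ?_ ⟨i, i, le_rfl, by omega, by omega, fun _ => hi,
      fun k hk h => ?_⟩⟩
    · rintro w hw (rfl | rfl)
      exacts [absurd rfl hw, hHa]
    · have := (hWm W[k]).1 (by simp)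
      exact .inl ((hW.getElem_inj_iff).1 (h.resolve_left this.ne'))
  · obtain ⟨a₀, ha₀, hsa₀⟩ := hTA s (by simp)
    obtain ⟨W, hW, hWm, h⟩ := hsplit s (by simp)
    have hHa : H.Adj s a₀ := (hHadj s a₀).2 ⟨hsa₀.ne, .inl ⟨by simp, .inl ha₀, hsa₀⟩⟩
    have hHt : H.Adj s t := (hHadj s t).2 ⟨hst, .inr ⟨by simp, by simp⟩⟩
    obtain ⟨i, hi, hai⟩ := List.getElem_of_mem ((hWm a₀).2 hHa)
    obtain ⟨j, hj, htj⟩ := List.getElem_of_mem ((hWm t).2 hHt)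
    have hij : i ≠ j := by
      rintro rfl
      exact hAT a₀ ha₀ (by simp [← hai, ← htj])
    have hmemA : ∀ k (hk : k < W.length), k ≠ j → W[k] ∈ A := by
      intro k hk hkj
      have := (hWm W[k]).1 (by simp)
      refine (hHsupp _ _ this).2.resolve_right fun h => ?_
      rcases h with h | h
      · exact this.ne' h
      · exact hkj (hW.getElem_inj_iff.1 (h.trans htj.symm))
    have hadj : ∀ k (hk : k < W.length), ∀ w, w ≠ s → w ∈ ({s, t} : Set V) ∨ w = W[k] →
        H.Adj s w := by
      rintro k hk w hws ((rfl | rfl) | rfl)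
      exacts [absurd rfl hws, hHt, (hWm _).1 (by simp)]
    have hidx : ∀ k (hk : k < W.length), ∀ l (hl : l < W.length),
        W[l] ∈ ({s, t} : Set V) ∨ W[l] = W[k] → l = j ∨ l = k := by
      rintro k hk l hl ((h | h) | h)
      · exact absurd h ((hWm W[l]).1 (by simp)).ne'
      · exact .inl (hW.getElem_inj_iff.1 (h.trans htj.symm))
      · exact .inr (hW.getElem_inj_iff.1 h)
    by_cases hj' : j + 1 < W.length
    · exact ⟨W[j + 1], hmemA _ hj' (by omega), h _ (hadj _ hj') ⟨j, j + 1, by omega, by omega,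
        by omega, fun _ => hj', hidx _ hj'⟩⟩
    · have hj1 : j - 1 < W.length := by omega
      refine ⟨W[j - 1], hmemA _ hj1 (by omega), h _ (hadj _ hj1) ⟨j - 1, j, by omega, by omega,
        by omega, fun _ => hj, fun l hl hl' => (hidx _ hj1 l hl hl').symm⟩⟩

end Separation

end OnePlanarity

namespace OnePlanarity

section Additions

variable {V : Type}

set_option maxHeartbeats 1000000 in
/-- Across a separator with at most two vertices an edge can be added without creating a
Kuratowski minor. -/
lemma exists_addition [Finite V] {G : SimpleGraph V} {U : Set V} (hm : SmallCert V U.ncard)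
    (hG : Free G) (hsupp : ∀ u v, G.Adj u v → u ∈ U)
    (hsep : ∃ T ⊆ U, T.ncard ≤ 2 ∧ (U \ T).Nonempty ∧ ¬ Conn G (U \ T)) :
    ∃ G', G < G' ∧ (∀ u v, G'.Adj u v → u ∈ U) ∧ Free G' := by
  obtain ⟨T, hT, hmin⟩ : ∃ T, (T ⊆ U ∧ T.ncard ≤ 2 ∧ (U \ T).Nonempty ∧ ¬ Conn G (U \ T)) ∧
      ∀ T', (T' ⊆ U ∧ T'.ncard ≤ 2 ∧ (U \ T').Nonempty ∧ ¬ Conn G (U \ T')) →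
        T.ncard ≤ T'.ncard := by
    let P : Set (Set V) := {T | T ⊆ U ∧ T.ncard ≤ 2 ∧ (U \ T).Nonempty ∧ ¬ Conn G (U \ T)}
    obtain ⟨T, hT, h⟩ := Set.exists_min_image P Set.ncard (Set.toFinite _)
      (let ⟨T, h⟩ := hsep; ⟨T, h⟩)
    exact ⟨T, hT, h⟩
  obtain ⟨hTU, hT2, hne, hnc⟩ := hT
  have hadj : ∀ C : Set V, C ⊆ U \ T → C.Nonempty → ((U \ T) \ C).Nonempty →
      (∀ u ∈ C, ∀ v ∈ U \ T, G.Adj u v → v ∈ C) → ∀ t ∈ T, ∃ c ∈ C, G.Adj t c := by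
    rintro C hC ⟨c, hc⟩ ⟨d, hd, hdC⟩ hcl t ht
    have hsub : U \ T ⊆ U \ (T \ {t}) := fun v hv => ⟨hv.1, fun h => hv.2 h.1⟩
    have hconn : Conn G (U \ (T \ {t})) := by
      by_contra h
      have h1 := hmin (T \ {t}) ⟨Set.sdiff_subset.trans hTU,
        (Set.ncard_le_ncard Set.sdiff_subset (Set.toFinite _)).trans hT2, hne.mono hsub, h⟩
      have := Set.ncard_sdiff_singleton_lt_of_mem ht (Set.toFinite _)
      omega
    obtain ⟨x, -, hx, y, hy, hyC, hxy⟩ := hconn.exists_adj (hsub (hC hc)) hc (hsub hd) hdC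
    by_cases hyt : y = t
    · exact ⟨x, hx, hyt ▸ hxy.symm⟩
    · exact absurd (hcl x hx y ⟨hy.1, fun h => hy.2 ⟨h, hyt⟩⟩ hxy) hyC
  obtain ⟨A, hAU, hA, hA', hAc, hAcl⟩ := exists_split_of_not_conn hne hnc
  have hA'cl : ∀ u ∈ (U \ T) \ A, ∀ v ∈ U \ T, G.Adj u v → v ∈ (U \ T) \ A :=
    fun u hu v hv huv => ⟨hv, fun h => hu.2 (hAcl v h u hu.1 huv.symm)⟩
  have hAT : ∀ v ∈ A, v ∉ T := fun v hv => (hAU hv).2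
  have hTA := hadj A hAU hA hA' hAcl
  have hTA' := hadj _ Set.sdiff_subset hA'
    (hA.mono fun v hv => ⟨hAU hv, fun h => h.2 hv⟩) hA'cl
  obtain ⟨w, hw⟩ := id hA'
  have hKU : comp G (U \ T) w ⊆ U \ T := comp_subset hw.1
  have hKA' : comp G (U \ T) w ⊆ (U \ T) \ A := fun v hv => ⟨hKU hv, fun h =>
    hw.2 ((conn_comp G (U \ T) w).2 A ⟨v, hv, h⟩
      (fun u _ huA v hv huv => hAcl u huA v (hKU hv) huv) w (mem_comp_self _ _ _))⟩
  have hTK := hadj (comp G (U \ T) w) hKU ⟨w, mem_comp_self _ _ _⟩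
    (hA.mono fun v hv => ⟨hAU hv, fun h => (hKA' h).2 hv⟩)
    (fun u hu v hv huv => comp_closed hu huv hv)
  have hT' : T = ∅ ∨ (∃ s, T = {s}) ∨ ∃ s t, s ≠ t ∧ T = {s, t} := by
    have : T.ncard = 0 ∨ T.ncard = 1 ∨ T.ncard = 2 := by omega
    rwa [Set.ncard_eq_zero, Set.ncard_eq_one, Set.ncard_eq_two] at this
  obtain ⟨a, ha, hfa⟩ := free_sideGraph hm hG
    (Set.ncard_lt_ncard ⟨Set.union_subset (hAU.trans Set.sdiff_subset) hTU,
      fun h => (h hw.1.1).elim hw.2 hw.1.2⟩ (Set.toFinite _))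
    hA hAT hT' hTA (conn_comp G (U \ T) w)
    (fun v hv h => h.elim (hKA' hv).2 (hKU hv).2) hTK
  obtain ⟨a₀, ha₀⟩ := hA
  obtain ⟨b, hb, hfb⟩ := free_sideGraph hm hG
    (Set.ncard_lt_ncard ⟨Set.union_subset (Set.sdiff_subset.trans Set.sdiff_subset) hTU,
      fun h => (h (hAU ha₀).1).elim (fun h => h.2 ha₀) (hAT a₀ ha₀)⟩ (Set.toFinite _))
    hA' (fun v hv => hv.1.2) hT' hTA' hAc (fun v hv h => h.elim (fun h => h.2 hv) (hAT v hv)) hTA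
  replace hfa := hfa b (fun h => h.elim hb.2 hb.1.2)
  replace hfb := hfb a (fun h => h.elim (fun h => h.2 ha) (hAT a ha))
  have hab : a ≠ b := fun h => hb.2 (h ▸ ha)
  let G' : SimpleGraph V := SimpleGraph.fromRel fun u v =>
    G.Adj u v ∨ (u ∈ T ∧ v ∈ T) ∨ (u = a ∧ v = b)
  have hG' : ∀ u v, G'.Adj u v ↔ u ≠ v ∧
      (G.Adj u v ∨ (u ∈ T ∧ v ∈ T) ∨ (u = a ∧ v = b) ∨ (u = b ∧ v = a)) := by
    intro u v
    simp only [G', SimpleGraph.fromRel_adj, G.adj_comm v u]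
    tauto
  have hle : G ≤ G' := fun u v h => (hG' u v).2 ⟨h.ne, .inl h⟩
  have hG'U : ∀ u v, G'.Adj u v → u ∈ U := by
    intro u v h
    rcases ((hG' u v).1 h).2 with h | h | h | h
    exacts [hsupp u v h, hTU h.1, h.1 ▸ (hAU ha).1, h.1 ▸ hb.1.1]
  refine ⟨G', lt_of_le_not_ge hle fun h => ?_, hG'U, ?_⟩
  · exact hb.2 (hAcl a ha b hb.1 (h ((hG' a b).2 ⟨hab, by simp⟩)))
  have hclique : ∀ u ∈ T, ∀ v ∈ T, u ≠ v → G'.Adj u v :=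
    fun u hu v hv h => (hG' u v).2 ⟨h, .inr (.inl ⟨hu, hv⟩)⟩
  have hcov : ∀ u v, G'.Adj u v → u ∈ A ∨ u ∈ T ∨ u ∈ (U \ T) \ A := by
    intro u v h
    have := hG'U u v h
    simp only [Set.mem_sdiff]
    tauto
  have hcross : ∀ u ∈ A, ∀ v ∈ (U \ T) \ A, G'.Adj u v → u = a ∧ v = b := by
    intro u hu v hv h
    rcases ((hG' u v).1 h).2 with h | h | h | h
    exacts [absurd (hAcl u hu v hv.1 h) hv.2, absurd h.1 (hAT u hu), h,
      absurd (h.2 ▸ ha) hv.2]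
  have hside : ∀ (B B' : Set V) (a b : V), (∀ u v, G'.Adj u v ↔ u ≠ v ∧
      (G.Adj u v ∨ (u ∈ T ∧ v ∈ T) ∨ (u = a ∧ v = b) ∨ (u = b ∧ v = a))) →
      (∀ u, u ∈ U → u ∉ B' → u ∈ B ∪ T) → b ∈ B' →
      ∀ u v, u ∉ B' → v ∉ B' → G'.Adj u v → (sideGraph G B T a b).Adj u v := by
    intro B B' a b hG' hBB hb u v hu hv h
    have hu' := hBB u (hG'U u v h) hu
    have hv' := hBB v (hG'U v u h.symm) hv
    obtain ⟨hne, h | h | h | h⟩ := (hG' u v).1 h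
    · exact (SimpleGraph.fromRel_adj _ _ _).2 ⟨hne, .inl (.inl ⟨hu', hv', h⟩)⟩
    · exact (SimpleGraph.fromRel_adj _ _ _).2 ⟨hne, .inl (.inr (.inl h))⟩
    · exact absurd (h.2 ▸ hb) hv
    · exact absurd (h.1 ▸ hb) hu
  have hsideb : ∀ (B : Set V) (a b : V), b ∉ T → ∀ u ∈ T, (sideGraph G B T a b).Adj b u :=
    fun B a b hb u hu => (SimpleGraph.fromRel_adj _ _ _).2
      ⟨fun h => hb (h ▸ hu), .inl (.inr (.inr ⟨rfl, .inl hu⟩))⟩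
  have hsidea : ∀ (B : Set V) (a b : V), a ≠ b → (sideGraph G B T a b).Adj a b :=
    fun B a b hab => (SimpleGraph.fromRel_adj _ _ _).2
      ⟨hab, .inr (.inr (.inr ⟨rfl, .inr rfl⟩))⟩
  obtain ⟨s, t, hst⟩ : ∃ s t, ∀ v ∈ T, v = s ∨ v = t := by
    rcases hT' with rfl | ⟨s, rfl⟩ | ⟨s, t, -, rfl⟩
    exacts [⟨a, a, by simp⟩, ⟨s, s, by simp⟩, ⟨s, t, by simp⟩]
  refine Free.glue (A := A) (A' := (U \ T) \ A) hcov hAT (fun v hv h => h.2 hv)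
    (fun v hv h => h.1.2 hv) ha hb hst hclique hcross ?_ (hsideb A a b hb.1.2) (hsidea A a b hab)
    ?_ (hsideb _ b a (hAT a ha)) (hsidea _ b a hab.symm).symm hfa hfb
  · refine hside _ _ a b hG' (fun u hu h => ?_) hb
    simp only [Set.mem_sdiff, Set.mem_union] at h ⊢
    tauto
  · refine hside _ _ b a (fun u v => ?_) (fun u hu h => ?_) ha
    · rw [hG', or_comm (a := u = a ∧ v = b)]
    · simp only [Set.mem_sdiff, Set.mem_union] at h ⊢
      tauto

end Additions

end OnePlanarity

namespace OnePlanarity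

section Contractible

variable {V : Type}

/-- A 3-connected graph has an edge whose endpoints do not belong to a separating triple. -/
lemma exists_contractible [Finite V] {G : SimpleGraph V} {U : Set V}
    (hedge : ∃ x y, G.Adj x y)
    (hconn : ∀ a b, (U \ {a, b}).Nonempty → Conn G (U \ {a, b})) :
    ∃ x y, G.Adj x y ∧ ∀ z, (U \ {x, y, z}).Nonempty → Conn G (U \ {x, y, z}) := by
  by_contra! hcon
  have key : ∀ n : ℕ, ∀ x y z, ∀ C : Set V, C.ncard = n → G.Adj x y → C ⊆ U \ {x, y, z} →
      C.Nonempty → ((U \ {x, y, z}) \ C).Nonempty →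
      (∀ u ∈ C, ∀ v ∈ U \ {x, y, z}, G.Adj u v → v ∈ C) → False := by
    intro n
    induction n using Nat.strong_induction_on with
    | _ n ih =>
    rintro x y z C rfl hxy hCU ⟨c, hc⟩ ⟨d, hd, hdC⟩ hcl
    have hsub : ∀ x y z : V, U \ {x, y, z} ⊆ U \ {x, y} := fun x y z v hv =>
      ⟨hv.1, fun h => hv.2 (by rcases h with rfl | rfl <;> simp)⟩
    obtain ⟨u, -, hu, z', hz', hz'C, huz⟩ :=
      (hconn x y ⟨c, hsub x y z (hCU hc)⟩).exists_adj (hsub x y z (hCU hc)) hc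
        (hsub x y z hd) hdC
    obtain rfl : z' = z := by
      by_contra h
      refine hz'C (hcl u hu z' ⟨hz'.1, ?_⟩ huz)
      have := hz'.2
      simp_all
    have hu' := (hCU hu).2
    simp only [Set.mem_insert_iff, Set.mem_singleton_iff, not_or] at hu'
    have hz'' := hz'.2
    simp only [Set.mem_insert_iff, Set.mem_singleton_iff, not_or] at hz''
    obtain ⟨v, hne, hnc⟩ := hcon z' u huz.symm
    obtain ⟨D, hDU, hD, hD', -, hDcl⟩ := exists_split_of_not_conn hne hnc
    obtain ⟨E, hEU, ⟨e, he⟩, ⟨f, hf, hfE⟩, hEcl, hxE, hyE⟩ : ∃ E ⊆ U \ {z', u, v}, E.Nonempty ∧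
        ((U \ {z', u, v}) \ E).Nonempty ∧
        (∀ a ∈ E, ∀ b ∈ U \ {z', u, v}, G.Adj a b → b ∈ E) ∧ x ∉ E ∧ y ∉ E := by
      by_cases h : x ∈ D ∨ y ∈ D
      · refine ⟨(U \ {z', u, v}) \ D, Set.sdiff_subset, hD',
          hD.mono fun a ha => ⟨hDU ha, fun h => h.2 ha⟩, fun a ha b hb hab => ⟨hb, fun h =>
          ha.2 (hDcl b h a ha.1 hab.symm)⟩, fun hx => ?_, fun hy => ?_⟩
        · rcases h with h | h
          exacts [hx.2 h, hx.2 (hDcl y h x hx.1 hxy.symm)]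
        · rcases h with h | h
          exacts [hy.2 (hDcl x h y hy.1 hxy), hy.2 h]
      · push Not at h
        exact ⟨D, hDU, hD, hD', hDcl, h.1, h.2⟩
    have hsub' : ∀ w, w ∈ U \ {z', u, v} → w ∈ U \ {z', v} := fun w hw => ⟨hw.1, fun h =>
      hw.2 (by rcases h with rfl | rfl <;> simp)⟩
    obtain ⟨w, -, hw, u', hu'', huE, hwu⟩ :=
      (hconn z' v ⟨e, hsub' e (hEU he)⟩).exists_adj (hsub' e (hEU he)) he (hsub' f hf) hfE
    obtain rfl : u' = u := by
      by_contra h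
      refine huE (hEcl w hw u' ⟨hu''.1, ?_⟩ hwu)
      have := hu''.2
      simp_all
    have hnot : ∀ b ∈ E, b ∉ ({x, y, z'} : Set V) := by
      rintro b hb (rfl | rfl | rfl)
      exacts [hxE hb, hyE hb, (hEU hb).2 (by simp)]
    refine ih (E ∩ C).ncard (Set.ncard_lt_ncard ⟨Set.inter_subset_right, fun h =>
      (hEU (h hu).1).2 (by simp)⟩ (Set.toFinite _)) z' u' v (E ∩ C) rfl huz.symm
      (Set.inter_subset_left.trans hEU)
      ⟨w, hw, hcl u' hu w ⟨(hEU hw).1, hnot w hw⟩ hwu.symm⟩ ⟨f, hf, fun h => hfE h.1⟩ ?_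
    intro a ha b hb hab
    have := hEcl a ha.1 b hb hab
    exact ⟨this, hcl a ha.2 b ⟨hb.1, hnot b this⟩ hab⟩
  obtain ⟨x, y, hxy⟩ := hedge
  obtain ⟨z, hne, hnc⟩ := hcon x y hxy
  obtain ⟨D, hDU, hD, hD', -, hDcl⟩ := exists_split_of_not_conn hne hnc
  exact key _ x y z D rfl hxy hDU hD hD' hDcl

/-- Two vertices with neighbours in a connected set are joined by a path through this set. -/
lemma Conn.exists_path {G : SimpleGraph V} {C : Set V} (hC : Conn G C) {u v : V} (hu : u ∈ C)
    (hv : v ∈ C) : ∃ q : List V, q.Nodup ∧ (∀ w ∈ q, w ∈ C) ∧ q.head? = some u ∧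
      q.getLast? = some v ∧ q.IsChain G.Adj := by
  obtain ⟨p, hp⟩ := (conn_iff_induce.1 hC).exists_isPath ⟨u, hu⟩ ⟨v, hv⟩
  refine ⟨p.support.map (↑), hp.support_nodup.map Subtype.val_injective, ?_, ?_, ?_, ?_⟩
  · intro w hw
    obtain ⟨w, -, rfl⟩ := List.mem_map.1 hw
    exact w.2
  · rw [List.head?_map, List.head?_eq_some_head (by simp)]
    simp
  · rw [List.getLast?_map, List.getLast?_eq_some_getLast (by simp)]
    simp
  · rw [List.isChain_map]
    exact p.isChain_adj_support.imp fun _ _ h => h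

end Contractible

section Order

variable {V : Type}

/-- In a 2-connected graph every partial bipolar order of a vertex set extends by an ear. -/
lemma exists_ear [Finite V] {G : SimpleGraph V} {R : Set V} (hR : ∀ z,
    Conn G (R \ {z})) {l : List V}
    (hl : l.Nodup) (hlR : ∀ v ∈ l, v ∈ R) {s t : V} (hs : l.head? = some s)
    (ht : l.getLast? = some t) (hst : s ≠ t)
    (hord : ∀ v ∈ l, v ≠ s → v ≠ t →
      (∃ u, G.Adj v u ∧ [u, v].Sublist l) ∧ ∃ u, G.Adj v u ∧ [v, u].Sublist l)
    {w : V} (hw : w ∈ R) (hwl : w ∉ l) :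
    ∃ l' : List V, l'.Nodup ∧ (∀ v ∈ l', v ∈ R) ∧ l'.head? = some s ∧ l'.getLast? = some t ∧
      (∀ v ∈ l', v ≠ s → v ≠ t →
        (∃ u, G.Adj v u ∧ [u, v].Sublist l') ∧ ∃ u, G.Adj v u ∧ [v, u].Sublist l') ∧
      l.length < l'.length := by
  set C := comp G (R \ {v | v ∈ l}) w with hC
  have hwC : w ∈ C := mem_comp_self _ _ _
  have hCR : C ⊆ R \ {v | v ∈ l} := comp_subset ⟨hw, hwl⟩
  have hsl : s ∈ l := List.mem_of_mem_head? hs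
  have htl : t ∈ l := List.mem_of_mem_getLast? ht
  have hatt : ∀ z ∈ l, ∃ a ∈ l, a ≠ z ∧ ∃ c ∈ C, G.Adj a c := by
    intro z hz
    obtain ⟨b, hb, hbz⟩ : ∃ b ∈ l, b ≠ z := by
      by_cases h : s = z
      exacts [⟨t, htl, fun h' => hst (h.trans h'.symm)⟩, ⟨s, hsl, h⟩]
    obtain ⟨x, -, hx, y, hy, hyC, hxy⟩ := (hR z).exists_adj (X := C) (u := w) (w := b)
      ⟨hw, fun h => hwl (h ▸ hz)⟩ hwC ⟨hlR b hb, hbz⟩ (fun h => (hCR h).2 hb)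
    refine ⟨y, ?_, hy.2, x, hx, hxy.symm⟩
    by_contra hyl
    exact hyC (comp_closed hx hxy ⟨hy.1, hyl⟩)
  obtain ⟨a, b, hab, ca, hca, haca, cb, hcb, hbcb⟩ : ∃ a b, [a, b].Sublist l ∧
      ∃ c ∈ C, G.Adj a c ∧ ∃ c' ∈ C, G.Adj b c' := by
    obtain ⟨a, ha, -, c, hc, hac⟩ := hatt s hsl
    obtain ⟨b, hb, hba, c', hc', hbc⟩ := hatt a ha
    obtain ⟨l₁, l₂, rfl⟩ := List.append_of_mem ha
    rcases List.mem_append.1 hb with hb | hb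
    · exact ⟨b, a, show ([b] ++ [a]).Sublist _ from (List.singleton_sublist.2 hb).append
        (List.singleton_sublist.2 List.mem_cons_self), c', hc', hbc, c, hc, hac⟩
    · have hb := (List.mem_cons.1 hb).resolve_left hba
      exact ⟨a, b, ((List.singleton_sublist.2 hb).cons_cons a).trans
        (List.sublist_append_right _ _), c, hc, hac, c', hc', hbc⟩
  obtain ⟨q, hq, hqC, hq1, hq2, hqch⟩ := (conn_comp G _ w).exists_path hca hcb
  obtain ⟨l₁, l₂, rfl, hb⟩ : ∃ l₁ l₂, l = l₁ ++ a :: l₂ ∧ b ∈ l₂ := by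
    obtain ⟨l₁, l₂, rfl, h1, h2⟩ := List.append_sublist_iff.1 (show ([a] ++ [b]).Sublist l from hab)
    obtain ⟨m, m', rfl⟩ := List.append_of_mem (List.singleton_sublist.1 h1)
    exact ⟨m, m' ++ l₂, by simp, by simp [List.singleton_sublist.1 h2]⟩
  have hsub : (l₁ ++ a :: l₂).Sublist (l₁ ++ a :: (q ++ l₂)) :=
    (List.Sublist.cons_cons a (List.sublist_append_right _ _)).append_left _
  have hqne : q ≠ [] := by rintro rfl; simp at hq1
  refine ⟨l₁ ++ a :: (q ++ l₂), ?_, ?_, ?_, ?_, ?_, ?_⟩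
  · have hqd : ∀ v ∈ q, v ∉ l₁ ++ a :: l₂ := fun v hv => (hCR (hqC v hv)).2
    have hperm : (l₁ ++ a :: (q ++ l₂)).Perm (q ++ (l₁ ++ a :: l₂)) := by
      classical
      rw [List.perm_iff_count]
      intro v
      simp only [List.count_append, List.count_cons]
      omega
    rw [hperm.nodup_iff, List.nodup_append]
    exact ⟨hq, hl, fun v hv v' hv' h => hqd v hv (h ▸ hv')⟩
  · intro v hv
    simp only [List.mem_append, List.mem_cons] at hv
    rcases hv with hv | hv | hv | hv
    · exact hlR v (by simp [hv])
    · exact hlR v (by simp [hv])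
    · exact (hCR (hqC v hv)).1
    · exact hlR v (by simp [hv])
  · cases l₁ <;> simpa using hs
  · have hl₂ : l₂ ≠ [] := List.ne_nil_of_mem hb
    rw [List.getLast?_append_of_ne_nil _ (List.cons_ne_nil _ _),
        List.getLast?_cons_of_ne_nil (List.append_ne_nil_of_right_ne_nil _ hl₂),
      List.getLast?_append_of_ne_nil _ hl₂]
    rwa [List.getLast?_append_of_ne_nil _ (List.cons_ne_nil _ _),
        List.getLast?_cons_of_ne_nil hl₂] at ht
  · intro v hv hvs hvt
    by_cases hvl : v ∈ l₁ ++ a :: l₂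
    · obtain ⟨⟨u, hu, hu'⟩, u', hu'', hu'''⟩ := hord v hvl hvs hvt
      exact ⟨⟨u, hu, hu'.trans hsub⟩, u', hu'', hu'''.trans hsub⟩
    have hvq : v ∈ q := by
      simp only [List.mem_append, List.mem_cons] at hv hvl
      tauto
    obtain ⟨q₁, q₂, rfl⟩ := List.append_of_mem hvq
    have hqsub : (a :: (q₁ ++ v :: q₂) ++ l₂).Sublist (l₁ ++ a :: (q₁ ++ v :: q₂ ++ l₂)) :=
      List.sublist_append_right _ _
    constructor
    · rcases List.eq_nil_or_concat q₁ with rfl | ⟨q₁, u, rfl⟩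
      · obtain rfl : v = ca := by simpa using hq1
        refine ⟨a, haca.symm, List.Sublist.trans ?_ hqsub⟩
        simp
      · refine ⟨u, ?_, List.Sublist.trans ?_ hqsub⟩
        · exact ((List.isChain_append.1 hqch).2.2 u (by simp) v (by simp)).symm
        · refine List.Sublist.trans (l₂ := [u, v] ++ (q₂ ++ l₂)) (by simp) ?_
          simp only [List.concat_eq_append, List.append_assoc, List.cons_append, List.nil_append]
          exact .cons _ (List.sublist_append_right _ _)
    · rcases q₂ with _ | ⟨u, q₂⟩
      · obtain rfl : v = cb := by simpa using hq2
        refine ⟨b, hbcb.symm, List.Sublist.trans ?_ hqsub⟩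
        have : [v, b].Sublist (v :: l₂) := (List.singleton_sublist.2 hb).cons_cons v
        exact this.trans (by simp)
      · refine ⟨u, ?_, List.Sublist.trans ?_ hqsub⟩
        · simp [List.isChain_append] at hqch
          exact hqch.2.1.1
        · refine List.Sublist.trans (l₂ := [v, u] ++ (q₂ ++ l₂)) (by simp) ?_
          simp only [List.append_assoc, List.cons_append, List.nil_append]
          exact .cons _ (List.sublist_append_right _ _)
  · have := List.length_pos_of_ne_nil hqne
    simp
    omega

/-- Every 2-connected graph has a bipolar order with prescribed ends. -/
lemma exists_order [Finite V] {G : SimpleGraph V} {R : Set V} (hRc : Conn G R)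
    (hR : ∀ z, Conn G (R \ {z})) {s t : V} (hs : s ∈ R) (ht : t ∈ R) (hst : s ≠ t) :
    ∃ r : V → ℕ, Set.InjOn r R ∧ (∀ v ∈ R, r s ≤ r v) ∧ (∀ v ∈ R, r v ≤ r t) ∧
      (∀ v ∈ R, v ≠ s → ∃ u ∈ R, G.Adj v u ∧ r u < r v) ∧
      ∀ v ∈ R, v ≠ t → ∃ u ∈ R, G.Adj v u ∧ r v < r u := by
  classical
  let P : Set (List V) := {l | l.Nodup ∧ (∀ v ∈ l, v ∈ R) ∧ l.head? = some s ∧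
    l.getLast? = some t ∧ ∀ v ∈ l, v ≠ s → v ≠ t →
      (∃ u, G.Adj v u ∧ [u, v].Sublist l) ∧ ∃ u, G.Adj v u ∧ [v, u].Sublist l}
  have := Fintype.ofFinite V
  have hP : P.Finite := (List.finite_length_le V (Fintype.card V)).subset
    fun l hl => hl.1.length_le_card
  obtain ⟨l, ⟨hl, hlR, hls, hlt, hord⟩, hmax⟩ := Set.exists_max_image P List.length hP
    ⟨[s, t], by simp [hst], by simp [hs, ht], rfl, rfl, by simp⟩
  have hRl : ∀ w ∈ R, w ∈ l := by
    intro w hw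
    by_contra hwl
    obtain ⟨l', h1, h2, h3, h4, h5, h6⟩ := exists_ear hR hl hlR hls hlt hst hord hw hwl
    have := hmax l' ⟨h1, h2, h3, h4, h5⟩
    omega
  have hlt' : ∀ u v, [u, v].Sublist l → l.idxOf u < l.idxOf v := by
    have : l.Pairwise fun u v => l.idxOf u < l.idxOf v := by
      rw [List.pairwise_iff_getElem]
      intro i j hi hj hij
      rwa [hl.idxOf_getElem, hl.idxOf_getElem]
    exact fun u v h => List.pairwise_iff_forall_sublist.1 this h
  have hinj : Set.InjOn (fun v => l.idxOf v) R := fun u hu v _ h =>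
    List.idxOf_inj (hRl u hu) |>.1 h
  have hmin : ∀ v ∈ R, l.idxOf s ≤ l.idxOf v := by
    intro v _
    have : l.idxOf s = 0 := by
      cases l with
      | nil => simp at hls
      | cons a l => simp at hls; simp [hls]
    omega
  have hmax' : ∀ v ∈ R, l.idxOf v ≤ l.idxOf t := by
    intro v hv
    have : l.idxOf t = l.length - 1 := by
      have hne : l ≠ [] := List.ne_nil_of_mem (hRl t ht)
      have h1 := List.length_pos_of_ne_nil hne
      have : t = l[l.length - 1] := by
        rw [List.getLast?_eq_some_getLast hne, Option.some.injEq] at hlt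
        rw [← hlt, List.getLast_eq_getElem]
      conv_lhs => rw [this]
      exact hl.idxOf_getElem _ _
    have := List.idxOf_lt_length_of_mem (hRl v hv)
    omega
  have hnbr : ∀ v ∈ R, ∃ u ∈ R, G.Adj v u := by
    intro v hv
    obtain ⟨w, hw, hwv⟩ : ∃ w ∈ R, w ≠ v := by
      by_cases h : s = v
      exacts [⟨t, ht, fun h' => hst (h.trans h'.symm)⟩, ⟨s, hs, h⟩]
    obtain ⟨x, -, rfl, y, hy, -, hxy⟩ := hRc.exists_adj (X := {v}) hv rfl hw hwv
    exact ⟨y, hy, hxy⟩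
  refine ⟨fun v => l.idxOf v, hinj, hmin, hmax', fun v hv hvs => ?_, fun v hv hvt => ?_⟩
  · by_cases hvt : v = t
    · subst hvt
      obtain ⟨u, hu, huv⟩ := hnbr v hv
      exact ⟨u, hu, huv, lt_of_le_of_ne (hmax' u hu) fun h => huv.ne' (hinj hu hv h)⟩
    · obtain ⟨u, hu, huv⟩ := (hord v (hRl v hv) hvs hvt).1
      exact ⟨u, hlR u (huv.subset (by simp)), hu, hlt' u v huv⟩
  · by_cases hvs : v = s
    · subst hvs
      obtain ⟨u, hu, huv⟩ := hnbr v hv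
      exact ⟨u, hu, huv, lt_of_le_of_ne (hmin u hu) fun h => huv.ne (hinj hv hu h)⟩
    · obtain ⟨u, hu, huv⟩ := (hord v (hRl v hv) hvs hvt).2
      exact ⟨u, hlR u (huv.subset (by simp)), hu, hlt' v u huv⟩

lemma conn_of_descent {G : SimpleGraph V} {A : Set V} {s : V} (hs : s ∈ A) (f : V → ℕ)
    (h : ∀ v ∈ A, v ≠ s → ∃ u ∈ A, G.Adj v u ∧ f u < f v) : Conn G A := by
  refine ⟨⟨s, hs⟩, ?_⟩
  rintro X ⟨w, hw, hwX⟩ hX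
  have key : ∀ n, ∀ v ∈ A, f v = n → (v ∈ X ↔ s ∈ X) := by
    intro n
    induction n using Nat.strong_induction_on with
    | _ n ih =>
    rintro v hv rfl
    by_cases hvs : v = s
    · rw [hvs]
    obtain ⟨u, hu, hvu, hlt⟩ := h v hv hvs
    rw [← ih _ hlt u hu rfl]
    exact ⟨fun h => hX v hv h u hu hvu, fun h => hX u hu h v hv hvu.symm⟩
  exact fun v hv => (key _ v hv rfl).2 ((key _ w hw rfl).1 hwX)

lemma conn_of_ascent [Finite V] {G : SimpleGraph V} {A : Set V} {t : V} (ht : t ∈ A) (f : V → ℕ)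
    (h : ∀ v ∈ A, v ≠ t → ∃ u ∈ A, G.Adj v u ∧ f v < f u) : Conn G A := by
  obtain ⟨N, hN⟩ := (Set.finite_range f).bddAbove
  refine conn_of_descent ht (fun v => N - f v) fun v hv hvt => ?_
  obtain ⟨u, hu, hvu, hlt⟩ := h v hv hvt
  have := hN ⟨u, rfl⟩
  exact ⟨u, hu, hvu, by omega⟩

end Order

end OnePlanarity

namespace OnePlanarity

section Rooted

variable {V : Type}

lemma IsModel.of_lt {n : ℕ} {H : SimpleGraph (Fin n)} {G : SimpleGraph V} {B : Fin n → Set V}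
    (disj : ∀ i j, i < j → ∀ v, v ∈ B i → v ∉ B j) (conn : ∀ i, Conn G (B i))
    (adj : ∀ i j, i < j → H.Adj i j → ∃ u ∈ B i, ∃ v ∈ B j, G.Adj u v) : IsModel H G B where
  disj i j v hi hj := by
    rcases lt_trichotomy i j with h | h | h
    exacts [absurd hj (disj i j h v hi), h, absurd hi (disj j i h v hj)]
  conn := conn
  adj i j h := by
    rcases lt_or_gt_of_ne h.ne with h' | h'
    · exact adj i j h' h
    · obtain ⟨u, hu, v, hv, huv⟩ := adj j i h' h.symm
      exact ⟨v, hv, u, hu, huv.symm⟩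

/-- Two adjacent vertices with three common neighbours in a 2-connected graph avoiding them yield
a `K₅` minor. -/
lemma not_free_of_three [Finite V] {G : SimpleGraph V} {R : Set V} (hRc : Conn G R)
    (hR : ∀ z, Conn G (R \ {z})) {x y a b c : V} (hxy : G.Adj x y) (hx : x ∉ R) (hy : y ∉ R)
    (ha : a ∈ R) (hb : b ∈ R) (hc : c ∈ R) (hab : a ≠ b) (hac : a ≠ c) (hbc : b ≠ c)
    (hxa : G.Adj x a) (hxb : G.Adj x b) (hxc : G.Adj x c)
    (hya : G.Adj y a) (hyb : G.Adj y b) (hyc : G.Adj y c) : ¬ Free G := by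
  obtain ⟨r, hinj, hmin, hmax, hlow, hup⟩ := exists_order hRc hR ha hc hac
  have hrab : r a < r b := lt_of_le_of_ne (hmin b hb) fun h => hab (hinj ha hb h)
  have hrbc : r b < r c := lt_of_le_of_ne (hmax b hb) fun h => hbc (hinj hb hc h)
  have hL : Conn G {v | v ∈ R ∧ r v < r b} := by
    refine conn_of_descent (s := a) ⟨ha, hrab⟩ r fun v hv hva => ?_
    obtain ⟨u, hu, hvu, hlt⟩ := hlow v hv.1 hva
    exact ⟨u, ⟨hu, hlt.trans hv.2⟩, hvu, hlt⟩
  have hH : Conn G {v | v ∈ R ∧ r b < r v} := by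
    refine conn_of_ascent (t := c) ⟨hc, hrbc⟩ r fun v hv hvc => ?_
    obtain ⟨u, hu, hvu, hlt⟩ := hup v hv.1 hvc
    exact ⟨u, ⟨hu, hv.2.trans hlt⟩, hvu, hlt⟩
  obtain ⟨l, hl, hbl, hlb⟩ := hlow b hb hab.symm
  obtain ⟨h, hh, hbh, hhb⟩ := hup b hb hbc
  obtain ⟨p, -, hp, q, hq, hqL, hpq⟩ := (hR b).exists_adj (X := {v | v ∈ R ∧ r v < r b})
    (u := a) (w := c) ⟨ha, hab⟩ ⟨ha, hrab⟩ ⟨hc, hbc.symm⟩ (fun h => lt_asymm h.2 hrbc)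
  have hq' : r b < r q := by
    refine lt_of_le_of_ne (not_lt.1 fun h => hqL ⟨hq.1, h⟩) fun h => hq.2 (hinj hb hq.1 h).symm
  refine fun hG => hG.1 ![{x}, {y}, {v | v ∈ R ∧ r v < r b}, {b}, {v | v ∈ R ∧ r b < r v}]
    (.of_lt ?_ ?_ ?_)
  · intro i j hij v hi hj
    fin_cases i <;> fin_cases j <;> first
      | exact absurd hij (by decide)
      | exact hxy.ne (hi.symm.trans hj)
      | exact hx (hi ▸ hj.1)
      | exact hy (hi ▸ hj.1)
      | exact hx ((hi.symm.trans hj : x = b) ▸ hb)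
      | exact hy ((hi.symm.trans hj : y = b) ▸ hb)
      | exact absurd hi.2 (by rw [show v = b from hj]; exact lt_irrefl _)
      | exact absurd hj.2 (by rw [show v = b from hi]; exact lt_irrefl _)
      | exact lt_asymm hi.2 hj.2
  · intro i
    fin_cases i
    exacts [conn_singleton G x, conn_singleton G y, hL, conn_singleton G b, hH]
  · intro i j hij _
    fin_cases i <;> fin_cases j <;> first
      | exact absurd hij (by decide)
      | exact ⟨x, rfl, y, rfl, hxy⟩
      | exact ⟨x, rfl, a, ⟨ha, hrab⟩, hxa⟩
      | exact ⟨x, rfl, b, rfl, hxb⟩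
      | exact ⟨x, rfl, c, ⟨hc, hrbc⟩, hxc⟩
      | exact ⟨y, rfl, a, ⟨ha, hrab⟩, hya⟩
      | exact ⟨y, rfl, b, rfl, hyb⟩
      | exact ⟨y, rfl, c, ⟨hc, hrbc⟩, hyc⟩
      | exact ⟨l, ⟨hl, hlb⟩, b, rfl, hbl.symm⟩
      | exact ⟨p, hp, q, ⟨hq.1, hq'⟩, hpq⟩
      | exact ⟨b, rfl, h, ⟨hh, hhb⟩, hbh⟩

/-- A cyclic arrangement of connected sets containing the given vertices. -/
def Quad (G : SimpleGraph V) (R : Set V) (a b c d : V) : Prop :=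
  ∃ F : Fin 4 → Set V, (∀ i, F i ⊆ R) ∧ (∀ i, Conn G (F i)) ∧
    (∀ i j v, v ∈ F i → v ∈ F j → i = j) ∧ (∀ i, ∃ u ∈ F i, ∃ v ∈ F (i + 1), G.Adj u v) ∧
    a ∈ F 0 ∧ b ∈ F 1 ∧ c ∈ F 2 ∧ d ∈ F 3

lemma Quad.rotate {G : SimpleGraph V} {R : Set V} {a b c d : V} (h : Quad G R a b c d) :
    Quad G R b c d a := by
  obtain ⟨F, hR, hc, hd, ha, h0, h1, h2, h3⟩ := h
  refine ⟨fun i => F (i + 1), fun i => hR _, fun i => hc _, fun i j v hi hj =>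
    add_right_cancel (hd _ _ v hi hj), fun i => ha _, h1, h2, h3, h0⟩

lemma Quad.reflect {G : SimpleGraph V} {R : Set V} {a b c d : V} (h : Quad G R a b c d) :
    Quad G R a d c b := by
  obtain ⟨F, hR, hc, hd, ha, h0, h1, h2, h3⟩ := h
  refine ⟨fun i => F (-i), fun i => hR _, fun i => hc _, fun i j v hi hj =>
    neg_injective (hd _ _ v hi hj), fun i => ?_, h0, h3, h2, h1⟩
  obtain ⟨u, hu, v, hv, huv⟩ := ha (-(i + 1))
  refine ⟨v, ?_, u, hu, huv.symm⟩
  convert hv using 2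
  abel

lemma not_free_of_quad {G : SimpleGraph V} {R : Set V} {a b c d x y : V} (h : Quad G R a b c d)
    (hxy : G.Adj x y) (hx : x ∉ R) (hy : y ∉ R) (hxa : G.Adj x a) (hxc : G.Adj x c)
    (hyb : G.Adj y b) (hyd : G.Adj y d) : ¬ Free G := by
  obtain ⟨F, hR, hc, hd, ha, h0, h1, h2, h3⟩ := h
  have hF : ∀ i, ∃ u ∈ F (i + 1), ∃ v ∈ F i, G.Adj u v := fun i =>
    let ⟨u, hu, v, hv, huv⟩ := ha i
    ⟨v, hv, u, hu, huv.symm⟩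
  have hFd : ∀ i j v, i ≠ j → v ∈ F i → v ∉ F j := fun i j v h hi hj => h (hd i j v hi hj)
  refine fun hG => hG.2 ![{x}, F 1, F 3, {y}, F 0, F 2] (.of_lt ?_ ?_ ?_)
  · intro i j hij v hi hj
    fin_cases i <;> fin_cases j <;> first
      | exact absurd hij (by decide)
      | exact hxy.ne (hi.symm.trans hj)
      | exact hFd _ _ v (by decide) hi hj
      | exact hx (hi ▸ hR _ hj)
      | exact hy (hi ▸ hR _ hj)
      | exact hy (hj ▸ hR _ hi)
  · intro i
    fin_cases i
    exacts [conn_singleton G x, hc _, hc _, conn_singleton G y, hc _, hc _]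
  · intro i j hij hadj
    fin_cases i <;> fin_cases j <;> first
      | exact absurd hij (by decide)
      | exact absurd hadj (by decide)
      | exact ⟨x, rfl, y, rfl, hxy⟩
      | exact ⟨x, rfl, a, h0, hxa⟩
      | exact ⟨x, rfl, c, h2, hxc⟩
      | exact ⟨b, h1, y, rfl, hyb.symm⟩
      | exact ⟨d, h3, y, rfl, hyd.symm⟩
      | exact ha _
      | exact hF 0
      | exact hF 2

set_option maxHeartbeats 1000000 in
lemma quad_of_order [Finite V] {G : SimpleGraph V} {R : Set V} (hRc : Conn G R)
    (hR : ∀ z, Conn G (R \ {z})) {r : V → ℕ} (hinj : Set.InjOn r R) {s t : V}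
    (hs : s ∈ R) (ht : t ∈ R) (hmin : ∀ v ∈ R, r s ≤ r v) (hmax : ∀ v ∈ R, r v ≤ r t)
    (hlow : ∀ v ∈ R, v ≠ s → ∃ u ∈ R, G.Adj v u ∧ r u < r v)
    (hup : ∀ v ∈ R, v ≠ t → ∃ u ∈ R, G.Adj v u ∧ r v < r u) {a b c d : V}
    (ha : a ∈ R) (hb : b ∈ R) (hc : c ∈ R) (hd : d ∈ R) (hab : a ≠ b) (hac : r a < r c)
    (hbc : r b < r c) (hcd : r c < r d) : Quad G R a c d b ∨ Quad G R b c d a := by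
  classical
  set L : Set V := {v | v ∈ R ∧ r v < r c} with hL
  set H : Set V := {v | v ∈ R ∧ r c < r v} with hH
  have hLc : Conn G L := by
    refine conn_of_descent (s := s) ⟨hs, (hmin a ha).trans_lt hac⟩ r fun v hv hva => ?_
    obtain ⟨u, hu, hvu, hlt⟩ := hlow v hv.1 hva
    exact ⟨u, ⟨hu, hlt.trans hv.2⟩, hvu, hlt⟩
  have hLcc : Conn G {v | v ∈ R ∧ r v ≤ r c} := by
    refine conn_of_descent (s := s) ⟨hs, (hmin c hc)⟩ r fun v hv hva => ?_
    obtain ⟨u, hu, hvu, hlt⟩ := hlow v hv.1 hva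
    exact ⟨u, ⟨hu, hlt.le.trans hv.2⟩, hvu, hlt⟩
  have hHc : Conn G H := by
    refine conn_of_ascent (t := t) ⟨ht, hcd.trans_le (hmax d hd)⟩ r fun v hv hvc => ?_
    obtain ⟨u, hu, hvu, hlt⟩ := hup v hv.1 hvc
    exact ⟨u, ⟨hu, hv.2.trans hlt⟩, hvu, hlt⟩
  let f : V → V := fun v => if r c < r v then d else v
  have hfd : ∀ v, r c < r v → f v = d := fun v h => if_pos h
  have hfn : ∀ v, r v ≤ r c → f v = v := fun v h => if_neg h.not_gt
  let J : SimpleGraph V :=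
    { Adj := fun u v => u ≠ v ∧ ∃ u' ∈ R, ∃ v' ∈ R, f u' = u ∧ f v' = v ∧ G.Adj u' v'
      symm := ⟨fun u v ⟨h, u', hu', v', hv', h1, h2, h3⟩ =>
        ⟨h.symm, v', hv', u', hu', h2, h1, h3.symm⟩⟩
      loopless := ⟨fun _ h => h.1 rfl⟩ }
  have hmap : ∀ u ∈ R, ∀ v ∈ R, G.Adj u v → f u = f v ∨ J.Adj (f u) (f v) :=
    fun u hu v hv h => or_iff_not_imp_left.2 fun hne => ⟨hne, u, hu, v, hv, rfl, rfl, h⟩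
  set R' : Set V := f '' R with hR'
  have hR'm : ∀ v ∈ R', v = d ∨ v = c ∨ v ∈ L := by
    rintro _ ⟨v, hv, rfl⟩
    rcases lt_trichotomy (r v) (r c) with h | h | h
    · rw [hfn v h.le]; exact .inr (.inr ⟨hv, h⟩)
    · rw [hfn v h.le]; exact .inr (.inl (hinj hv hc h))
    · exact .inl (hfd v h)
  have hLR' : ∀ v ∈ L, v ∈ R' := fun v hv => ⟨v, hv.1, hfn v hv.2.le⟩
  have hcR' : c ∈ R' := ⟨c, hc, hfn c le_rfl⟩
  have hdR' : d ∈ R' := ⟨d, hd, hfd d hcd⟩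
  have hcd' : c ≠ d := fun h => by simp [h] at hcd
  have hR'c : Conn J R' := hRc.image f hmap
  have hR'z : ∀ z, Conn J (R' \ {z}) := by
    intro z
    by_cases hz : z ∈ R'
    · rcases eq_or_ne z d with rfl | hzd
      · convert hLcc.image f fun u hu v hv h => hmap u hu.1 v hv.1 h using 1
        ext v
        constructor
        · rintro ⟨⟨w, hw, rfl⟩, hne⟩
          exact ⟨w, ⟨hw, not_lt.1 fun h => hne (hfd w h)⟩, rfl⟩
        · rintro ⟨w, ⟨hw, hwc⟩, rfl⟩
          refine ⟨⟨w, hw, rfl⟩, fun h => ?_⟩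
          rw [hfn w hwc] at h
          rw [show w = z from h] at hwc
          omega
      · have hzc : r z ≤ r c := by
          rcases hR'm z hz with h | h | h
          exacts [absurd h hzd, h ▸ le_rfl, h.2.le]
        convert (hR z).image f fun u hu v hv h => hmap u hu.1 v hv.1 h using 1
        ext v
        constructor
        · rintro ⟨⟨w, hw, rfl⟩, hne⟩
          refine ⟨w, ⟨hw, ?_⟩, rfl⟩
          rintro rfl
          exact hne (hfn w hzc)
        · rintro ⟨w, ⟨hw, hwz⟩, rfl⟩
          refine ⟨⟨w, hw, rfl⟩, fun h => ?_⟩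
          by_cases hwc : r c < r w
          · exact hzd ((hfd w hwc).symm.trans h).symm
          · rw [hfn w (not_lt.1 hwc)] at h
            exact hwz h
    · rwa [Set.sdiff_singleton_eq_self hz]
  have hJL : ∀ u v, u ∈ L → J.Adj u v → v ≠ d → G.Adj u v := by
    rintro u v hu ⟨-, u', hu', v', hv', h1, h2, h3⟩ hvd
    have hud : u ≠ d := by rintro rfl; exact lt_asymm hcd hu.2
    have h1' : r u' ≤ r c := not_lt.1 fun h => hud (h1.symm.trans (hfd u' h))
    have h2' : r v' ≤ r c := not_lt.1 fun h => hvd (h2.symm.trans (hfd v' h))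
    rwa [← h1, ← h2, hfn _ h1', hfn _ h2']
  have hJd : ∀ u, u ∈ L → J.Adj u d → ∃ h ∈ H, G.Adj u h := by
    rintro u hu ⟨-, u', hu', v', hv', h1, h2, h3⟩
    have hud : u ≠ d := by rintro rfl; exact lt_asymm hcd hu.2
    have h1' : r u' ≤ r c := not_lt.1 fun h => hud (h1.symm.trans (hfd u' h))
    have h2' : r c < r v' := by
      by_contra h
      rw [hfn _ (not_lt.1 h)] at h2
      exact h (h2 ▸ hcd)
    exact ⟨v', ⟨hv', h2'⟩, by rwa [← h1, hfn _ h1']⟩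
  obtain ⟨r', hinj', hmin', hmax', hlow', hup'⟩ := exists_order hR'c hR'z hcR' hdR' hcd'
  have key : ∀ a b, a ∈ L → b ∈ L → r' a < r' b → Quad G R a c d b := by
    intro a b ha hb hlt
    have had : a ≠ d := by rintro rfl; exact lt_asymm hcd ha.2
    have hac : a ≠ c := by rintro rfl; exact lt_irrefl _ ha.2
    have hbd : b ≠ d := by rintro rfl; exact lt_asymm hcd hb.2
    have hbc : b ≠ c := by rintro rfl; exact lt_irrefl _ hb.2
    have hne : ∀ u ∈ R', ∀ v ∈ R', u ≠ v → r' u ≠ r' v := fun u hu v hv h h' => h (hinj' hu hv h')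
    have h1 : Conn J {v | v ∈ R' ∧ r' v ≤ r' a} := by
      refine conn_of_descent (s := c) ⟨hcR', hmin' a (hLR' a ha)⟩ r' fun v hv hvc => ?_
      obtain ⟨u, hu, hvu, hlt⟩ := hlow' v hv.1 hvc
      exact ⟨u, ⟨hu, hlt.le.trans hv.2⟩, hvu, hlt⟩
    have h2 : Conn J {v | v ∈ R' ∧ r' b ≤ r' v} := by
      refine conn_of_ascent (t := d) ⟨hdR', hmax' b (hLR' b hb)⟩ r' fun v hv hvc => ?_
      obtain ⟨u, hu, hvu, hlt⟩ := hup' v hv.1 hvc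
      exact ⟨u, ⟨hu, hv.2.trans hlt.le⟩, hvu, hlt⟩
    have hP₁ : comp G (L ∩ {v | r' v ≤ r' a}) a ⊆ L ∩ {v | r' v ≤ r' a} :=
      comp_subset ⟨ha, le_refl (r' a)⟩
    have hQ : comp G (L ∩ {v | r' b ≤ r' v}) b ⊆ L ∩ {v | r' b ≤ r' v} :=
      comp_subset ⟨hb, le_refl (r' b)⟩
    obtain ⟨p, hp, hpc⟩ : ∃ p ∈ comp G (L ∩ {v | r' v ≤ r' a}) a, G.Adj p c := by
      obtain ⟨x, -, hx, y, hy, hyP, hxy⟩ := h1.exists_adj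
        (X := comp G (L ∩ {v | r' v ≤ r' a}) a) (u := a) (w := c) ⟨hLR' a ha, le_rfl⟩
        (mem_comp_self _ _ _) ⟨hcR', hmin' a (hLR' a ha)⟩ (fun h => lt_irrefl _ (hP₁ h).1.2)
      have hyd : y ≠ d := by
        rintro rfl
        exact hne _ hdR' a (hLR' a ha) had.symm
          (le_antisymm hy.2 (hmax' a (hLR' a ha)))
      have hxy' := hJL x y (hP₁ hx).1 hxy hyd
      rcases hR'm y hy.1 with h | rfl | h
      · exact absurd h hyd
      · exact ⟨x, hx, hxy'⟩
      · exact absurd (comp_closed hx hxy' ⟨h, hy.2⟩) hyP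
    obtain ⟨q, hq, h, hh, hqh⟩ : ∃ q ∈ comp G (L ∩ {v | r' b ≤ r' v}) b, ∃ h ∈ H, G.Adj q h := by
      obtain ⟨x, -, hx, y, hy, hyP, hxy⟩ := h2.exists_adj
        (X := comp G (L ∩ {v | r' b ≤ r' v}) b) (u := b) (w := d) ⟨hLR' b hb, le_rfl⟩
        (mem_comp_self _ _ _) ⟨hdR', hmax' b (hLR' b hb)⟩ (fun h => lt_asymm hcd (hQ h).1.2)
      have hyc : y ≠ c := by
        rintro rfl
        exact hne _ hcR' b (hLR' b hb) hbc.symm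
          (le_antisymm (hmin' b (hLR' b hb)) hy.2)
      rcases hR'm y hy.1 with rfl | h | h
      · obtain ⟨h, hh, hxh⟩ := hJd x (hQ hx).1 hxy
        exact ⟨x, hx, h, hh, hxh⟩
      · exact absurd h hyc
      · refine absurd (comp_closed hx (hJL x y (hQ hx).1 hxy ?_) ⟨h, hy.2⟩) hyP
        rintro rfl
        exact lt_asymm hcd h.2
    set Q := comp G (L ∩ {v | r' b ≤ r' v}) b with hQdef
    have hbQ : b ∈ Q := mem_comp_self _ _ _
    have haQ : a ∈ L \ Q := ⟨ha, fun h => absurd (hQ h).2 (not_le.2 hlt)⟩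
    have hPL : comp G (L \ Q) a ⊆ L \ Q := comp_subset haQ
    have hP₁P : comp G (L ∩ {v | r' v ≤ r' a}) a ⊆ comp G (L \ Q) a :=
      (conn_comp _ _ _).subset_comp (fun v hv => ⟨(hP₁ hv).1, fun h =>
        absurd (hlt.trans_le (hQ h).2) (not_lt.2 (hP₁ hv).2)⟩) (mem_comp_self _ _ _)
    obtain ⟨x, -, hx, y, hy, hyP, hxy⟩ := hLc.exists_adj (X := comp G (L \ Q) a) (u := a) (w := b)
      ha (mem_comp_self _ _ _) hb (fun h => (hPL h).2 hbQ)
    have hyQ : y ∈ Q := by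
      by_contra h
      exact hyP (comp_closed hx hxy ⟨hy, h⟩)
    obtain ⟨h', hh', hch', hlt'⟩ := hup c hc
      (by rintro rfl; exact absurd hcd (not_lt.2 (hmax d hd)))
    have hdisj : ∀ i j : Fin 4, i < j → ∀ v, v ∈ (![comp G (L \ Q) a, {c}, H, Q] : Fin 4 →
        Set V) i →
        v ∉ (![comp G (L \ Q) a, {c}, H, Q] : Fin 4 → Set V) j := by
      intro i j hij v hi hj
      fin_cases i <;> fin_cases j <;> first
        | exact absurd hij (by decide)
        | exact absurd (hPL hi).1.2 (by rw [show v = c from hj]; exact lt_irrefl _)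
        | exact lt_asymm (hPL hi).1.2 hj.2
        | exact (hPL hi).2 hj
        | exact absurd hj.2 (by rw [show v = c from hi]; exact lt_irrefl _)
        | exact absurd (hQ hj).1.2 (by rw [show v = c from hi]; exact lt_irrefl _)
        | exact lt_asymm hi.2 (hQ hj).1.2
    refine ⟨![comp G (L \ Q) a, {c}, H, Q], ?_, ?_, ?_, ?_, mem_comp_self _ _ _, rfl, ⟨hd, hcd⟩,
        hbQ⟩
    · intro i
      fin_cases i
      exacts [fun v hv => (hPL hv).1.1, Set.singleton_subset_iff.2 hc, fun v hv => hv.1,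
        fun v hv => (hQ hv).1.1]
    · intro i
      fin_cases i
      exacts [conn_comp _ _ _, conn_singleton _ _, hHc, conn_comp _ _ _]
    · intro i j v hi hj
      rcases lt_trichotomy i j with h | h | h
      exacts [absurd hj (hdisj i j h v hi), h, absurd hi (hdisj j i h v hj)]
    · intro i
      fin_cases i
      exacts [⟨p, hP₁P hp, c, rfl, hpc⟩, ⟨c, rfl, h', ⟨hh', hlt'⟩, hch'⟩, ⟨h, hh, q, hq, hqh.symm⟩,
        ⟨y, hyQ, x, hx, hxy.symm⟩]
  rcases lt_trichotomy (r' a) (r' b) with h | h | h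
  · exact .inl (key a b ⟨ha, hac⟩ ⟨hb, hbc⟩ h)
  · exact absurd (hinj' (hLR' a ⟨ha, hac⟩) (hLR' b ⟨hb, hbc⟩) h) hab
  · exact .inr (key b a ⟨hb, hbc⟩ ⟨ha, hac⟩ h)

/-- Four vertices of a 2-connected graph lie in connected sets that are arranged cyclically. -/
lemma exists_quad [Finite V] {G : SimpleGraph V} {R : Set V} (hRc : Conn G R)
    (hR : ∀ z, Conn G (R \ {z})) {x₁ x₂ y₁ y₂ : V} (h : [x₁, x₂, y₁, y₂].Nodup)
    (hmem : ∀ w ∈ [x₁, x₂, y₁, y₂], w ∈ R) :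
    Quad G R x₁ y₁ x₂ y₂ ∨ Quad G R x₁ x₂ y₁ y₂ ∨ Quad G R x₁ x₂ y₂ y₁ := by
  simp only [List.nodup_cons, List.mem_cons, List.not_mem_nil, or_false, not_or,
    List.nodup_nil, not_false_eq_true, and_true] at h
  have hx₁ := hmem x₁ (by simp)
  have hx₂ := hmem x₂ (by simp)
  have hy₁ := hmem y₁ (by simp)
  have hy₂ := hmem y₂ (by simp)
  obtain ⟨r, hinj, hmin, hmax, hlow, hup⟩ := exists_order hRc hR hx₁ hy₂ h.1.2.2
  have hlt : ∀ u ∈ R, ∀ v ∈ R, u ≠ v → r u ≤ r v → r u < r v := fun u hu v hv hne hle =>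
    lt_of_le_of_ne hle fun h => hne (hinj hu hv h)
  have h1 := hlt x₁ hx₁ x₂ hx₂ h.1.1 (hmin _ hx₂)
  have h2 := hlt x₁ hx₁ y₁ hy₁ h.1.2.1 (hmin _ hy₁)
  have h3 := hlt x₂ hx₂ y₂ hy₂ h.2.1.2 (hmax _ hx₂)
  have h4 := hlt y₁ hy₁ y₂ hy₂ h.2.2 (hmax _ hy₁)
  rcases le_total (r x₂) (r y₁) with hle | hle
  · have h5 := hlt x₂ hx₂ y₁ hy₁ h.2.1.1 hle
    rcases quad_of_order hRc hR hinj hx₁ hy₂ hmin hmax hlow hup hx₁ hx₂ hy₁ hy₂ h.1.1 h2 h5 h4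
      with h | h
    · exact .inr (.inr h.reflect)
    · exact .inr (.inl h.rotate.rotate.rotate)
  · have h5 := hlt y₁ hy₁ x₂ hx₂ (Ne.symm h.2.1.1) hle
    rcases quad_of_order hRc hR hinj hx₁ hy₂ hmin hmax hlow hup hx₁ hy₁ hx₂ hy₂ h.1.2.1 h1 h5 h3
      with h | h
    · exact .inr (.inr h)
    · exact .inl (h.rotate.rotate.rotate)

end Rooted

end OnePlanarity

namespace OnePlanarity

section Kuratowski

variable {V : Type}

lemma Quad.congr {G G' : SimpleGraph V} {R : Set V} {a b c d : V} (h : Quad G R a b c d)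
    (hG : ∀ u ∈ R, ∀ v ∈ R, G.Adj u v → G'.Adj u v) : Quad G' R a b c d := by
  obtain ⟨F, hR, hc, hd, ha, hF⟩ := h
  refine ⟨F, hR, fun i => ⟨(hc i).1, fun X hX hcl => (hc i).2 X hX fun u hu huX v hv huv =>
    hcl u hu huX v hv (hG u (hR i hu) v (hR i hv) huv)⟩, hd, fun i => ?_, hF⟩
  obtain ⟨u, hu, v, hv, huv⟩ := ha i
  exact ⟨u, hu, v, hv, hG u (hR i hu) v (hR _ hv) huv⟩

lemma IsSplit.congr {p q p' q' : V → Prop} {W : List V} (h : IsSplit p q W)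
    (hp : ∀ w ∈ W, p' w → p w) (hq : ∀ w ∈ W, q' w → q w) : IsSplit p' q' W := by
  obtain ⟨P, b, Q, b', P', rfl, hb, hb', h1, h2⟩ := h
  refine ⟨P, b, Q, b', P', rfl, hb, hb', fun w hw h => h1 w hw (hq w ?_ h),
    fun w hw h => h2 w hw (hp w ?_ h)⟩
  · simp only [List.mem_append] at hw ⊢
    tauto
  · simp [hw]

lemma Splits.congr {p q p' q' : V → Prop} {W : List V} (h : Splits p q W)
    (hp : ∀ w ∈ W, p' w → p w) (hq : ∀ w ∈ W, q' w → q w) : Splits p' q' W :=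
  h.imp (fun h => h.congr hp hq) (fun h => h.congr hq hp)

/-- A 3-connected graph without Kuratowski minors has a planarity certificate provided that
smaller graphs have one. -/
lemma cert_of_three_connected [Finite V] {G : SimpleGraph V} {U : Set V}
    (hm : SmallCert V U.ncard) (hG : Free G) (hsupp : ∀ u v, G.Adj u v → u ∈ U)
    (hedge : ∃ x y, G.Adj x y)
    (hconn : ∀ a b, (U \ {a, b}).Nonempty → Conn G (U \ {a, b})) : Cert G := by
  obtain ⟨x, y, hxy, hz⟩ := exists_contractible hedge hconn
  have hxU := hsupp x y hxy
  have hyU := hsupp y x hxy.symm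
  have hJ : Cert (contract G x y) := by
    refine hm (U \ {y}) _ (Set.ncard_sdiff_singleton_lt_of_mem hyU (Set.toFinite _)) ?_
      (hG.contract hxy)
    rintro u v ⟨h1, h2, h3, h | ⟨rfl, -⟩ | ⟨-, h⟩⟩
    exacts [⟨hsupp u v h, h1⟩, ⟨hxU, h1⟩, ⟨hsupp u y h.symm, h1⟩]
  obtain ⟨W, hW, hWm, h⟩ := exists_rotation hxy hJ
  have hWR : ∀ w ∈ W, w ∈ U \ {x, y} := by
    intro w hw
    obtain ⟨h1, h2, h3⟩ := (hWm w).1 hw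
    refine ⟨h3.elim (fun h => hsupp w x h.symm) fun h => hsupp w y h.symm, ?_⟩
    rintro (h | h)
    exacts [h1 h, h2 h]
  have hxR : x ∉ U \ {x, y} := fun h => h.2 (by simp)
  have hyR : y ∉ U \ {x, y} := fun h => h.2 (by simp)
  have hRc : ∀ a b c, a ∈ W → b ∈ W → c ∈ W → a ≠ b → a ≠ c → b ≠ c →
      Conn G (U \ {x, y}) ∧ ∀ z, Conn G ((U \ {x, y}) \ {z}) := by
    intro a b c ha hb hc hab hac hbc
    refine ⟨hconn x y ⟨a, hWR a ha⟩, fun z => ?_⟩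
    have hset : (U \ {x, y}) \ {z} = U \ {x, y, z} := by
      ext v
      simp only [Set.mem_sdiff, Set.mem_insert_iff, Set.mem_singleton_iff]
      tauto
    rw [hset]
    apply hz
    rw [← hset]
    by_cases haz : a = z
    · exact ⟨b, hWR b hb, fun h => hab (haz.trans (Eq.symm h))⟩
    · exact ⟨a, hWR a ha, haz⟩
  have hres : ∀ a b c d, a ∈ W → b ∈ W → c ∈ W → d ∈ W →
      Splits (fun w => w = a ∨ w = b) (fun w => w = c ∨ w = d) W →
      ¬ Quad G (U \ {x, y}) a c b d := by
    intro a b c d ha hb hc hd hs hQ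
    let G' : SimpleGraph V := SimpleGraph.fromRel fun u v =>
      (G.Adj u v ∧ u ∈ U \ {x, y} ∧ v ∈ U \ {x, y}) ∨ (u = x ∧ v = y) ∨
        (u = x ∧ (v = a ∨ v = b)) ∨ (u = y ∧ (v = c ∨ v = d))
    have hof : ∀ u v, (G.Adj u v ∧ u ∈ U \ {x, y} ∧ v ∈ U \ {x, y}) ∨ (u = x ∧ v = y) ∨
        (u = x ∧ (v = a ∨ v = b)) ∨ (u = y ∧ (v = c ∨ v = d)) → u ≠ v → G'.Adj u v :=
      fun u v h hne => (SimpleGraph.fromRel_adj _ _ _).2 ⟨hne, .inl h⟩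
    have hne : ∀ w ∈ W, x ≠ w ∧ y ≠ w := fun w hw => ⟨((hWm w).1 hw).1.symm,
      ((hWm w).1 hw).2.1.symm⟩
    have hc' : Cert G' := by
      have hx : ∀ w, w ≠ x → w ≠ y → G'.Adj x w → w = a ∨ w = b := by
        intro w hwx hwy hw
        rcases ((SimpleGraph.fromRel_adj _ _ _).1 hw).2 with h | h
        · rcases h with h | h | h | h
          exacts [absurd h.2.1 hxR, absurd h.2 hwy, h.2, absurd h.1 hxy.ne]
        · rcases h with h | h | h | h
          exacts [absurd h.2.2 hxR, absurd h.1 hwx, absurd h.1 hwx, absurd h.1 hwy]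
      have hy : ∀ w, w ≠ x → w ≠ y → G'.Adj y w → w = c ∨ w = d := by
        intro w hwx hwy hw
        rcases ((SimpleGraph.fromRel_adj _ _ _).1 hw).2 with h | h
        · rcases h with h | h | h | h
          exacts [absurd h.2.1 hyR, absurd h.2 hwy, absurd h.1 hxy.ne', h.2]
        · rcases h with h | h | h | h
          exacts [absurd h.2.2 hyR, absurd h.1 hwx, absurd h.1 hwx, absurd h.1 hwy]
      refine h G' ?_ ?_ (hs.congr (fun w hw => hx w (hne w hw).1.symm (hne w hw).2.symm)
        (fun w hw => hy w (hne w hw).1.symm (hne w hw).2.symm))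
      · intro u v huv hux huy hvx hvy
        rcases ((SimpleGraph.fromRel_adj _ _ _).1 huv).2 with h | h
        · rcases h with h | h | h | h
          exacts [h.1, absurd h.1 hux, absurd h.1 hux, absurd h.1 huy]
        · rcases h with h | h | h | h
          exacts [h.1.symm, absurd h.1 hvx, absurd h.1 hvx, absurd h.1 hvy]
      · rintro w hwx hwy (hw | hw)
        · rcases hx w hwx hwy hw with rfl | rfl
          exacts [((hWm _).1 ha).2.2, ((hWm _).1 hb).2.2]
        · rcases hy w hwx hwy hw with rfl | rfl
          exacts [((hWm _).1 hc).2.2, ((hWm _).1 hd).2.2]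
    refine not_free_of_quad (hQ.congr fun u hu v hv huv => hof u v (.inl ⟨huv, hu, hv⟩) huv.ne)
      (x := x) (y := y) (hof x y (by simp) hxy.ne) hxR hyR (hof x a (by simp) (hne a ha).1)
      (hof x b (by simp) (hne b hb).1) (hof y c (by simp) (hne c hc).2)
      (hof y d (by simp) (hne d hd).2) hc'.free
  rcases splits_or (p := G.Adj x) (q := G.Adj y) hW with hs | ⟨a, b, c, ha, hb, hc, hab, hac, hbc,
    ha', hb', hc'⟩ | ⟨x₁, x₂, y₁, y₂, hnd, hmem, hx', hy', halt⟩
  · refine h G (fun _ _ h _ _ _ _ => h) (fun _ _ _ h => h) hs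
  · obtain ⟨h1, h2⟩ := hRc a b c ha hb hc hab hac hbc
    exact absurd hG (not_free_of_three h1 h2 hxy hxR hyR (hWR a ha) (hWR b hb) (hWR c hc)
      hab hac hbc ha'.1 hb'.1 hc'.1 ha'.2 hb'.2 hc'.2)
  · have hx₁ := hmem x₁ (by simp)
    have hx₂ := hmem x₂ (by simp)
    have hy₁ := hmem y₁ (by simp)
    have hy₂ := hmem y₂ (by simp)
    have hnd' := hnd
    simp only [List.nodup_cons, List.mem_cons, List.not_mem_nil, or_false, not_or,
      List.nodup_nil, not_false_eq_true, and_true] at hnd'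
    obtain ⟨h1, h2⟩ := hRc x₁ x₂ y₁ hx₁ hx₂ hy₁ hnd'.1.1 hnd'.1.2.1 hnd'.2.1.1
    rcases exists_quad h1 h2 hnd (fun w hw => hWR w (hmem w hw)) with hq | hq | hq
    · exact absurd hG (not_free_of_quad hq hxy hxR hyR hx'.1 hx'.2 hy'.1 hy'.2)
    · exact absurd hq (hres x₁ y₁ x₂ y₂ hx₁ hy₁ hx₂ hy₂ halt.1)
    · exact absurd hq (hres x₁ y₂ x₂ y₁ hx₁ hy₂ hx₂ hy₁ halt.2)

lemma smallCert [Finite V] (m : ℕ) : SmallCert V m := by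
  induction m with
  | zero => exact fun U G h => absurd h (Nat.not_lt_zero _)
  | succ m ih =>
    intro U G hU
    have hm : SmallCert V U.ncard := fun U' G' h => ih U' G' (by omega)
    induction G using WellFoundedGT.induction with
    | _ G ihG =>
    intro hsupp hG
    by_cases hedge : ∃ x y, G.Adj x y
    swap
    · push Not at hedge
      rw [show G = ⊥ by ext u v; simp [hedge]]
      exact cert_bot
    by_cases hsep : ∃ T ⊆ U, T.ncard ≤ 2 ∧ (U \ T).Nonempty ∧ ¬ Conn G (U \ T)
    · obtain ⟨G', hlt, hsupp', hG'⟩ := exists_addition hm hG hsupp hsep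
      exact (ihG G' hlt hsupp' hG').mono hlt.le
    · push Not at hsep
      refine cert_of_three_connected hm hG hsupp hedge fun a b hne => ?_
      have h1 : U \ {a, b} = U \ (U ∩ {a, b}) := by simp
      rw [h1] at hne ⊢
      exact hsep _ Set.inter_subset_left ((Set.ncard_le_ncard Set.inter_subset_right
        (Set.toFinite _)).trans ((Set.ncard_insert_le a {b}).trans (by rw [Set.ncard_singleton])))
            hne

/-- Graphs without `K₅` and `K₃,₃` minors have planarity certificates. -/
theorem Free.cert [Finite V] {G : SimpleGraph V} (hG : Free G) : Cert G :=
  smallCert (Set.ncard (Set.univ : Set V) + 1) Set.univ G (Nat.lt_succ_self _)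
    (fun _ _ _ => trivial) hG

end Kuratowski

end OnePlanarity

namespace OnePlanarity

section Planarization

variable {V : Type}

/-- A partial matching on the edges of `G`, in which matched edges are disjoint. -/
structure IsPairing (G : SimpleGraph V) (R : Sym2 V → Sym2 V → Prop) : Prop where
  mem : ∀ e e', R e e' → e ∈ G.edgeSet
  symm : ∀ e e', R e e' → R e' e
  unique : ∀ e e₁ e₂, R e e₁ → R e e₂ → e₁ = e₂
  disj : ∀ e e', R e e' → ∀ v, v ∈ e → v ∉ e'

lemma IsPairing.ne {G : SimpleGraph V} {R : Sym2 V → Sym2 V → Prop} (hR : IsPairing G R)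
    {e e' : Sym2 V} (h : R e e') : e ≠ e' := by
  rintro rfl
  induction e with | _ u v
  exact hR.disj _ _ h u (by simp) (by simp)

lemma ClosedFree.free {W : Type*} {G : SimpleGraph V} {R : Sym2 V → Sym2 V → Prop}
    (h : ClosedFree G R) {J : SimpleGraph W}
    (key : ∀ {k : ℕ} {H : SimpleGraph (Fin k)} {B : Fin k → Set W}, IsObstruction H →
      IsModel H J B → ∃ B', (∀ i, RClosed R (B' i)) ∧ IsModel H (crossGraph G R) B') : Free J :=
  ⟨fun _ hB => (key isObstruction_five hB).elim fun B' hB' => h.1 B' hB'.1 hB'.2,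
    fun _ hB => (key isObstruction_three_three hB).elim fun B' hB' => h.2 B' hB'.1 hB'.2⟩

lemma ClosedFree.of_models {G : SimpleGraph V} {R R' : Sym2 V → Sym2 V → Prop}
    (h : ClosedFree G R)
    (key : ∀ {k : ℕ} {H : SimpleGraph (Fin k)} {B : Fin k → Set (V ⊕ Sym2 V)}, IsObstruction H →
      (∀ i, RClosed R' (B i)) → IsModel H (crossGraph G R') B →
      ∃ B', (∀ i, RClosed R (B' i)) ∧ IsModel H (crossGraph G R) B') : ClosedFree G R' :=
  ⟨fun _ hR hB => (key isObstruction_five hR hB).elim fun B' hB' => h.1 B' hB'.1 hB'.2,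
    fun _ hR hB => (key isObstruction_three_three hR hB).elim fun B' hB' => h.2 B' hB'.1 hB'.2⟩

/-- The graph obtained by placing a vertex on every edge, the same for edges with the same value
under `r`. -/
def starGraph {Q : Type*} (G : SimpleGraph V) (r : Sym2 V → Q) : SimpleGraph (V ⊕ Q) where
  Adj
    | .inl u, .inr x => ∃ e ∈ G.edgeSet, u ∈ e ∧ r e = x
    | .inr x, .inl u => ∃ e ∈ G.edgeSet, u ∈ e ∧ r e = x
    | _, _ => False
  symm := ⟨by
    rintro (u | x) (v | y) h <;> exact h⟩
  loopless := ⟨by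
    rintro (u | x) h <;> exact h⟩

lemma free_starGraph {Q : Type*} {G : SimpleGraph V} {R : Sym2 V → Sym2 V → Prop}
    (hR : IsPairing G R) (hfree : ClosedFree G R) {r : Sym2 V → Q}
    (hr : ∀ e e', r e = r e' ↔ e = e' ∨ R e e') : Free (starGraph G r) := by
  refine hfree.free fun {k H B} hH hB => ?_
  let F : V ⊕ Q → Set (V ⊕ Sym2 V) := Sum.elim (fun u => {.inl u}) fun x =>
      {a | ∃ e, r e = x ∧ a = .inr e}
  have hF : ∀ i, ∀ w ∈ B i, Conn (crossGraph G R) (F w) := by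
    rintro i (u | x) hw
    · exact conn_singleton _ _
    · obtain ⟨u | y, h⟩ := hB.exists_adj hH hw
      swap
      · exact h.elim
      obtain ⟨e, he, -, rfl⟩ := h
      by_cases h : ∃ e', R e e'
      · obtain ⟨e', h⟩ := h
        have : F (.inr (r e)) = {.inr e, .inr e'} := by
          ext a
          simp only [F, Sum.elim_inr, Set.mem_ofPred_eq, Set.mem_insert_iff, Set.mem_singleton_iff]
          constructor
          · rintro ⟨f, hf, rfl⟩
            rcases (hr _ _).1 hf with rfl | hf
            · exact .inl rfl
            · exact .inr (congrArg _ (hR.unique _ _ _ (hR.symm _ _ hf) h))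
          · rintro (rfl | rfl)
            · exact ⟨e, rfl, rfl⟩
            · exact ⟨e', (hr _ _).2 (.inr (hR.symm _ _ h)), rfl⟩
        rw [this]
        exact conn_pair ⟨he, hR.mem _ _ (hR.symm _ _ h), hR.ne h, .inl h⟩
      · have : F (.inr (r e)) = {.inr e} := by
          ext a
          simp only [F, Sum.elim_inr, Set.mem_ofPred_eq, Set.mem_singleton_iff]
          constructor
          · rintro ⟨f, hf, rfl⟩
            rcases (hr _ _).1 hf with rfl | hf
            · rfl
            · exact (h ⟨f, hR.symm _ _ hf⟩).elim
          · rintro rfl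
            exact ⟨e, rfl, rfl⟩
        rw [this]
        exact conn_singleton _ _
  have hadj : ∀ w w', (starGraph G r).Adj w w' → ∃ u ∈ F w, ∃ v ∈ F w',
      (crossGraph G R).Adj u v := by
    rintro (u | x) (v | y) h
    · exact h.elim
    · obtain ⟨e, he, hu, rfl⟩ := h
      exact ⟨_, rfl, .inr e, ⟨e, rfl, rfl⟩, he, hu⟩
    · obtain ⟨e, he, hu, rfl⟩ := h
      exact ⟨.inr e, ⟨e, rfl, rfl⟩, _, rfl, he, hu⟩
    · exact h.elim
  refine ⟨fun i => ⋃ w ∈ B i, F w, ?_, ⟨?_, ?_, ?_⟩⟩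
  · intro i e e' h
    have hrr : r e = r e' := (hr _ _).2 (.inr h)
    simp only [Set.mem_iUnion₂]
    constructor
    all_goals
      rintro ⟨u | x, hw, hm⟩
      · cases hm
      · obtain ⟨f, rfl, hf⟩ := hm
        cases hf
        refine ⟨_, hw, _, ?_, rfl⟩
        simp [hrr]
  · intro i j a hi hj
    obtain ⟨w, hw, haw⟩ := Set.mem_iUnion₂.1 hi
    obtain ⟨w', hw', haw'⟩ := Set.mem_iUnion₂.1 hj
    have : w = w' := by
      rcases w with u | x <;> rcases w' with v | y
      · cases haw; cases haw'; rfl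
      · obtain ⟨f, -, rfl⟩ := haw'; cases haw
      · obtain ⟨f, -, rfl⟩ := haw; cases haw'
      · obtain ⟨f, rfl, rfl⟩ := haw
        obtain ⟨f', rfl, h⟩ := haw'
        cases h; rfl
    exact hB.disj i j w hw (this ▸ hw')
  · exact fun i => conn_biUnion (hB.conn i) F (hF i) fun w _ w' _ h => hadj w w' h
  · intro i j hij
    obtain ⟨w, hw, w', hw', h⟩ := hB.adj i j hij
    obtain ⟨u, hu, v, hv, huv⟩ := hadj w w' h
    exact ⟨u, Set.mem_biUnion hw hu, v, Set.mem_biUnion hw' hv, huv⟩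

/-- Gluing the arcs of a crossing-free drawing of the graph `starGraph G r`. -/
lemma exists_drawing_of_starGraph [Finite V] {Q : Type*} [Finite Q] {G : SimpleGraph V}
    {R : Sym2 V → Sym2 V → Prop} (hR : IsPairing G R) {r : Sym2 V → Q}
    (hr : ∀ e e', r e = r e' ↔ e = e' ∨ R e e') (D : Drawing (starGraph G r))
    (hD : ∀ e e' p, ¬ D.Crosses e e' p) :
    ∃ D' : Drawing G, D'.IsOnePlanar ∧ ∀ e e' p, D'.Crosses e e' p → R e e' := by
  let A : V → Sym2 V → Set (ℝ × ℝ) := fun u e => D.arc s(.inl u, .inr (r e))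
  have hadj : ∀ e ∈ G.edgeSet, ∀ u ∈ e, (starGraph G r).Adj (.inl u) (.inr (r e)) :=
    fun e he u hu => ⟨e, he, hu, rfl⟩
  have hA : ∀ e ∈ G.edgeSet, ∀ u ∈ e, IsArc (A u e) (D.pos (.inl u)) (D.pos (.inr (r e))) :=
    fun e he u hu => D.arc_curve _ (hadj e he u hu) _ _ rfl
  have hmeet : ∀ e ∈ G.edgeSet, ∀ e' ∈ G.edgeSet, ∀ u ∈ e, ∀ u' ∈ e', e ≠ e' ∨ u ≠ u' →
      ∀ p ∈ A u e, p ∈ A u' e' →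
        (u = u' ∧ p = D.pos (.inl u)) ∨ (r e = r e' ∧ p = D.pos (.inr (r e))) := by
    intro e he e' he' u hu u' hu' hne p hp hp'
    have hne' : s(Sum.inl u, Sum.inr (r e)) ≠ s(Sum.inl u', Sum.inr (r e')) := by
      intro h
      simp only [Sym2.eq_iff, Sum.inl.injEq, Sum.inr.injEq, reduceCtorEq, and_self, or_false] at h
      obtain ⟨rfl, h⟩ := h
      rcases (hr _ _).1 h with rfl | h
      · simp at hne
      · exact hR.disj _ _ h u hu hu'
    have hp0 : p ∈ Set.range D.pos := by
      by_contra hp0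
      exact hD _ _ p ⟨hadj e he u hu, hadj e' he' u' hu', hne', hp, hp', hp0⟩
    obtain ⟨w, rfl⟩ := hp0
    have h1 := D.arc_avoid _ (hadj e he u hu) w hp
    have h2 := D.arc_avoid _ (hadj e' he' u' hu') w hp'
    rw [Sym2.mem_iff] at h1 h2
    rcases h1 with rfl | rfl
    · left
      simpa using h2
    · right
      simpa using h2
  let arc : Sym2 V → Set (ℝ × ℝ) := fun e => {p | ∃ u ∈ e, p ∈ A u e}
  have hpoint : ∀ e ∈ G.edgeSet, ∀ e' ∈ G.edgeSet, e ≠ e' → ∀ p ∈ arc e, p ∈ arc e' →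
      (∃ u, p = D.pos (.inl u)) ∨ (R e e' ∧ p = D.pos (.inr (r e))) := by
    rintro e he e' he' hne p ⟨u, hu, hp⟩ ⟨u', hu', hp'⟩
    rcases hmeet e he e' he' u hu u' hu' (.inl hne) p hp hp' with h | ⟨h, h'⟩
    · exact .inl ⟨u, h.2⟩
    · exact .inr ⟨((hr _ _).1 h).resolve_left hne, h'⟩
  let D' : Drawing G :=
    { pos := fun v => D.pos (.inl v)
      pos_inj := D.pos_inj.comp Sum.inl_injective
      arc := arc
      arc_curve := by
        rintro e he u v rfl
        have huv : u ≠ v := (G.mem_edgeSet.1 he).ne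
        have := (hA _ he u (by simp)).trans (hA _ he v (by simp)).symm (by
          rintro p ⟨hp, hp'⟩
          rcases hmeet _ he _ he u (by simp) v (by simp) (.inr huv) p hp hp' with h | h
          · exact (huv h.1).elim
          · exact h.2)
        convert this using 1
        ext p
        simp [arc]
      arc_avoid := by
        rintro e he w ⟨u, hu, hp⟩
        have := D.arc_avoid _ (hadj e he u hu) _ hp
        simp only [Sym2.mem_iff, Sum.inl.injEq, reduceCtorEq, or_false] at this
        rwa [this]
      arc_finite_inter := by
        intro e he e' he' hne
        refine (Set.finite_range D.pos).subset ?_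
        rintro p ⟨hp, hp'⟩
        rcases hpoint e he e' he' hne p hp hp' with ⟨u, rfl⟩ | ⟨-, rfl⟩ <;> simp }
  have hcross : ∀ e e' p, D'.Crosses e e' p → R e e' ∧ p = D.pos (.inr (r e)) := by
    rintro e e' p ⟨he, he', hne, hp, hp', hp0⟩
    rcases hpoint e he e' he' hne p hp hp' with ⟨u, rfl⟩ | h
    · exact (hp0 ⟨u, rfl⟩).elim
    · exact h
  refine ⟨D', ⟨?_, ?_⟩, fun e e' p h => (hcross e e' p h).1⟩
  · intro e e₁ e₂ p q h1 h2
    have h1 := hcross _ _ _ h1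
    have h2 := hcross _ _ _ h2
    exact ⟨hR.unique _ _ _ h1.1 h2.1, h1.2.trans h2.2.symm⟩
  · intro e e' p h
    exact hR.disj _ _ (hcross _ _ _ h).1

/-- A pairing without closed models of the Kuratowski graphs is realized by a 1-planar drawing. -/
theorem IsPairing.exists_drawing [Finite V] {G : SimpleGraph V} {R : Sym2 V → Sym2 V → Prop}
    (hR : IsPairing G R) (hfree : ClosedFree G R) :
    ∃ D : Drawing G, D.IsOnePlanar ∧ ∀ e e' p, D.Crosses e e' p → R e e' := by
  let s : Setoid (Sym2 V) :=
    { r := fun e e' => e = e' ∨ R e e'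
      iseqv :=
        { refl := fun e => .inl rfl
          symm := by
            rintro e e' (rfl | h)
            exacts [.inl rfl, .inr (hR.symm _ _ h)]
          trans := by
            rintro e e' e'' (rfl | h) (rfl | h')
            · exact .inl rfl
            · exact .inr h'
            · exact .inr h
            · exact .inl (hR.unique _ _ _ (hR.symm _ _ h) h') } }
  have hr : ∀ e e', Quotient.mk s e = Quotient.mk s e' ↔ e = e' ∨ R e e' :=
    fun e e' => Quotient.eq
  obtain ⟨D, hD⟩ := (free_starGraph hR hfree hr).cert.exists_drawing
  exact exists_drawing_of_starGraph hR hr D hD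

end Planarization

end OnePlanarity

namespace OnePlanarity

section Reduction

variable {V : Type}

/-- A partial matching of crossing edges all of whose crossing types lie in `S`. -/
structure IsGood (G : SimpleGraph V) (S : Set CrossingType) (R : Sym2 V → Sym2 V → Prop) : Prop
    extends IsPairing G R where
  type : ∀ a b c d, R s(a, b) s(c, d) → ∃ t ∈ S, HasCrossingType G a b c d t

theorem sRestricted_iff [Finite V] {G : SimpleGraph V} {S : Set CrossingType} :
    SRestricted G S ↔ ∃ R, IsGood G S R ∧ ClosedFree G R := by
  constructor
  · rintro ⟨D, ⟨h1, h2⟩, h3⟩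
    refine ⟨fun e e' => ∃ p, D.Crosses e e' p, ⟨⟨?_, ?_, ?_, ?_⟩, ?_⟩,
      D.closedFree (fun _ _ p h => ⟨p, h⟩) fun _ _ h => h⟩
    · exact fun e e' ⟨p, h⟩ => h.1
    · exact fun e e' ⟨p, h⟩ => ⟨p, h.2.1, h.1, h.2.2.1.symm, h.2.2.2.2.1, h.2.2.2.1, h.2.2.2.2.2⟩
    · exact fun e e₁ e₂ ⟨p, hp⟩ ⟨q, hq⟩ => (h1 _ _ _ _ _ hp hq).1
    · exact fun e e' ⟨p, hp⟩ => h2 _ _ _ hp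
    · exact fun a b c d ⟨p, hp⟩ => h3 _ _ _ _ _ hp
  · rintro ⟨R, hR, hfree⟩
    obtain ⟨D, hD, h⟩ := hR.exists_drawing hfree
    exact ⟨D, hD, fun a b c d p hp => hR.type _ _ _ _ (h _ _ _ hp)⟩

lemma IsModel.not_two_neighbors {W ι : Type*} {H : SimpleGraph ι} (hH : IsObstruction H)
    {J : SimpleGraph W} {B : ι → Set W} (hB : IsModel H J B) (i : ι) (x y : W)
    (h : ∀ u ∈ B i, ∀ v, v ∉ B i → J.Adj u v → v = x ∨ v = y) : False := by
  obtain ⟨j, k, l, hjk, hjl, hkl, hj, hk, hl⟩ := hH.three i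
  have key : ∀ m, H.Adj i m → x ∈ B m ∨ y ∈ B m := by
    intro m hm
    obtain ⟨u, hu, v, hv, huv⟩ := hB.adj i m hm
    rcases h u hu v (fun h' => hm.ne (hB.disj _ _ _ h' hv)) huv with rfl | rfl
    · exact .inl hv
    · exact .inr hv
  rcases key j hj with h1 | h1 <;> rcases key k hk with h2 | h2 <;> rcases key l hl with h3 | h3
  all_goals first
    | exact hjk (hB.disj _ _ _ h1 h2)
    | exact hjl (hB.disj _ _ _ h1 h3)
    | exact hkl (hB.disj _ _ _ h2 h3)

/-- A branch set meeting the interior of a path of three vertices of degree two contains an end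
of the path. -/
lemma IsModel.mem_of_path {W ι : Type*} {H : SimpleGraph ι} (hH : IsObstruction H)
    {J : SimpleGraph W} {B : ι → Set W} (hB : IsModel H J B) (i : ι) {p₀ p₁ p₂ p₃ p₄ : W}
    (h₁ : ∀ v, J.Adj p₁ v → v = p₀ ∨ v = p₂) (h₂ : ∀ v, J.Adj p₂ v → v = p₁ ∨ v = p₃)
    (h₃ : ∀ v, J.Adj p₃ v → v = p₂ ∨ v = p₄) (h : p₁ ∈ B i ∨ p₂ ∈ B i ∨ p₃ ∈ B i) :
    p₀ ∈ B i ∨ p₄ ∈ B i := by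
  by_contra! hn
  by_cases hp : p₂ ∈ B i
  · have hsub := (hB.conn i).2 {p₁, p₂, p₃} ⟨p₂, hp, by simp⟩ (by
      rintro u hu (rfl | rfl | rfl) v hv huv
      · rcases h₁ v huv with rfl | rfl
        · exact (hn.1 hv).elim
        · simp
      · rcases h₂ v huv with rfl | rfl <;> simp
      · rcases h₃ v huv with rfl | rfl
        · simp
        · exact (hn.2 hv).elim)
    classical
    refine hB.not_two_neighbors hH i (if p₁ ∈ B i then p₀ else p₁) (if p₃ ∈ B i then p₄ else p₃)
      fun u hu v hv huv => ?_
    rcases hsub u hu with rfl | rfl | rfl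
    · rcases h₁ v huv with rfl | rfl
      · simp [hu]
      · exact (hv hp).elim
    · rcases h₂ v huv with rfl | rfl <;> simp [hv]
    · rcases h₃ v huv with rfl | rfl
      · exact (hv hp).elim
      · simp [hu]
  · rcases h with h | h | h
    · have hsub := (hB.conn i).2 {p₁} ⟨p₁, h, rfl⟩ (by
        rintro u hu rfl v hv huv
        rcases h₁ v huv with rfl | rfl
        · exact (hn.1 hv).elim
        · exact (hp hv).elim)
      refine hB.not_two_neighbors hH i p₀ p₂ fun u hu v hv huv => ?_
      obtain rfl := hsub u hu
      exact h₁ v huv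
    · exact hp h
    · have hsub := (hB.conn i).2 {p₃} ⟨p₃, h, rfl⟩ (by
        rintro u hu rfl v hv huv
        rcases h₃ v huv with rfl | rfl
        · exact (hp hv).elim
        · exact (hn.2 hv).elim)
      refine hB.not_two_neighbors hH i p₂ p₄ fun u hu v hv huv => ?_
      obtain rfl := hsub u hu
      exact h₃ v huv

/-- The vertices `a, b, c, d` form a 4-cycle of `G`. -/
structure IsFourCycle (G : SimpleGraph V) (a b c d : V) : Prop where
  ab : G.Adj a b
  bc : G.Adj b c
  cd : G.Adj c d
  da : G.Adj d a

lemma IsFourCycle.rotate {G : SimpleGraph V} {a b c d : V} (h : IsFourCycle G a b c d) :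
    IsFourCycle G c d a b := ⟨h.cd, h.da, h.ab, h.bc⟩

section Twins

variable {G : SimpleGraph V} {R : Sym2 V → Sym2 V → Prop} {a b c d : V}

/-- The edges of a 4-cycle. -/
def cycleEdges (a b c d : V) : Set (Sym2 V) := {s(a, b), s(b, c), s(c, d), s(d, a)}

/-- Two opposite vertices of a 4-cycle together with its edges. -/
def twinPart (a b c d : V) : Set (V ⊕ Sym2 V) :=
  {.inl b, .inl d, .inr s(a, b), .inr s(b, c), .inr s(c, d), .inr s(d, a)}

/-- The pairs avoiding a set of edges. -/
def avoid (R : Sym2 V → Sym2 V → Prop) (T : Set (Sym2 V)) : Sym2 V → Sym2 V → Prop :=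
  fun e e' => R e e' ∧ e ∉ T ∧ e' ∉ T

lemma crossGraph_avoid_le (T : Set (Sym2 V)) : crossGraph G (avoid R T) ≤ crossGraph G R := by
  rintro (u | e) (v | e') h
  · exact h
  · exact h
  · exact h
  · exact ⟨h.1, h.2.1, h.2.2.1, h.2.2.2.imp (·.1) (·.1)⟩

lemma adj_of_mem_cycleEdges {T : Set (Sym2 V)} {u v : V} (h : s(u, v) ∈ T) (x : V ⊕ Sym2 V)
    (hx : (crossGraph G (avoid R T)).Adj (.inr s(u, v)) x) : x = .inl u ∨ x = .inl v := by
  rcases x with x | e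
  · obtain ⟨-, hx⟩ := hx
    simpa using hx
  · rcases hx.2.2.2 with h' | h'
    · exact (h'.2.1 h).elim
    · exact (h'.2.2 h).elim

lemma adj_of_degree_two {T : Set (Sym2 V)} {u v w : V} (h : ∀ x, G.Adj v x → x = u ∨ x = w)
    (x : V ⊕ Sym2 V) (hx : (crossGraph G (avoid R T)).Adj (.inl v) x) :
    x = .inr s(u, v) ∨ x = .inr s(v, w) := by
  rcases x with x | e
  · exact hx.elim
  · obtain ⟨he, hv⟩ := hx
    obtain ⟨y, rfl⟩ := Sym2.mem_iff_exists.1 hv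
    rcases h y he with rfl | rfl
    · left; rw [Sym2.eq_swap]
    · exact .inr rfl

set_option maxHeartbeats 1000000 in
/-- Crossings around a pair of twins of degree two can be discarded. -/
lemma ClosedFree.avoid_twins (hR : IsPairing G R) (hfree : ClosedFree G R)
    (hc : IsFourCycle G a b c d) (hcross : R s(a, b) s(c, d))
    (hb : ∀ x, G.Adj b x → x = a ∨ x = c) (hd : ∀ x, G.Adj d x → x = c ∨ x = a) :
    ClosedFree G (avoid R (cycleEdges a b c d)) := by
  have hac : a ≠ c := by
    rintro rfl
    exact hR.disj _ _ hcross a (by simp) (by simp)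
  have hbd : b ≠ d := by
    rintro rfl
    exact hR.disj _ _ hcross b (by simp) (by simp)
  have hab := hc.ab.ne
  have hbc := hc.bc.ne
  have hcd := hc.cd.ne
  have hda := hc.da.ne
  refine hfree.of_models fun {k H B} hH hcl hB => ?_
  have hleft : ∀ x, .inr s(a, b) = x ∨ .inl b = x ∨ .inr s(b, c) = x →
      ∀ i, x ∈ B i → .inl a ∈ B i ∨ .inl c ∈ B i := by
    intro x hx i hxi
    refine hB.mem_of_path hH i (p₁ := .inr s(a, b)) (p₂ := .inl b) (p₃ := .inr s(b, c))
      (adj_of_mem_cycleEdges (by simp [cycleEdges])) (adj_of_degree_two hb)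
      (adj_of_mem_cycleEdges (by simp [cycleEdges])) ?_
    rcases hx with rfl | rfl | rfl
    exacts [.inl hxi, .inr (.inl hxi), .inr (.inr hxi)]
  have hright : ∀ x, .inr s(c, d) = x ∨ .inl d = x ∨ .inr s(d, a) = x →
      ∀ i, x ∈ B i → .inl a ∈ B i ∨ .inl c ∈ B i := by
    intro x hx i hxi
    refine (hB.mem_of_path hH i (p₁ := .inr s(c, d)) (p₂ := .inl d) (p₃ := .inr s(d, a))
      (adj_of_mem_cycleEdges (by simp [cycleEdges])) (adj_of_degree_two hd)
      (adj_of_mem_cycleEdges (by simp [cycleEdges])) ?_).symm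
    rcases hx with rfl | rfl | rfl
    exacts [.inl hxi, .inr (.inl hxi), .inr (.inr hxi)]
  have hends : ∀ i, ∀ x ∈ twinPart a b c d, x ∈ B i → .inl a ∈ B i ∨ .inl c ∈ B i := by
    rintro i x (rfl | rfl | rfl | rfl | rfl | rfl) hxi
    · exact hleft _ (by simp) i hxi
    · exact hright _ (by simp) i hxi
    · exact hleft _ (by simp) i hxi
    · exact hleft _ (by simp) i hxi
    · exact hright _ (by simp) i hxi
    · exact hright _ (by simp) i hxi
  have hnbr : ∀ x ∈ twinPart a b c d, ∀ y,
      (crossGraph G (avoid R (cycleEdges a b c d))).Adj x y →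
      y ∈ twinPart a b c d ∨ y = .inl a ∨ y = .inl c := by
    rintro x (rfl | rfl | rfl | rfl | rfl | rfl) y hxy
    · rcases adj_of_degree_two hb y hxy with rfl | rfl <;> simp [twinPart]
    · rcases adj_of_degree_two hd y hxy with rfl | rfl <;> simp [twinPart]
    all_goals
      rcases adj_of_mem_cycleEdges (by simp [cycleEdges]) y hxy with rfl | rfl <;> simp [twinPart]
  have haT : .inl a ∉ twinPart a b c d := by simp [twinPart, hab, hda.symm]
  have hcT : .inl c ∉ twinPart a b c d := by simp [twinPart, hbc.symm, hcd]
  have hinr : ∀ e, .inr e ∈ twinPart a b c d ↔ e ∈ cycleEdges a b c d := by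
    intro e
    simp [twinPart, cycleEdges]
  have hadjCross : (crossGraph G R).Adj (.inr s(a, b)) (.inr s(c, d)) :=
    ⟨hc.ab, hc.cd, hR.ne hcross, .inl hcross⟩
  have hadjA : (crossGraph G R).Adj (.inl a) (.inr s(a, b)) := ⟨hc.ab, by simp⟩
  have hadjC : (crossGraph G R).Adj (.inl c) (.inr s(c, d)) := ⟨hc.cd, by simp⟩
  -- the core of the new branch sets
  let Y : Fin k → Set (V ⊕ Sym2 V) := fun i => (B i \ twinPart a b c d) ∪
    {x | .inl c ∈ B i ∧ (x = .inr s(a, b) ∨ x = .inr s(c, d))}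
  have hY : ∀ i, Conn (crossGraph G R) (Y i) := by
    intro i
    classical
    by_cases hci : .inl c ∈ B i
    · let f : V ⊕ Sym2 V → V ⊕ Sym2 V := fun x =>
        if x = .inr s(a, b) ∨ x = .inl d ∨ x = .inr s(d, a) then .inr s(a, b)
        else if x = .inl b ∨ x = .inr s(b, c) ∨ x = .inr s(c, d) then .inr s(c, d) else x
      have e1 : s(c, d) ≠ s(a, b) := (hR.ne hcross).symm
      have e2 : s(c, d) ≠ s(d, a) := by
        intro h
        rw [Sym2.eq_iff] at h
        rcases h with h | h
        · exact hcd h.1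
        · exact hac h.1.symm
      have e3 : s(b, c) ≠ s(a, b) := by
        intro h
        rw [Sym2.eq_iff] at h
        rcases h with h | h
        · exact hab h.1.symm
        · exact hac h.2.symm
      have e4 : s(b, c) ≠ s(d, a) := by
        intro h
        rw [Sym2.eq_iff] at h
        rcases h with h | h
        · exact hbd h.1
        · exact hab h.1.symm
      have hfab : f (.inr s(a, b)) = .inr s(a, b) := by simp [f]
      have hfd : f (.inl d) = .inr s(a, b) := by simp [f]
      have hfda : f (.inr s(d, a)) = .inr s(a, b) := by simp [f]
      have hfb : f (.inl b) = .inr s(c, d) := by simp [f, hbd]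
      have hfbc : f (.inr s(b, c)) = .inr s(c, d) := by simp only [f]; simp [e3, e4]
      have hfcd : f (.inr s(c, d)) = .inr s(c, d) := by simp only [f]; simp [e1, e2]
      have hfx : ∀ x, x ∉ twinPart a b c d → f x = x := by
        intro x hx
        simp only [twinPart, Set.mem_insert_iff, Set.mem_singleton_iff, not_or] at hx
        simp only [f]
        rw [if_neg (by tauto), if_neg (by tauto)]
      have hf : Conn (crossGraph G R) (f '' B i) := by
        have hone : ∀ x ∈ twinPart a b c d, ∀ y,
            (crossGraph G (avoid R (cycleEdges a b c d))).Adj x y →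
            f x = f y ∨ (crossGraph G R).Adj (f x) (f y) := by
          rintro x (rfl | rfl | rfl | rfl | rfl | rfl) y hxy
          · rcases adj_of_degree_two hb y hxy with rfl | rfl
            · rw [hfb, hfab]; exact .inr hadjCross.symm
            · rw [hfb, hfbc]; exact .inl rfl
          · rcases adj_of_degree_two hd y hxy with rfl | rfl
            · rw [hfd, hfcd]; exact .inr hadjCross
            · rw [hfd, hfda]; exact .inl rfl
          all_goals
            rcases adj_of_mem_cycleEdges (by simp [cycleEdges]) y hxy with rfl | rfl
          · rw [hfab, hfx _ haT]; exact .inr hadjA.symm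
          · rw [hfab, hfb]; exact .inr hadjCross
          · rw [hfbc, hfb]; exact .inl rfl
          · rw [hfbc, hfx _ hcT]; exact .inr hadjC.symm
          · rw [hfcd, hfx _ hcT]; exact .inr hadjC.symm
          · rw [hfcd, hfd]; exact .inr hadjCross.symm
          · rw [hfda, hfd]; exact .inl rfl
          · rw [hfda, hfx _ haT]; exact .inr hadjA.symm
        refine (hB.conn i).image f fun x _ y _ hxy => ?_
        by_cases hx : x ∈ twinPart a b c d
        · exact hone x hx y hxy
        · by_cases hy : y ∈ twinPart a b c d
          · exact (hone y hy x hxy.symm).imp Eq.symm SimpleGraph.Adj.symm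
          · rw [hfx x hx, hfx y hy]
            exact .inr (crossGraph_avoid_le _ hxy)
      have := hf.union (conn_pair hadjCross) (u := .inl c) ⟨_, hci, hfx _ hcT⟩
        (.inr rfl) hadjC
      convert this using 1
      ext x
      simp only [Y, Set.mem_union, Set.mem_sdiff, Set.mem_ofPred_eq, hci, true_and,
        Set.mem_insert_iff, Set.mem_singleton_iff]
      constructor
      · rintro (h | h)
        · exact .inl ⟨x, h.1, hfx x h.2⟩
        · exact .inr h
      · rintro (⟨y, hy, rfl⟩ | h)
        · by_cases hyT : y ∈ twinPart a b c d
          · right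
            rcases hyT with rfl | rfl | rfl | rfl | rfl | rfl
            · rw [hfb]; simp
            · rw [hfd]; simp
            · rw [hfab]; simp
            · rw [hfbc]; simp
            · rw [hfcd]; simp
            · rw [hfda]; simp
          · rw [hfx y hyT]
            exact .inl ⟨hy, hyT⟩
        · exact .inr h
    · have hYi : Y i = B i \ twinPart a b c d := by
        ext x
        simp [Y, hci]
      rw [hYi]
      by_cases hai : .inl a ∈ B i
      · have := (hB.conn i).image (J := crossGraph G R)
          (fun x => if x ∈ twinPart a b c d then .inl a else x) (by
            intro x hx y hy hxy
            by_cases hxT : x ∈ twinPart a b c d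
            · rcases hnbr x hxT y hxy with hyT | rfl | rfl
              · simp [hxT, hyT]
              · simp [hxT]
              · exact (hci hy).elim
            · by_cases hyT : y ∈ twinPart a b c d
              · rcases hnbr y hyT x hxy.symm with hxT | rfl | rfl
                · simp [hxT, hyT]
                · simp [hyT]
                · exact (hci hx).elim
              · simp only [hxT, hyT, if_false]
                exact .inr (crossGraph_avoid_le _ hxy))
        convert this using 1
        ext x
        constructor
        · rintro ⟨hx, hxT⟩
          exact ⟨x, hx, if_neg hxT⟩
        · rintro ⟨y, hy, rfl⟩
          by_cases hyT : y ∈ twinPart a b c d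
          · simp only [hyT, if_true]
            exact ⟨hai, haT⟩
          · simp only [hyT, if_false]
            exact ⟨hy, hyT⟩
      · have : B i \ twinPart a b c d = B i := by
          ext x
          refine ⟨fun h => h.1, fun h => ⟨h, fun hT => ?_⟩⟩
          rcases hends i x hT h with h | h
          exacts [hai h, hci h]
        rw [this]
        exact (hB.conn i).mono (crossGraph_avoid_le _)
  -- the edges `bc` and `da` follow their partners
  let Z : Fin k → Set (V ⊕ Sym2 V) := fun i => {x | ∃ e f, x = .inr e ∧
    (e = s(b, c) ∨ e = s(d, a)) ∧ R f e ∧ .inr f ∈ B i ∧ f ∉ cycleEdges a b c d}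
  have hnoT : ∀ e e', R e e' → (e = s(b, c) ∨ e = s(d, a)) → e' ≠ s(a, b) ∧ e' ≠ s(c, d) := by
    rintro e e' h (rfl | rfl)
    · exact ⟨by rintro rfl; exact hR.disj _ _ h b (by simp) (by simp),
        by rintro rfl; exact hR.disj _ _ h c (by simp) (by simp)⟩
    · exact ⟨by rintro rfl; exact hR.disj _ _ h a (by simp) (by simp),
        by rintro rfl; exact hR.disj _ _ h d (by simp) (by simp)⟩
  have hne : ∀ e, (e = s(b, c) ∨ e = s(d, a)) → e ≠ s(a, b) ∧ e ≠ s(c, d) := by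
    intro e he
    constructor
    · rintro rfl
      exact (hnoT _ _ hcross he).2 rfl
    · rintro rfl
      exact (hnoT _ _ (hR.symm _ _ hcross) he).1 rfl
  have hYmem : ∀ i e, .inr e ∈ Y i ↔ (.inr e ∈ B i ∧ e ∉ cycleEdges a b c d) ∨
      (.inl c ∈ B i ∧ (e = s(a, b) ∨ e = s(c, d))) := by
    intro i e
    simp only [Y, Set.mem_union, Set.mem_sdiff, Set.mem_ofPred_eq, hinr, Sum.inr.injEq]
  have hclosed : ∀ i e e', R e e' → .inr e ∈ Y i ∪ Z i → .inr e' ∈ Y i ∪ Z i := by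
    rintro i e e' h (he | ⟨_, f, he, he', hf, hfi, hfT⟩)
    · rcases (hYmem i e).1 he with ⟨hei, heT⟩ | ⟨hci, rfl | rfl⟩
      · by_cases hT' : e' ∈ cycleEdges a b c d
        · right
          refine ⟨e', e, rfl, ?_, h, hei, heT⟩
          rcases hT' with rfl | rfl | rfl | rfl
          · exact (heT (by rw [hR.unique _ _ _ (hR.symm _ _ h) hcross]; simp [cycleEdges])).elim
          · exact .inl rfl
          · exact (heT (by
              rw [hR.unique _ _ _ (hR.symm _ _ h) (hR.symm _ _ hcross)]; simp [cycleEdges])).elim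
          · exact .inr rfl
        · left
          exact (hYmem i e').2 (.inl ⟨((hcl i) e e' ⟨h, heT, hT'⟩).1 hei, hT'⟩)
      · left
        rw [hR.unique _ _ _ h hcross]
        exact (hYmem _ _).2 (.inr ⟨hci, .inr rfl⟩)
      · left
        rw [hR.unique _ _ _ h (hR.symm _ _ hcross)]
        exact (hYmem _ _).2 (.inr ⟨hci, .inl rfl⟩)
    · cases he
      rw [hR.unique _ _ _ h (hR.symm _ _ hf)]
      exact .inl ((hYmem _ _).2 (.inl ⟨hfi, hfT⟩))
  refine ⟨fun i => Y i ∪ Z i, fun i e e' h => ⟨hclosed i e e' h, hclosed i e' e (hR.symm _ _ h)⟩,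
    ?_, ?_, ?_⟩
  · have hYZ : ∀ i j x, x ∈ Y i → x ∈ Z j → False := by
      rintro i j _ h ⟨e, f, rfl, he, -⟩
      rcases (hYmem i e).1 h with ⟨-, h⟩ | ⟨-, h⟩
      · apply h
        rcases he with rfl | rfl <;> simp [cycleEdges]
      · rcases h with h | h
        exacts [(hne e he).1 h, (hne e he).2 h]
    rintro i j x (hx | hx) (hx' | hx')
    · rcases hx with hx | hx <;> rcases hx' with hx' | hx'
      · exact hB.disj i j x hx.1 hx'.1
      · rcases hx' with ⟨-, rfl | rfl⟩ <;> simp [twinPart] at hx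
      · rcases hx with ⟨-, rfl | rfl⟩ <;> simp [twinPart] at hx'
      · exact hB.disj i j _ hx.1 hx'.1
    · exact (hYZ _ _ _ hx hx').elim
    · exact (hYZ _ _ _ hx' hx).elim
    · obtain ⟨e, f, rfl, -, hf, hfi, -⟩ := hx
      obtain ⟨e', f', he, -, hf', hfi', -⟩ := hx'
      cases he
      rw [hR.unique _ _ _ (hR.symm _ _ hf') (hR.symm _ _ hf)] at hfi'
      exact hB.disj i j _ hfi hfi'
  · intro i
    refine ⟨(hY i).1.mono Set.subset_union_left, ?_⟩
    rintro X hX hXc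
    have hZf : ∀ x ∈ Z i, ∃ y ∈ Y i, (crossGraph G R).Adj x y := by
      rintro _ ⟨e, f, rfl, -, hf, hfi, hfT⟩
      exact ⟨.inr f, (hYmem i f).2 (.inl ⟨hfi, hfT⟩), hR.mem _ _ (hR.symm _ _ hf), hR.mem _ _ hf,
        (hR.ne hf).symm, .inr hf⟩
    have hYX : ∀ y ∈ Y i, y ∈ X := by
      refine (hY i).2 X ?_ fun u hu huX v hv huv => hXc u (.inl hu) huX v (.inl hv) huv
      obtain ⟨u, hu | hu, huX⟩ := hX
      · exact ⟨u, hu, huX⟩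
      · obtain ⟨y, hy, huy⟩ := hZf u hu
        exact ⟨y, hy, hXc u (.inr hu) huX y (.inl hy) huy⟩
    rintro v (hv | hv)
    · exact hYX v hv
    · obtain ⟨y, hy, hvy⟩ := hZf v hv
      exact hXc y (.inl hy) (hYX y hy) v (.inr hv) hvy.symm
  · intro i j hij
    have hfin : .inl a ∈ B i ∨ .inl c ∈ B i → .inl a ∈ B j ∨ .inl c ∈ B j →
        ∃ u ∈ Y i ∪ Z i, ∃ v ∈ Y j ∪ Z j, (crossGraph G R).Adj u v := by
      rintro (hi | hi) (hj | hj)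
      · exact (hij.ne (hB.disj _ _ _ hi hj)).elim
      · exact ⟨.inl a, .inl (.inl ⟨hi, haT⟩), .inr s(a, b), .inl (.inr ⟨hj, .inl rfl⟩), hadjA⟩
      · exact ⟨.inr s(a, b), .inl (.inr ⟨hi, .inl rfl⟩), .inl a, .inl (.inl ⟨hj, haT⟩), hadjA.symm⟩
      · exact (hij.ne (hB.disj _ _ _ hi hj)).elim
    obtain ⟨u, hu, v, hv, huv⟩ := hB.adj i j hij
    have hother : ∀ l x, x ∈ B l → (x ∈ twinPart a b c d ∨ x = .inl a ∨ x = .inl c) →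
        .inl a ∈ B l ∨ .inl c ∈ B l := by
      rintro l x hx (h | rfl | rfl)
      · exact hends l x h hx
      · exact .inl hx
      · exact .inr hx
    by_cases huT : u ∈ twinPart a b c d
    · exact hfin (hends i u huT hu) (hother j v hv (hnbr u huT v huv))
    · by_cases hvT : v ∈ twinPart a b c d
      · exact hfin (hother i u hu (hnbr v hvT u huv.symm)) (hends j v hvT hv)
      · exact ⟨u, .inl (.inl ⟨hu, huT⟩), v, .inl (.inl ⟨hv, hvT⟩), crossGraph_avoid_le _ huv⟩

end Twins

end Reduction

end OnePlanarity

namespace OnePlanarity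

section Flags

variable {V : Type}

/-- A set in which every vertex is joined to a centre by a connected subset is connected. -/
lemma conn_of_center {W : Type*} {G : SimpleGraph W} {A : Set W} {z : W} (hz : z ∈ A)
    (h : ∀ v ∈ A, ∃ B ⊆ A, Conn G B ∧ z ∈ B ∧ v ∈ B) : Conn G A := by
  refine ⟨⟨z, hz⟩, ?_⟩
  rintro X ⟨u, hu, huX⟩ hX
  have hsub : ∀ B ⊆ A, Conn G B → (∃ x ∈ B, x ∈ X) → ∀ x ∈ B, x ∈ X := fun B hBA hB hx =>
    hB.2 X hx fun u hu hux v hv huv => hX u (hBA hu) hux v (hBA hv) huv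
  obtain ⟨B, hBA, hB, hzB, huB⟩ := h u hu
  have hzX := hsub B hBA hB ⟨u, huB, huX⟩ z hzB
  intro v hv
  obtain ⟨B, hBA, hB, hzB, hvB⟩ := h v hv
  exact hsub B hBA hB ⟨z, hzB, hzX⟩ v hvB

/-- The vertices outside `{a, c}` that are not degree-two vertices of `Ws` attached to `{a, c}`. -/
def coreSet (G : SimpleGraph V) (Ws : Set V) (a c : V) : Set V :=
  {v | v ≠ a ∧ v ≠ c ∧ ¬ (v ∈ Ws ∧ ∀ x, G.Adj v x → x = a ∨ x = c)}

lemma conn_coreSet {G : SimpleGraph V} {Ws : Set V}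
    (hind : ∀ w ∈ Ws, ∀ u ∈ Ws, ¬ G.Adj w u) (hconn : KConnected 3 (suppress G Ws)) {a c : V}
    (ha : a ∉ Ws) (hc : c ∉ Ws) : Conn G (coreSet G Ws a c) := by
  let T : Set {v : V // v ∉ Ws} := {⟨a, ha⟩, ⟨c, hc⟩}
  have hT : Conn (suppress G Ws) Tᶜ := by
    refine conn_iff_induce.2 (hconn.2 T ?_)
    have := Set.ncard_insert_le (⟨a, ha⟩ : {v : V // v ∉ Ws}) {⟨c, hc⟩}
    rw [Set.ncard_singleton] at this
    exact Nat.lt_succ_of_le this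
  have hTmem : ∀ v : {v : V // v ∉ Ws}, v ∈ Tᶜ ↔ v.1 ≠ a ∧ v.1 ≠ c := by
    intro v
    simp [T, Subtype.ext_iff]
  let F : {v : V // v ∉ Ws} → Set V := fun v =>
    {x | x = v.1 ∨ (x ∈ Ws ∧ G.Adj v.1 x)}
  have hF : ∀ v ∈ Tᶜ, Conn G (F v) := by
    intro v _
    refine conn_of_center (z := v.1) (.inl rfl) ?_
    rintro x (rfl | ⟨hx, hvx⟩)
    · exact ⟨{v.1}, by simp [F], conn_singleton _ _, rfl, rfl⟩
    · refine ⟨{v.1, x}, ?_, conn_pair hvx, .inl rfl, .inr rfl⟩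
      rintro y (rfl | rfl)
      exacts [.inl rfl, .inr ⟨hx, hvx⟩]
  have := conn_biUnion hT F hF (by
    intro v _ v' _ h
    have key : ∀ v v' : {v : V // v ∉ Ws}, (G.Adj v.1 v'.1 ∨ ∃ w ∈ Ws, G.Adj w v.1 ∧ G.Adj w v'.1) →
        ∃ x ∈ F v, ∃ y ∈ F v', G.Adj x y := by
      rintro v v' (h | ⟨w, hw, hv, hv'⟩)
      · exact ⟨_, .inl rfl, _, .inl rfl, h⟩
      · exact ⟨w, .inr ⟨hw, hv.symm⟩, _, .inl rfl, hv'⟩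
    rcases ((SimpleGraph.fromRel_adj _ _ _).1 h).2 with h | h
    · exact key v v' h
    · obtain ⟨x, hx, y, hy, hxy⟩ := key v' v h
      exact ⟨y, hy, x, hx, hxy.symm⟩)
  convert this using 1
  ext x
  simp only [Set.mem_iUnion₂, coreSet, Set.mem_ofPred_eq]
  constructor
  · rintro ⟨hxa, hxc, hx⟩
    by_cases hxW : x ∈ Ws
    · have : ∃ y, G.Adj x y ∧ y ≠ a ∧ y ≠ c := by
        by_contra! hcon
        refine hx ⟨hxW, fun y hy => ?_⟩
        by_cases hya : y = a
        · exact .inl hya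
        · exact .inr (hcon y hy hya)
      obtain ⟨y, hxy, hya, hyc⟩ := this
      exact ⟨⟨y, fun hy => hind x hxW y hy hxy⟩, (hTmem _).2 ⟨hya, hyc⟩, .inr ⟨hxW, hxy.symm⟩⟩
    · exact ⟨⟨x, hxW⟩, (hTmem _).2 ⟨hxa, hxc⟩, .inl rfl⟩
  · rintro ⟨v, hv, rfl | ⟨hx, hvx⟩⟩
    · exact ⟨((hTmem _).1 hv).1, ((hTmem _).1 hv).2, fun h => v.2 h.1⟩
    · refine ⟨fun h => ha (h ▸ hx), fun h => hc (h ▸ hx), fun h => ?_⟩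
      rcases h.2 _ hvx.symm with h | h
      exacts [((hTmem _).1 hv).1 h, ((hTmem _).1 hv).2 h]

/-- Three crossing pairs of 4-cycles sharing a diagonal give a closed model of `K₃,₃`. -/
lemma not_three_pairs {G : SimpleGraph V} {R : Sym2 V → Sym2 V → Prop} (hR : IsPairing G R)
    (hfree : ClosedFree G R) (hG : InternallyThreeConnected G)
    (htwin : ∀ a b c d, IsFourCycle G a b c d → R s(a, b) s(c, d) →
      (∀ x, G.Adj b x → x = a ∨ x = c) → (∀ x, G.Adj d x → x = c ∨ x = a) → False)
    {a c : V} {b d : Fin 3 → V} (hb : Function.Injective b)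
    (hc4 : ∀ k, IsFourCycle G a (b k) c (d k)) (hRk : ∀ k, R s(a, b k) s(c, d k)) : False := by
  obtain ⟨Ws, hdeg, hind, hconn⟩ := hG
  have hac : a ≠ c := by
    rintro rfl
    exact hR.disj _ _ (hRk 0) a (by simp) (by simp)
  have hd : Function.Injective d := by
    intro k l h
    have := hR.unique _ _ _ (hR.symm _ _ (hRk k)) (h ▸ hR.symm _ _ (hRk l))
    exact hb (Sym2.congr_right.1 this)
  have hW : ∀ (v : V) (f : Fin 3 → V), Function.Injective f → (∀ k, G.Adj v (f k)) → v ∉ Ws := by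
    intro v f hf hadj hv
    obtain ⟨x, y, -, hxy⟩ := hdeg v hv
    have h : ∀ k, f k = x ∨ f k = y := by
      intro k
      have : f k ∈ G.neighborSet v := hadj k
      rw [hxy] at this
      exact this
    have h01 : f 0 ≠ f 1 := fun h => by simpa using hf h
    have h02 : f 0 ≠ f 2 := fun h => by simpa using hf h
    have h12 : f 1 ≠ f 2 := fun h => by simpa using hf h
    have h0 := h 0
    have h1 := h 1
    have h2 := h 2
    grind
  have hcore := conn_coreSet hind hconn (hW a b hb fun k => (hc4 k).ab)
    (hW c d hd fun k => (hc4 k).cd)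
  set C := coreSet G Ws a c with hC
  let P : Set (Sym2 V) := {e | ∃ k, e = s(a, b k) ∨ e = s(c, d k)}
  have hPR : ∀ e e', R e e' → e ∈ P → e' ∈ P := by
    rintro e e' h ⟨k, rfl | rfl⟩
    · exact ⟨k, .inr (hR.unique _ _ _ h (hRk k))⟩
    · exact ⟨k, .inl (hR.unique _ _ _ h (hR.symm _ _ (hRk k)))⟩
  have hcross : ∀ k l, s(a, b k) ≠ s(c, d l) := by
    intro k l h
    rw [Sym2.eq_iff] at h
    rcases h with h | h
    · exact hac h.1
    · exact (hc4 l).da.ne h.1.symm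
  let F : V → Set (V ⊕ Sym2 V) := fun u => {x | x = .inl u ∨
    ∃ e, x = .inr e ∧ ∃ f ∈ G.edgeSet, u ∈ f ∧ f ∉ P ∧ (e = f ∨ R f e)}
  have hF : ∀ u ∈ C, Conn (crossGraph G R) (F u) := by
    intro u _
    refine conn_of_center (z := .inl u) (.inl rfl) ?_
    rintro x (rfl | ⟨e, rfl, f, hf, huf, hfP, h⟩)
    · exact ⟨{.inl u}, by simp [F], conn_singleton _ _, rfl, rfl⟩
    · have h1 : (crossGraph G R).Adj (.inl u) (.inr f) := ⟨hf, huf⟩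
      have h2 : .inr f ∈ F u := .inr ⟨f, rfl, f, hf, huf, hfP, .inl rfl⟩
      rcases h with rfl | h
      · refine ⟨{.inl u, .inr e}, ?_, conn_pair h1, .inl rfl, .inr rfl⟩
        rintro y (rfl | rfl)
        exacts [.inl rfl, h2]
      · refine ⟨insert (.inr e) {.inl u, .inr f}, ?_, (conn_pair h1).insert (u := .inr f) (v :=
          .inr e) (.inr rfl)
          ⟨hf, hR.mem _ _ (hR.symm _ _ h), hR.ne h, .inl h⟩, .inr (.inl rfl), .inl rfl⟩
        rintro y (rfl | rfl | rfl)
        exacts [.inr ⟨e, rfl, f, hf, huf, hfP, .inr h⟩, .inl rfl, h2]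
  have hX := conn_biUnion hcore F hF (by
    intro u hu v hv huv
    refine ⟨.inr s(u, v), .inr ⟨_, rfl, s(u, v), huv, by simp, ?_, .inl rfl⟩, .inl v, .inl rfl,
      huv, by simp⟩
    rintro ⟨k, h | h⟩
    · have ha : a ∈ s(u, v) := h ▸ Sym2.mem_mk_left _ _
      rcases Sym2.mem_iff.1 ha with h | h
      exacts [hu.1 h.symm, hv.1 h.symm]
    · have ha : c ∈ s(u, v) := h ▸ Sym2.mem_mk_left _ _
      rcases Sym2.mem_iff.1 ha with h | h
      exacts [hu.2.1 h.symm, hv.2.1 h.symm])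
  set X := ⋃ u ∈ C, F u with hXdef
  have hXinl : ∀ u, .inl u ∈ X ↔ u ∈ C := by
    intro u
    simp [X, F]
  have hXP : ∀ e, .inr e ∈ X → e ∉ P := by
    intro e he heP
    obtain ⟨u, -, h | ⟨_, h, f, hf, huf, hfP, h'⟩⟩ := Set.mem_iUnion₂.1 he
    · cases h
    · cases h
      rcases h' with rfl | h'
      exacts [hfP heP, hfP (hPR _ _ (hR.symm _ _ h') heP)]
  have hXR : ∀ e e', R e e' → .inr e ∈ X → .inr e' ∈ X := by
    intro e e' h he
    obtain ⟨u, hu, h' | ⟨_, h', f, hf, huf, hfP, h''⟩⟩ := Set.mem_iUnion₂.1 he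
    · cases h'
    · cases h'
      refine Set.mem_iUnion₂.2 ⟨u, hu, .inr ⟨e', rfl, f, hf, huf, hfP, ?_⟩⟩
      rcases h'' with rfl | h''
      · exact .inr h
      · exact .inl (hR.unique _ _ _ h (hR.symm _ _ h''))
  let B : Fin 6 → Set (V ⊕ Sym2 V) := ![{.inl a}, {.inl c}, X,
    {.inr s(a, b 0), .inr s(c, d 0)}, {.inr s(a, b 1), .inr s(c, d 1)},
    {.inr s(a, b 2), .inr s(c, d 2)}]
  have hB : ∀ k : Fin 3, B (k.natAdd 3) = {.inr s(a, b k), .inr s(c, d k)} := by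
    intro k
    fin_cases k <;> rfl
  have hsplit : ∀ i : Fin 6, i = 0 ∨ i = 1 ∨ i = 2 ∨ ∃ k : Fin 3, i = k.natAdd 3 := by
    decide
  have hBP : ∀ k : Fin 3, ∀ x ∈ B (k.natAdd 3), ∃ e ∈ P, x = .inr e := by
    intro k x hx
    rw [hB] at hx
    rcases hx with rfl | rfl
    exacts [⟨_, ⟨k, .inl rfl⟩, rfl⟩, ⟨_, ⟨k, .inr rfl⟩, rfl⟩]
  refine hfree.2 B ?_ ⟨?_, ?_, ?_⟩
  · intro i e e' h
    have key : ∀ e e', R e e' → .inr e ∈ B i → .inr e' ∈ B i := by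
      intro e e' h he
      rcases hsplit i with rfl | rfl | rfl | ⟨k, rfl⟩
      · cases he
      · cases he
      · exact hXR e e' h he
      · rw [hB] at he ⊢
        rcases he with he | he
        · cases he
          exact .inr (congrArg _ (hR.unique _ _ _ h (hRk k)))
        · cases he
          exact .inl (congrArg _ (hR.unique _ _ _ h (hR.symm _ _ (hRk k))))
    exact ⟨key e e' h, key e' e (hR.symm _ _ h)⟩
  · have hne : ∀ i j : Fin 6, i < j → ∀ x, x ∈ B i → x ∉ B j := by
      intro i j hij x hx hx'
      rcases hsplit j with rfl | rfl | rfl | ⟨l, rfl⟩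
      · exact (Fin.not_lt_zero _ hij).elim
      · obtain rfl : i = 0 := by omega
        cases hx
        cases hx'
        exact hac rfl
      · obtain rfl | rfl : i = 0 ∨ i = 1 := by omega
        · cases hx
          exact ((hXinl a).1 hx').1 rfl
        · cases hx
          exact ((hXinl c).1 hx').2.1 rfl
      · rcases hsplit i with rfl | rfl | rfl | ⟨k, rfl⟩
        · obtain ⟨e, -, rfl⟩ := hBP l x hx'
          cases hx
        · obtain ⟨e, -, rfl⟩ := hBP l x hx'
          cases hx
        · obtain ⟨e, he, rfl⟩ := hBP l x hx'
          exact hXP e hx he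
        · have hkl : k ≠ l := by
            rintro rfl
            exact lt_irrefl _ hij
          rw [hB] at hx hx'
          rcases hx with rfl | rfl <;> rcases hx' with h | h
          · exact hkl (hb (Sym2.congr_right.1 (Sum.inr_injective h)))
          · exact hcross _ _ (Sum.inr_injective h)
          · exact hcross _ _ (Sum.inr_injective h).symm
          · exact hkl (hd (Sym2.congr_right.1 (Sum.inr_injective h)))
    intro i j x hi hj
    rcases lt_trichotomy i j with h | h | h
    exacts [(hne i j h x hi hj).elim, h, (hne j i h x hj hi).elim]
  · intro i
    rcases hsplit i with rfl | rfl | rfl | ⟨k, rfl⟩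
    · exact conn_singleton _ _
    · exact conn_singleton _ _
    · exact hX
    · rw [hB]
      exact conn_pair ⟨(hc4 k).ab, (hc4 k).cd, hR.ne (hRk k), .inl (hRk k)⟩
  · have key : ∀ (i : Fin 6) (k : Fin 3), i < 3 → ∃ u ∈ B i, ∃ v ∈ B (k.natAdd 3),
      (crossGraph G R).Adj u v := by
      intro i k hi
      rw [hB]
      obtain rfl | rfl | rfl : i = 0 ∨ i = 1 ∨ i = 2 := by omega
      · exact ⟨_, rfl, _, .inl rfl, (hc4 k).ab, by simp⟩
      · exact ⟨_, rfl, _, .inr rfl, (hc4 k).cd, by simp⟩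
      · by_cases hbk : b k ∈ C
        · exact ⟨.inl (b k), (hXinl _).2 hbk, _, .inl rfl, (hc4 k).ab, by simp⟩
        · by_cases hdk : d k ∈ C
          · exact ⟨.inl (d k), (hXinl _).2 hdk, _, .inr rfl, (hc4 k).cd, by simp⟩
          · exfalso
            have hbk' : b k ∈ Ws ∧ ∀ x, G.Adj (b k) x → x = a ∨ x = c := by
              by_contra h
              exact hbk ⟨(hc4 k).ab.ne.symm, (hc4 k).bc.ne, h⟩
            have hdk' : d k ∈ Ws ∧ ∀ x, G.Adj (d k) x → x = a ∨ x = c := by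
              by_contra h
              exact hdk ⟨(hc4 k).da.ne, (hc4 k).cd.ne.symm, h⟩
            exact htwin _ _ _ _ (hc4 k) (hRk k) hbk'.2 fun x hx => (hdk'.2 x hx).symm
    rintro i j (⟨hi, hj⟩ | ⟨hj, hi⟩)
    · rcases hsplit j with rfl | rfl | rfl | ⟨k, rfl⟩
      · omega
      · omega
      · omega
      · exact key i k hi
    · rcases hsplit i with rfl | rfl | rfl | ⟨k, rfl⟩
      · omega
      · omega
      · omega
      · obtain ⟨u, hu, v, hv, huv⟩ := key j k hj
        exact ⟨v, hv, u, hu, huv.symm⟩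

/-- The edges `e` and `e'` are opposite edges of a 4-cycle of `G` with diagonal `g`. -/
def Tied (G : SimpleGraph V) (e e' g : Sym2 V) : Prop :=
  ∃ a b c d, IsFourCycle G a b c d ∧ e = s(a, b) ∧ e' = s(c, d) ∧ g = s(a, c)

lemma Tied.symm {G : SimpleGraph V} {e e' g : Sym2 V} (h : Tied G e e' g) : Tied G e' e g := by
  obtain ⟨a, b, c, d, h, rfl, rfl, rfl⟩ := h
  exact ⟨c, d, a, b, h.rotate, rfl, rfl, Sym2.eq_swap⟩

lemma exists_chord {G : SimpleGraph V} (hG : IsChordal G) {a b c d : V}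
    (h : IsFourCycle G a b c d) (hac : a ≠ c) (hbd : b ≠ d) : G.Adj a c ∨ G.Adj b d := by
  let w : G.Walk a a := .cons h.ab (.cons h.bc (.cons h.cd (.cons h.da .nil)))
  have hab := h.ab.ne
  have hbc := h.bc.ne
  have hcd := h.cd.ne
  have hda := h.da.ne
  obtain ⟨x, y, hx, hy, hxy, hw⟩ := hG a w (by
    rw [SimpleGraph.Walk.cons_isCycle_iff]
    constructor
    · simp [SimpleGraph.Walk.isPath_def, hbc, hbd, hab.symm, hcd, hac.symm, hda]
    · simp [hab, hac, hbd, hbc, hab.symm, hda.symm]) (by simp [w])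
  have hne := hxy.ne
  simp only [w, SimpleGraph.Walk.support_cons, SimpleGraph.Walk.support_nil, List.mem_cons,
    List.not_mem_nil, or_false] at hx hy
  simp only [w, SimpleGraph.Walk.edges_cons, SimpleGraph.Walk.edges_nil, List.mem_cons,
    List.not_mem_nil, or_false, not_or] at hw
  rcases hx with rfl | rfl | rfl | rfl | rfl <;> rcases hy with rfl | rfl | rfl | rfl | rfl
  all_goals first
    | exact .inl hxy
    | exact .inl hxy.symm
    | exact .inr hxy
    | exact .inr hxy.symm
    | exact (hne rfl).elim
    | exact (hw.1 rfl).elim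
    | exact (hw.1 Sym2.eq_swap).elim
    | exact (hw.2.1 rfl).elim
    | exact (hw.2.1 Sym2.eq_swap).elim
    | exact (hw.2.2.1 rfl).elim
    | exact (hw.2.2.1 Sym2.eq_swap).elim
    | exact (hw.2.2.2 rfl).elim
    | exact (hw.2.2.2 Sym2.eq_swap).elim

lemma IsGood.exists_fourCycle {G : SimpleGraph V} {S : Set CrossingType} (hS : S ⊆ goodTypes)
    {R : Sym2 V → Sym2 V → Prop} (hR : IsGood G S R) {e e' : Sym2 V} (h : R e e') :
    ∃ a b c d, e = s(a, b) ∧ e' = s(c, d) ∧ IsFourCycle G a b c d := by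
  induction e with | _ a b
  induction e' with | _ c d
  have hab : G.Adj a b := hR.mem _ _ h
  have hcd : G.Adj c d := hR.mem _ _ (hR.symm _ _ h)
  obtain ⟨t, ht, htype⟩ := hR.type _ _ _ _ h
  have : (G.Adj b c ∧ G.Adj d a) ∨ (G.Adj b d ∧ G.Adj c a) := by
    rcases hS ht with rfl | rfl | rfl
    · exact .inl ⟨htype.2.2.1, htype.2.1.symm⟩
    · rcases htype with ⟨h1, h2, h3, h4⟩ | ⟨h1, h2, h3, h4⟩ | ⟨h1, h2, h3, h4⟩ | ⟨h1, h2, h3, h4⟩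
      · exact .inl ⟨h3, h2.symm⟩
      · exact .inr ⟨h4, h1.symm⟩
      · exact .inr ⟨h4, h1.symm⟩
      · exact .inl ⟨h3, h2.symm⟩
    · rcases htype with ⟨h1, h2, -⟩ | ⟨h1, h2, -⟩
      · exact .inr ⟨h2, h1.symm⟩
      · exact .inl ⟨h2, h1.symm⟩
  rcases this with h | h
  · exact ⟨a, b, c, d, rfl, rfl, hab, h.1, hcd, h.2⟩
  · exact ⟨a, b, d, c, rfl, Sym2.eq_swap, hab, h.1, hcd.symm, h.2⟩

lemma IsGood.exists_tied {G Ghat : SimpleGraph V} {S : Set CrossingType} (hS : S ⊆ goodTypes)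
    (hle : G ≤ Ghat) (hchordal : IsChordal Ghat) {R : Sym2 V → Sym2 V → Prop} (hR : IsGood G S R)
    {e e' : Sym2 V} (h : R e e') : ∃ g ∈ Ghat.edgeSet, Tied G e e' g := by
  obtain ⟨a, b, c, d, rfl, rfl, hc⟩ := hR.exists_fourCycle hS h
  have hdisj := hR.disj _ _ h
  have hac : a ≠ c := fun h' => hdisj a (by simp) (by simp [h'])
  have hbd : b ≠ d := fun h' => hdisj b (by simp) (by simp [h'])
  rcases exists_chord hchordal ⟨hle hc.ab, hle hc.bc, hle hc.cd, hle hc.da⟩ hac hbd with h | h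
  · exact ⟨s(a, c), h, a, b, c, d, hc, rfl, rfl, rfl⟩
  · exact ⟨s(b, d), h, b, a, d, c, ⟨hc.ab.symm, hc.da.symm, hc.cd.symm, hc.bc.symm⟩,
      Sym2.eq_swap, Sym2.eq_swap, rfl⟩

lemma IsGood.validCTP {G Ghat : SimpleGraph V} {S : Set CrossingType}
    {R : Sym2 V → Sym2 V → Prop} (hR : IsGood G S R) {a b c d : V} (hc : IsFourCycle G a b c d)
    (h : R s(a, b) s(c, d)) (hg : Ghat.Adj a c) :
    ValidCTP G Ghat S ((a, b, c, d), s(a, c)) := by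
  have hdisj := hR.disj _ _ h
  have hac : a ≠ c := fun h' => hdisj a (by simp) (by simp [h'])
  have hab := hc.ab.ne
  have hbc := hc.bc.ne
  have hcd := hc.cd.ne
  have hda := hc.da.ne
  refine ⟨hc.ab, hc.bc, hc.cd, hc.da, hR.type _ _ _ _ h, hg, ?_, ?_⟩
  · intro x hx
    rcases Sym2.mem_iff.1 hx with rfl | rfl <;> simp
  · simp only [Set.mem_insert_iff, Set.mem_singleton_iff, Sym2.eq_iff, not_or]
    grind

lemma IsGood.avoid {G : SimpleGraph V} {S : Set CrossingType} {R : Sym2 V → Sym2 V → Prop}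
    (hR : IsGood G S R) (T : Set (Sym2 V)) : IsGood G S (avoid R T) :=
  ⟨⟨fun e e' h => hR.mem e e' h.1, fun e e' h => ⟨hR.symm e e' h.1, h.2.2, h.2.1⟩,
    fun e e₁ e₂ h h' => hR.unique e e₁ e₂ h.1 h'.1, fun e e' h => hR.disj e e' h.1⟩,
    fun a b c d h => hR.type a b c d h.1⟩

/-- The edges `e, e'` are crossing edges of chord-tied pairs with a common chord in one of the sets
`D i`. -/
def FlagPair (D : Bool → Set (CTPData V)) (e e' : Sym2 V) : Prop :=
  e ≠ e' ∧ ∃ i, ∃ p ∈ D i, ∃ q ∈ D i, crEdgeOf p = e ∧ crEdgeOf q = e' ∧ p.2 = q.2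

/-- No three crossing pairs are tied to the same chord. -/
lemma not_three_tied {G : SimpleGraph V} {R : Sym2 V → Sym2 V → Prop} (hR : IsPairing G R)
    (hfree : ClosedFree G R) (hG : InternallyThreeConnected G)
    (htwin : ∀ a b c d, IsFourCycle G a b c d → R s(a, b) s(c, d) →
      (∀ x, G.Adj b x → x = a ∨ x = c) → (∀ x, G.Adj d x → x = c ∨ x = a) → False)
    {g : Sym2 V} {E E' : Fin 3 → Sym2 V} (hE : ∀ k, R (E k) (E' k)) (ht : ∀ k,
        Tied G (E k) (E' k) g)
    (hne : ∀ k l, k ≠ l → E k ≠ E l ∧ E k ≠ E' l) : False := by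
  obtain ⟨a, -, c, -, -, -, -, rfl⟩ := ht 0
  have key : ∀ k, ∃ b d, IsFourCycle G a b c d ∧ R s(a, b) s(c, d) ∧
      (E k = s(a, b) ∨ E' k = s(a, b)) := by
    intro k
    obtain ⟨x, b, y, d, hc, h1, h2, h3⟩ := ht k
    have hRk := hE k
    rw [h1, h2] at hRk
    rcases Sym2.eq_iff.1 h3 with ⟨rfl, rfl⟩ | ⟨rfl, rfl⟩
    · exact ⟨b, d, hc, hRk, .inl h1⟩
    · exact ⟨d, b, hc.rotate, hR.symm _ _ hRk, .inr h2⟩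
  choose b d hc hRk hEk using key
  refine not_three_pairs hR hfree hG htwin (a := a) (c := c) (b := b) (d := d) ?_ hc hRk
  intro k l h
  by_contra hkl
  have h1 := hEk k
  have h2 := hEk l
  rw [h] at h1
  rcases h1 with h1 | h1 <;> rcases h2 with h2 | h2
  · exact (hne k l hkl).1 (h1.trans h2.symm)
  · exact (hne k l hkl).2 (h1.trans h2.symm)
  · exact (hne l k (Ne.symm hkl)).2 (h2.trans h1.symm)
  · refine (hne k l hkl).1 (hR.unique _ _ _ (hR.symm _ _ (hE k)) ?_)
    rw [h1, ← h2]
    exact hR.symm _ _ (hE l)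

/-- If no three crossing pairs are tied to the same chord, two flags distinguish them. -/
lemma exists_flags {G Ghat : SimpleGraph V} {S : Set CrossingType} {R : Sym2 V → Sym2 V → Prop}
    (hR : IsGood G S R) (htied : ∀ e e', R e e' → ∃ g ∈ Ghat.edgeSet, Tied G e e' g)
    (hthree : ∀ (g : Sym2 V) (E E' : Fin 3 → Sym2 V), (∀ k, R (E k) (E' k)) →
      (∀ k, Tied G (E k) (E' k) g) → ¬ ∀ k l, k ≠ l → E k ≠ E l ∧ E k ≠ E' l) :
    ∃ D : Bool → Set (CTPData V), (∀ i, ∀ q ∈ D i, ValidCTP G Ghat S q) ∧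
      ∀ e e', R e e' ↔ FlagPair D e e' := by
  classical
  have hch : ∀ P : Sym2 (Sym2 V), ∃ g, ∀ e e', P = s(e, e') → R e e' →
      g ∈ Ghat.edgeSet ∧ Tied G e e' g := by
    intro P
    induction P with | _ e e'
    by_cases h : R e e'
    · obtain ⟨g, hg, ht⟩ := htied e e' h
      refine ⟨g, fun f f' hf _ => ?_⟩
      rcases Sym2.eq_iff.1 hf with ⟨rfl, rfl⟩ | ⟨rfl, rfl⟩
      exacts [⟨hg, ht⟩, ⟨hg, ht.symm⟩]
    · refine ⟨e, fun f f' hf hff => ?_⟩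
      rcases Sym2.eq_iff.1 hf with ⟨rfl, rfl⟩ | ⟨rfl, rfl⟩
      exacts [(h hff).elim, (h (hR.symm _ _ hff)).elim]
  choose chord hchord using hch
  have hpick : ∀ g : Sym2 V, ∃ f : Sym2 V, ∀ e e', R e e' → chord s(e, e') = g →
      ∃ f', R f f' ∧ chord s(f, f') = g := by
    intro g
    by_cases h : ∃ e e', R e e' ∧ chord s(e, e') = g
    · obtain ⟨e, e', h1, h2⟩ := h
      exact ⟨e, fun _ _ _ _ => ⟨e', h1, h2⟩⟩
    · exact ⟨g, fun e e' h1 h2 => (h ⟨e, e', h1, h2⟩).elim⟩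
  choose pick hpick using hpick
  let col : Sym2 V → Sym2 V → Bool := fun e g => decide (e = pick g ∨ R e (pick g))
  have hcol : ∀ e e' f f', R e e' → R f f' → chord s(e, e') = chord s(f, f') →
      col e (chord s(e, e')) = col f (chord s(e, e')) → e ≠ f → R e f := by
    intro e e' f f' he hf hg hc hne
    by_contra hef
    obtain ⟨p', hp, hpg⟩ := hpick _ e e' he rfl
    have te := (hchord _ e e' rfl he).2
    have tf := (hchord _ f f' rfl hf).2
    have tp := (hchord _ _ p' rfl hp).2
    rw [← hg] at tf
    rw [hpg] at tp
    clear hg hpg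
    generalize chord s(e, e') = g at *
    set p := pick g
    simp only [col, decide_eq_decide] at hc
    by_cases h : e = p ∨ R e p
    · have h' := hc.1 h
      rcases h with h | h <;> rcases h' with h' | h'
      · exact hne (h.trans h'.symm)
      · exact hef (h ▸ hR.symm _ _ h')
      · exact hef (h' ▸ h)
      · exact hne (hR.unique _ _ _ (hR.symm _ _ h) (hR.symm _ _ h'))
    · have h' : ¬(f = p ∨ R f p) := fun hh => h (hc.2 hh)
      rw [not_or] at h h'
      have hpp : ∀ x x', R x x' → x ≠ p → ¬ R x p → x ≠ p ∧ x ≠ p' ∧ p ≠ x ∧ p ≠ x' := by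
        intro x x' hx h1 h2
        refine ⟨h1, ?_, h1.symm, ?_⟩
        · rintro rfl
          exact h2 (hR.symm _ _ hp)
        · rintro rfl
          exact h2 hx
      have hep := hpp e e' he h.1 h.2
      have hfp := hpp f f' hf h'.1 h'.2
      have hef' : e ≠ f' := by
        rintro rfl
        exact hef (hR.symm _ _ hf)
      have hfe' : f ≠ e' := by
        rintro rfl
        exact hef he
      refine hthree g ![e, f, p] ![e', f', p'] ?_ ?_ ?_
      · intro k
        fin_cases k
        exacts [he, hf, hp]
      · intro k
        fin_cases k
        exacts [te, tf, tp]
      · intro k l hkl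
        fin_cases k <;> fin_cases l
        all_goals first
          | exact (hkl rfl).elim
          | exact ⟨hne, hef'⟩
          | exact ⟨hne.symm, hfe'⟩
          | exact ⟨hep.1, hep.2.1⟩
          | exact ⟨hep.2.2.1, hep.2.2.2⟩
          | exact ⟨hfp.1, hfp.2.1⟩
          | exact ⟨hfp.2.2.1, hfp.2.2.2⟩
  refine ⟨fun i => {q | ValidCTP G Ghat S q ∧ ∃ e', R (crEdgeOf q) e' ∧
    chord s(crEdgeOf q, e') = q.2 ∧ col (crEdgeOf q) q.2 = i}, fun i q hq => hq.1, ?_⟩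
  intro e e'
  constructor
  · intro h
    have hc : col e' (chord s(e, e')) = col e (chord s(e, e')) := by
      simp only [col, decide_eq_decide]
      generalize pick (chord s(e, e')) = p
      constructor
      · rintro (rfl | h')
        exacts [.inr h, .inl (hR.unique _ _ _ (hR.symm _ _ h) h')]
      · rintro (rfl | h')
        exacts [.inr (hR.symm _ _ h), .inl (hR.unique _ _ _ h h')]
    have hsw : chord s(e', e) = chord s(e, e') := by rw [Sym2.eq_swap]
    obtain ⟨hg, a, b, c, d, hcyc, rfl, rfl, ht⟩ := hchord _ e e' rfl h
    rw [ht] at hg hc hsw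
    have hv := hR.validCTP hcyc h hg
    have hv' := hR.validCTP hcyc.rotate (hR.symm _ _ h) (show Ghat.Adj a c from hg).symm
    rw [Sym2.eq_swap] at hv'
    exact ⟨hR.ne h, _, ((a, b, c, d), s(a, c)), ⟨hv, _, h, ht, rfl⟩, ((c, d, a, b), s(a, c)),
      ⟨hv', _, hR.symm _ _ h, hsw, hc⟩, rfl, rfl, rfl⟩
  · rintro ⟨hne, i, p, ⟨-, f, hf, hpf, hpc⟩, q, ⟨-, f', hf', hqf, hqc⟩, rfl, rfl, hpq⟩
    refine hcol _ f _ f' hf hf' ?_ ?_ hne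
    · rw [hpf, hqf, hpq]
    · rw [hpf, hpc, ← hqc, hpq]

/-- An `S`-restricted internally 3-connected graph has a crossing pattern encoded by two sets of
chord-tied pairs. -/
theorem exists_flagPair [Finite V] {G Ghat : SimpleGraph V} {S : Set CrossingType}
    (hS : S ⊆ goodTypes) (hG : InternallyThreeConnected G) (hle : G ≤ Ghat)
    (hchordal : IsChordal Ghat) (hres : SRestricted G S) :
    ∃ D : Bool → Set (CTPData V), (∀ i, ∀ q ∈ D i, ValidCTP G Ghat S q) ∧
      IsGood G S (FlagPair D) ∧ ClosedFree G (FlagPair D) := by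
  obtain ⟨R, ⟨hR, hfree⟩, hmin⟩ := exists_minimal_of_wellFoundedLT _ (sRestricted_iff.1 hres)
  have htwin : ∀ a b c d, IsFourCycle G a b c d → R s(a, b) s(c, d) →
      (∀ x, G.Adj b x → x = a ∨ x = c) → (∀ x, G.Adj d x → x = c ∨ x = a) → False := by
    intro a b c d hc h hb hd
    have := hmin ⟨hR.avoid _, hfree.avoid_twins hR.toIsPairing hc h hb hd⟩ (fun _ _ h => h.1) _ _ h
    exact this.2.1 (.inl rfl)
  obtain ⟨D, hD, hRD⟩ := exists_flags hR (fun e e' h => hR.exists_tied hS hle hchordal h)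
    fun g E E' hE ht hne => not_three_tied hR.toIsPairing hfree hG htwin hE ht hne
  obtain rfl : R = FlagPair D := by
    ext e e'
    exact hRD e e'
  exact ⟨D, hD, hR, hfree⟩

end Flags

end OnePlanarity

namespace OnePlanarity

section Formulas

namespace MSOFormula

variable {L : Type}

def or (φ ψ : MSOFormula L) : MSOFormula L := .not (.and (.not φ) (.not ψ))

def imp (φ ψ : MSOFormula L) : MSOFormula L := .not (.and φ (.not ψ))

def iff (φ ψ : MSOFormula L) : MSOFormula L := .and (.imp φ ψ) (.imp ψ φ)

def allV (x : ℕ) (φ : MSOFormula L) : MSOFormula L := .not (.exV x (.not φ))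

def allSetV (X : ℕ) (φ : MSOFormula L) : MSOFormula L := .not (.exSetV X (.not φ))

/-- A vertex `x` with label `l` satisfies `φ`. -/
def exLab (l : L) (x : ℕ) (φ : MSOFormula L) : MSOFormula L := .exV x (.and (.lab l x) φ)

/-- All vertices `x` with label `l` satisfy `φ`. -/
def allLab (l : L) (x : ℕ) (φ : MSOFormula L) : MSOFormula L := .not (.exLab l x (.not φ))

def conj : List (MSOFormula L) → MSOFormula L
  | [] => .tt
  | φ :: l => .and φ (conj l)

/-- Quantification over the set variables `m, …, m + k - 1`. -/
def exSets (m : ℕ) : ℕ → MSOFormula L → MSOFormula L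
  | 0, φ => φ
  | k + 1, φ => .exSetV (m + k) (exSets m k φ)

end MSOFormula

section Sat

variable {W : Type*} {L : Type} {H : SimpleGraph W} {lab : W → L} {ρ : MSOAssignment W}

@[simp] lemma sat_or {φ ψ : MSOFormula L} :
    MSOSat H lab (φ.or ψ) ρ ↔ MSOSat H lab φ ρ ∨ MSOSat H lab ψ ρ := by
  simp only [MSOFormula.or, MSOSat]; tauto

@[simp] lemma sat_imp {φ ψ : MSOFormula L} :
    MSOSat H lab (φ.imp ψ) ρ ↔ (MSOSat H lab φ ρ → MSOSat H lab ψ ρ) := by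
  simp only [MSOFormula.imp, MSOSat]; tauto

@[simp] lemma sat_iff {φ ψ : MSOFormula L} :
    MSOSat H lab (φ.iff ψ) ρ ↔ (MSOSat H lab φ ρ ↔ MSOSat H lab ψ ρ) := by
  simp only [MSOFormula.iff, MSOSat, sat_imp]; tauto

@[simp] lemma sat_allV {x : ℕ} {φ : MSOFormula L} :
    MSOSat H lab (φ.allV x) ρ ↔
      ∀ w, MSOSat H lab φ {ρ with v := Function.update ρ.v x w} := by
  simp [MSOFormula.allV, MSOSat]

@[simp] lemma sat_allSetV {X : ℕ} {φ : MSOFormula L} :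
    MSOSat H lab (φ.allSetV X) ρ ↔
      ∀ A, MSOSat H lab φ {ρ with sv := Function.update ρ.sv X A} := by
  simp [MSOFormula.allSetV, MSOSat]

@[simp] lemma sat_conj {l : List (MSOFormula L)} :
    MSOSat H lab (.conj l) ρ ↔ ∀ φ ∈ l, MSOSat H lab φ ρ := by
  induction l with
  | nil => simp [MSOFormula.conj, MSOSat]
  | cons φ l ih => simp [MSOFormula.conj, MSOSat, ih]

lemma sat_exSets {m k : ℕ} {φ : MSOFormula L} :
    MSOSat H lab (.exSets m k φ) ρ ↔ ∃ B : ℕ → Set W, MSOSat H lab φ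
      {ρ with sv := fun j => if m ≤ j ∧ j < m + k then B (j - m) else ρ.sv j} := by
  induction k generalizing ρ with
  | zero =>
    have : ∀ j, ¬(m ≤ j ∧ j < m) := by omega
    simp [MSOFormula.exSets, this]
  | succ k ih =>
    simp only [MSOFormula.exSets, MSOSat, ih]
    constructor
    · rintro ⟨A, B, h⟩
      refine ⟨fun j => if j = k then A else B j, ?_⟩
      convert h using 3 with j
      grind
    · rintro ⟨B, h⟩
      refine ⟨B k, B, ?_⟩
      convert h using 3 with j
      grind

end Sat

section Aux

variable {V : Type} {G Ghat : SimpleGraph V} {S : Set CrossingType}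
  {ρ : MSOAssignment (AuxV V)}

lemma auxGraph_adj_cr {u : V} {e : Sym2 V} :
    (auxGraph G Ghat S).Adj (.inl u) (.inr (.inl e)) ↔ e ∈ G.edgeSet ∧ u ∈ e := by
  simp [auxGraph]

lemma auxGraph_adj_ctp {u : V} {q : CTPData V} :
    (auxGraph G Ghat S).Adj (.inl u) (.inr (.inr (.inl q))) ↔ ValidCTP G Ghat S q ∧ u ∈ q.2 := by
  simp [auxGraph, -Prod.exists]

lemma auxGraph_cr_adj_ctp {e : Sym2 V} {q : CTPData V} :
    (auxGraph G Ghat S).Adj (.inr (.inl e)) (.inr (.inr (.inl q))) ↔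
      ValidCTP G Ghat S q ∧ e = crEdgeOf q := by
  simp [auxGraph, -Prod.exists, and_comm]

@[simp] lemma exists_label_plain {P : AuxV V → Prop} :
    (∃ w, auxLabelOf w = .plain ∧ P w) ↔ ∃ u, P (.inl u) := by
  constructor
  · rintro ⟨u | e | q | ⟨q, _ | _⟩, h, hP⟩ <;> first | exact ⟨_, hP⟩ | cases h
  · rintro ⟨u, h⟩
    exact ⟨_, rfl, h⟩

@[simp] lemma exists_label_cr {P : AuxV V → Prop} :
    (∃ w, auxLabelOf w = .cr ∧ P w) ↔ ∃ e, P (.inr (.inl e)) := by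
  constructor
  · rintro ⟨u | e | q | ⟨q, _ | _⟩, h, hP⟩ <;> first | exact ⟨_, hP⟩ | cases h
  · rintro ⟨u, h⟩
    exact ⟨_, rfl, h⟩

@[simp] lemma exists_label_ctp {P : AuxV V → Prop} :
    (∃ w, auxLabelOf w = .ctp ∧ P w) ↔ ∃ q, P (.inr (.inr (.inl q))) := by
  constructor
  · rintro ⟨u | e | q | ⟨q, _ | _⟩, h, hP⟩ <;> first | exact ⟨_, hP⟩ | cases h
  · rintro ⟨u, h⟩
    exact ⟨_, rfl, h⟩

lemma label_plain {w : AuxV V} : auxLabelOf w = .plain ↔ ∃ u, w = .inl u := by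
  simpa using exists_label_plain (P := fun w' => w = w')

lemma label_cr {w : AuxV V} : auxLabelOf w = .cr ↔ ∃ e, w = .inr (.inl e) := by
  simpa using exists_label_cr (P := fun w' => w = w')

@[simp] lemma sat_exLab {l : AuxLabel} {x : ℕ} {φ : MSOFormula AuxLabel} :
    MSOSat (auxGraph G Ghat S) auxLabelOf (φ.exLab l x) ρ ↔ ∃ w, auxLabelOf w = l ∧
      MSOSat (auxGraph G Ghat S) auxLabelOf φ {ρ with v := Function.update ρ.v x w} := by
  simp [MSOFormula.exLab, MSOSat]

@[simp] lemma sat_allPlain {x : ℕ} {φ : MSOFormula AuxLabel} :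
    MSOSat (auxGraph G Ghat S) auxLabelOf (φ.allLab .plain x) ρ ↔ ∀ u,
      MSOSat (auxGraph G Ghat S) auxLabelOf φ {ρ with v := Function.update ρ.v x (.inl u)} := by
  simp only [MSOFormula.allLab, MSOSat, sat_exLab, exists_label_plain, not_exists, not_not]

@[simp] lemma sat_allCr {x : ℕ} {φ : MSOFormula AuxLabel} :
    MSOSat (auxGraph G Ghat S) auxLabelOf (φ.allLab .cr x) ρ ↔ ∀ e,
      MSOSat (auxGraph G Ghat S) auxLabelOf φ
        {ρ with v := Function.update ρ.v x (.inr (.inl e))} := by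
  simp only [MSOFormula.allLab, MSOSat, sat_exLab, exists_label_cr, not_exists, not_not]

/-- The chord-tied pairs selected by the interpretations of the set variables `0` and `1`. -/
def selected (G Ghat : SimpleGraph V) (S : Set CrossingType) (s : ℕ → Set (AuxV V)) (i : Bool) :
    Set (CTPData V) :=
  {q | ValidCTP G Ghat S q ∧ Sum.inr (Sum.inr (Sum.inl q)) ∈ s i.toNat}

lemma selected_congr {s s' : ℕ → Set (AuxV V)} (h : ∀ k < 2, s k = s' k) :
    selected G Ghat S s = selected G Ghat S s' := by
  funext i
  rw [selected, selected, h _ i.toNat_lt]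

@[simp] lemma selected_update {s : ℕ → Set (AuxV V)} {A : Set (AuxV V)} :
    selected G Ghat S (Function.update s 2 A) = selected G Ghat S s :=
  selected_congr fun k hk => by rw [Function.update_of_ne (by omega)]

namespace MSOFormula

/-- The crossing edges of some selected chord-tied pairs with the same chord and flag are `x`
and `y`. -/
def pairFlag (i x y : ℕ) : MSOFormula AuxLabel :=
  .exLab .ctp 10 <| .exLab .ctp 11 <| .and (.memV 10 i) <| .and (.memV 11 i) <|
    .and (.adj x 10) <| .and (.adj y 11) <|
    .allLab .plain 12 (.iff (.adj 12 10) (.adj 12 11))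

/-- The edges `x` and `y` form a crossing pair. -/
def pair (x y : ℕ) : MSOFormula AuxLabel :=
  .and (.lab .cr x) <| .and (.lab .cr y) <| .and (.not (.veq x y)) <|
    .or (.pairFlag 0 x y) (.pairFlag 1 x y)

/-- The vertices `x` and `y` are adjacent. -/
def gadj (x y : ℕ) : MSOFormula AuxLabel :=
  .and (.not (.veq x y)) <| .exLab .cr 10 (.and (.adj x 10) (.adj y 10))

/-- Adjacency of vertices and edges in the cross graph. -/
def xadj (x y : ℕ) : MSOFormula AuxLabel :=
  .or (.and (.lab .plain x) <| .and (.lab .cr y) (.adj x y)) <|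
  .or (.and (.lab .plain y) <| .and (.lab .cr x) (.adj y x)) (.pair x y)

/-- The set `X` consists of vertices and edges. -/
def subset (X : ℕ) : MSOFormula AuxLabel :=
  .allV 0 (.imp (.memV 0 X) (.or (.lab .plain 0) (.lab .cr 0)))

def connected (X : ℕ) : MSOFormula AuxLabel :=
  .and (.exV 0 (.memV 0 X)) <| .allSetV 2 <|
    .imp (.exV 0 (.and (.memV 0 X) (.memV 0 2))) <|
    .imp (.allV 0 <| .imp (.memV 0 X) <| .imp (.memV 0 2) <| .allV 1 <| .imp (.memV 1 X) <|
      .imp (.xadj 0 1) (.memV 1 2)) <|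
    .allV 1 (.imp (.memV 1 X) (.memV 1 2))

def closed (X : ℕ) : MSOFormula AuxLabel :=
  .allV 0 <| .allV 1 <| .imp (.pair 0 1) (.iff (.memV 0 X) (.memV 1 X))

def touching (X Y : ℕ) : MSOFormula AuxLabel :=
  .exV 0 <| .and (.memV 0 X) <| .exV 1 <| .and (.memV 1 Y) (.xadj 0 1)

def disjoint (X Y : ℕ) : MSOFormula AuxLabel :=
  .allV 0 <| .not (.and (.memV 0 X) (.memV 0 Y))

end MSOFormula

lemma sat_pairFlag {i : Bool} {x y : ℕ} (hx : x < 10) (hy : y < 10) {e e' : Sym2 V}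
    (hex : ρ.v x = .inr (.inl e)) (hey : ρ.v y = .inr (.inl e')) :
    MSOSat (auxGraph G Ghat S) auxLabelOf (.pairFlag i.toNat x y) ρ ↔
      ∃ p ∈ selected G Ghat S ρ.sv i, ∃ q ∈ selected G Ghat S ρ.sv i,
        crEdgeOf p = e ∧ crEdgeOf q = e' ∧ p.2 = q.2 := by
  have h1 : x ≠ 10 := by omega
  have h2 : y ≠ 10 := by omega
  have h3 : x ≠ 11 := by omega
  have h4 : y ≠ 11 := by omega
  simp only [MSOFormula.pairFlag, sat_exLab, exists_label_ctp, MSOSat, sat_allPlain, sat_iff,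
    Function.update_apply, h1, h2, h3, h4, hex, hey, if_true, if_false, auxGraph_adj_ctp,
    auxGraph_cr_adj_ctp, selected, Set.mem_ofPred_eq, Nat.reduceEqDiff]
  constructor
  · rintro ⟨p, q, hp, hq, ⟨hpv, rfl⟩, ⟨hqv, rfl⟩, h⟩
    exact ⟨p, ⟨hpv, hp⟩, q, ⟨hqv, hq⟩, rfl, rfl, Sym2.ext fun u => by simpa [hpv, hqv] using h u⟩
  · rintro ⟨p, ⟨hpv, hp⟩, q, ⟨hqv, hq⟩, rfl, rfl, h⟩
    exact ⟨p, q, hp, hq, ⟨hpv, rfl⟩, ⟨hqv, rfl⟩, fun u => by simp [hpv, hqv, h]⟩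

lemma sat_pair {x y : ℕ} (hx : x < 10) (hy : y < 10) :
    MSOSat (auxGraph G Ghat S) auxLabelOf (.pair x y) ρ ↔
      ∃ e e', ρ.v x = .inr (.inl e) ∧ ρ.v y = .inr (.inl e') ∧
        FlagPair (selected G Ghat S ρ.sv) e e' := by
  simp only [MSOFormula.pair, MSOSat, label_cr, sat_or]
  constructor
  · rintro ⟨⟨e, he⟩, ⟨e', he'⟩, hne, h⟩
    refine ⟨e, e', he, he', fun h => hne (by rw [he, he', h]), ?_⟩
    rcases h with h | h
    · exact ⟨false, (sat_pairFlag hx hy he he').1 h⟩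
    · exact ⟨true, (sat_pairFlag hx hy he he').1 h⟩
  · rintro ⟨e, e', he, he', hne, i, h⟩
    refine ⟨⟨e, he⟩, ⟨e', he'⟩, fun h => hne (by simpa [he, he'] using h), ?_⟩
    have := (sat_pairFlag hx hy he he').2 h
    cases i
    · exact .inl this
    · exact .inr this

lemma sat_gadj {x y : ℕ} (hx : x < 10) (hy : y < 10) {u v : V} (hu : ρ.v x = .inl u)
    (hv : ρ.v y = .inl v) :
    MSOSat (auxGraph G Ghat S) auxLabelOf (.gadj x y) ρ ↔ G.Adj u v := by
  have h1 : x ≠ 10 := by omega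
  have h2 : y ≠ 10 := by omega
  simp only [MSOFormula.gadj, MSOSat, sat_exLab, exists_label_cr, Function.update_apply, h1, h2, hu,
    hv, if_true, if_false, auxGraph_adj_cr]
  constructor
  · rintro ⟨hne, e, ⟨he, hue⟩, -, hve⟩
    have hne : u ≠ v := fun h => hne (by rw [h])
    rwa [(Sym2.mem_and_mem_iff hne).1 ⟨hue, hve⟩] at he
  · intro h
    exact ⟨by simpa using h.ne, s(u, v), ⟨h, by simp⟩, h, by simp⟩

/-- The vertices of the auxiliary graph for the vertices and the edges of `G`. -/
def auxEmb : V ⊕ Sym2 V ↪ AuxV V where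
  toFun := Sum.elim .inl fun e => .inr (.inl e)
  inj' := by rintro (u | e) (v | f) h <;> simp_all

lemma label_auxEmb {w : AuxV V} :
    auxLabelOf w = .plain ∨ auxLabelOf w = .cr ↔ w ∈ Set.range auxEmb := by
  rw [label_plain, label_cr]
  constructor
  · rintro (⟨u, rfl⟩ | ⟨e, rfl⟩)
    exacts [⟨.inl u, rfl⟩, ⟨.inr e, rfl⟩]
  · rintro ⟨u | e, rfl⟩
    exacts [.inl ⟨u, rfl⟩, .inr ⟨e, rfl⟩]

lemma selected_edge {s : ℕ → Set (AuxV V)} {i : Bool} {q : CTPData V}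
    (h : q ∈ selected G Ghat S s i) : crEdgeOf q ∈ G.edgeSet := by
  obtain ⟨⟨a, b, c, d⟩, g⟩ := q
  exact h.1.1

lemma FlagPair.symm {D : Bool → Set (CTPData V)} {e e' : Sym2 V} (h : FlagPair D e e') :
    FlagPair D e' e := by
  obtain ⟨hne, i, p, hp, q, hq, h, h', hpq⟩ := h
  exact ⟨hne.symm, i, q, hq, p, hp, h', h, hpq.symm⟩

lemma FlagPair.mem_edgeSet {s : ℕ → Set (AuxV V)} {e e' : Sym2 V}
    (h : FlagPair (selected G Ghat S s) e e') : e ∈ G.edgeSet := by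
  obtain ⟨-, i, p, hp, q, hq, rfl, -⟩ := h
  exact selected_edge hp

lemma sat_xadj {x y : ℕ} (hx : x < 10) (hy : y < 10) :
    MSOSat (auxGraph G Ghat S) auxLabelOf (.xadj x y) ρ ↔
      ((crossGraph G (FlagPair (selected G Ghat S ρ.sv))).map auxEmb).Adj (ρ.v x) (ρ.v y) := by
  simp only [MSOFormula.xadj, sat_or, sat_pair hx hy, MSOSat, label_plain, label_cr,
    SimpleGraph.map_adj]
  generalize ρ.v x = w
  generalize ρ.v y = w'
  constructor
  · rintro (⟨⟨u, rfl⟩, ⟨e, rfl⟩, h⟩ | ⟨⟨u, rfl⟩, ⟨e, rfl⟩, h⟩ | ⟨e, e', rfl, rfl, h⟩)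
    · exact ⟨.inl u, .inr e, auxGraph_adj_cr.1 h, rfl, rfl⟩
    · exact ⟨.inr e, .inl u, auxGraph_adj_cr.1 h, rfl, rfl⟩
    · exact ⟨.inr e, .inr e', ⟨h.mem_edgeSet, h.symm.mem_edgeSet, h.1, .inl h⟩, rfl, rfl⟩
  · rintro ⟨u | e, v | e', h, rfl, rfl⟩
    · exact h.elim
    · exact .inl ⟨⟨u, rfl⟩, ⟨e', rfl⟩, auxGraph_adj_cr.2 h⟩
    · exact .inr (.inl ⟨⟨v, rfl⟩, ⟨e, rfl⟩, auxGraph_adj_cr.2 h⟩)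
    · exact .inr (.inr ⟨e, e', rfl, rfl, h.2.2.2.elim id .symm⟩)

lemma sat_subset {X : ℕ} : MSOSat (auxGraph G Ghat S) auxLabelOf (.subset X) ρ ↔
    ρ.sv X ⊆ Set.range auxEmb := by
  simp only [MSOFormula.subset, sat_allV, sat_imp, sat_or, MSOSat, Set.subset_def, ← label_auxEmb,
    Function.update_self]

lemma sat_connected {X : ℕ} (hX : X ≠ 2) :
    MSOSat (auxGraph G Ghat S) auxLabelOf (.connected X) ρ ↔
      Conn ((crossGraph G (FlagPair (selected G Ghat S ρ.sv))).map auxEmb) (ρ.sv X) := by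
  simp only [MSOFormula.connected, MSOSat, sat_allV, sat_imp, sat_allSetV, sat_xadj, Conn,
    Set.Nonempty, Function.update_apply, hX, selected_update, Nat.reduceLT, if_true, if_false,
    zero_ne_one]

lemma sat_closed {X : ℕ} : MSOSat (auxGraph G Ghat S) auxLabelOf (.closed X) ρ ↔
    ∀ e e', FlagPair (selected G Ghat S ρ.sv) e e' →
      (Sum.inr (.inl e) ∈ ρ.sv X ↔ Sum.inr (.inl e') ∈ ρ.sv X) := by
  simp only [MSOFormula.closed, sat_allV, sat_imp, sat_pair (show 0 < 10 by simp)
      (show 1 < 10 by simp), sat_iff, MSOSat]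
  simp

lemma sat_touching {X Y : ℕ} : MSOSat (auxGraph G Ghat S) auxLabelOf (.touching X Y) ρ ↔
    ∃ u ∈ ρ.sv X, ∃ v ∈ ρ.sv Y,
      ((crossGraph G (FlagPair (selected G Ghat S ρ.sv))).map auxEmb).Adj u v := by
  simp only [MSOFormula.touching, MSOSat, sat_xadj, Function.update_apply, Nat.reduceLT, if_true,
    zero_ne_one, if_false]

lemma sat_disjoint {X Y : ℕ} : MSOSat (auxGraph G Ghat S) auxLabelOf (.disjoint X Y) ρ ↔
    ∀ u, u ∈ ρ.sv X → u ∉ ρ.sv Y := by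
  simp only [MSOFormula.disjoint, MSOSat, sat_allV, Function.update_self, not_and]

end Aux

end Formulas

end OnePlanarity

namespace OnePlanarity

section Formulas

section Aux

variable {V : Type} {G Ghat : SimpleGraph V} {S : Set CrossingType}
  {ρ : MSOAssignment (AuxV V)}

namespace MSOFormula

/-- Every edge is in at most one crossing pair. -/
def uniquePair : MSOFormula AuxLabel :=
  .allLab .cr 0 <| .allLab .cr 1 <| .allLab .cr 2 <|
    .imp (.pair 0 1) <| .imp (.pair 0 2) (.veq 1 2)

/-- The edges of a crossing pair are disjoint. -/
def disjointPair : MSOFormula AuxLabel :=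
  .allLab .cr 0 <| .allLab .cr 1 <| .imp (.pair 0 1) <| .allLab .plain 2 <|
    .imp (.adj 2 0) (.not (.adj 2 1))

/-- The vertices `0, 1, 2, 3` induce a crossing of type `t`. -/
def crossingType : CrossingType → MSOFormula AuxLabel
  | .full => .conj [.gadj 0 2, .gadj 0 3, .gadj 1 2, .gadj 1 3]
  | .almostFull =>
    .or (.conj [.not (.gadj 0 2), .gadj 0 3, .gadj 1 2, .gadj 1 3]) <|
    .or (.conj [.gadj 0 2, .not (.gadj 0 3), .gadj 1 2, .gadj 1 3]) <|
    .or (.conj [.gadj 0 2, .gadj 0 3, .not (.gadj 1 2), .gadj 1 3])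
      (.conj [.gadj 0 2, .gadj 0 3, .gadj 1 2, .not (.gadj 1 3)])
  | .bowtie =>
    .or (.conj [.gadj 0 2, .gadj 1 3, .not (.gadj 0 3), .not (.gadj 1 2)])
      (.conj [.gadj 0 3, .gadj 1 2, .not (.gadj 0 2), .not (.gadj 1 3)])
  | _ => .not .tt

open Classical in
/-- The vertices `0, 1, 2, 3` induce a crossing with a type in `S`. -/
noncomputable def crossingTypeIn (S : Set CrossingType) : MSOFormula AuxLabel :=
  .or (.and (if .full ∈ S then .tt else .not .tt) (.crossingType .full)) <|
  .or (.and (if .almostFull ∈ S then .tt else .not .tt) (.crossingType .almostFull))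
    (.and (if .bowtie ∈ S then .tt else .not .tt) (.crossingType .bowtie))

/-- The crossing pairs have types in `S`. -/
noncomputable def typedPair (S : Set CrossingType) : MSOFormula AuxLabel :=
  .allLab .plain 0 <| .allLab .plain 1 <| .allLab .plain 2 <| .allLab .plain 3 <|
    .allLab .cr 4 <| .allLab .cr 5 <| .imp (.pair 4 5) <|
    .imp (.conj [.adj 0 4, .adj 1 4, .not (.veq 0 1), .adj 2 5, .adj 3 5, .not (.veq 2 3)])
      (.crossingTypeIn S)

open Classical in
/-- There is a closed model of `H`. -/
noncomputable def model {k : ℕ} (H : SimpleGraph (Fin k)) : MSOFormula AuxLabel :=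
  .exSets 10 k <| .and
    (.conj <| (List.finRange k).map fun i : Fin k =>
      .and (.subset (10 + i)) (.and (.connected (10 + i)) (.closed (10 + i))))
    (.conj <| (List.finRange k).map fun i : Fin k => .conj <| (List.finRange k).map fun j : Fin k =>
      .and (if i = j then .tt else .disjoint (10 + i) (10 + j))
        (if H.Adj i j then .touching (10 + i) (10 + j) else .tt))

/-- The graph has crossing pairs with types in `S` for which there are no closed models of the
two Kuratowski graphs. -/
noncomputable def restricted (S : Set CrossingType) : MSOFormula AuxLabel :=
  .exSetV 0 <| .exSetV 1 <| .conj [.uniquePair, .disjointPair, .typedPair S,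
    .not (.model (⊤ : SimpleGraph (Fin 5))), .not (.model K33)]

end MSOFormula

lemma sat_uniquePair : MSOSat (auxGraph G Ghat S) auxLabelOf .uniquePair ρ ↔
    ∀ e e₁ e₂, FlagPair (selected G Ghat S ρ.sv) e e₁ →
      FlagPair (selected G Ghat S ρ.sv) e e₂ → e₁ = e₂ := by
  simp [MSOFormula.uniquePair, MSOSat, sat_pair]

lemma sat_disjointPair : MSOSat (auxGraph G Ghat S) auxLabelOf .disjointPair ρ ↔
    ∀ e e', FlagPair (selected G Ghat S ρ.sv) e e' → ∀ v, v ∈ e → v ∉ e' := by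
  simp [MSOFormula.disjointPair, MSOSat, sat_pair, auxGraph_adj_cr]
  refine forall₃_congr fun e e' h => forall_congr' fun u => ?_
  simp [h.mem_edgeSet, h.symm.mem_edgeSet]

lemma sat_crossingType {a b c d : V} (ha : ρ.v 0 = .inl a) (hb : ρ.v 1 = .inl b)
    (hc : ρ.v 2 = .inl c) (hd : ρ.v 3 = .inl d) {t : CrossingType} (ht : t ∈ goodTypes) :
    MSOSat (auxGraph G Ghat S) auxLabelOf (.crossingType t) ρ ↔ HasCrossingType G a b c d t := by
  have h02 := sat_gadj (G := G) (Ghat := Ghat) (S := S) (by simp) (by simp) ha hc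
  have h03 := sat_gadj (G := G) (Ghat := Ghat) (S := S) (by simp) (by simp) ha hd
  have h12 := sat_gadj (G := G) (Ghat := Ghat) (S := S) (by simp) (by simp) hb hc
  have h13 := sat_gadj (G := G) (Ghat := Ghat) (S := S) (by simp) (by simp) hb hd
  rcases ht with rfl | rfl | rfl <;>
    simp [MSOFormula.crossingType, HasCrossingType, MSOSat, h02, h03, h12, h13]

lemma sat_crossingTypeIn (hS : S ⊆ goodTypes) {a b c d : V} (ha : ρ.v 0 = .inl a)
    (hb : ρ.v 1 = .inl b) (hc : ρ.v 2 = .inl c) (hd : ρ.v 3 = .inl d) :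
    MSOSat (auxGraph G Ghat S) auxLabelOf (.crossingTypeIn S) ρ ↔
      ∃ t ∈ S, HasCrossingType G a b c d t := by
  classical
  have key : ∀ t ∈ goodTypes, (MSOSat (auxGraph G Ghat S) auxLabelOf
      (.and (if t ∈ S then .tt else .not .tt) (.crossingType t)) ρ ↔
        t ∈ S ∧ HasCrossingType G a b c d t) := by
    intro t ht
    by_cases h : t ∈ S <;> simp [MSOSat, h, sat_crossingType ha hb hc hd ht]
  rw [MSOFormula.crossingTypeIn, sat_or, sat_or, key _ (by simp [goodTypes]),
    key _ (by simp [goodTypes]), key _ (by simp [goodTypes])]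
  constructor
  · rintro (h | h | h) <;> exact ⟨_, h⟩
  · rintro ⟨t, ht, h⟩
    rcases hS ht with rfl | rfl | rfl
    exacts [.inl ⟨ht, h⟩, .inr (.inl ⟨ht, h⟩), .inr (.inr ⟨ht, h⟩)]

lemma sat_typedPair (hS : S ⊆ goodTypes) :
    MSOSat (auxGraph G Ghat S) auxLabelOf (.typedPair S) ρ ↔
      ∀ a b c d, FlagPair (selected G Ghat S ρ.sv) s(a, b) s(c, d) →
        ∃ t ∈ S, HasCrossingType G a b c d t := by
  simp only [MSOFormula.typedPair, sat_allPlain, sat_allCr, sat_imp]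
  refine forall_congr' fun a => forall_congr' fun b => forall_congr' fun c =>
    forall_congr' fun d => ?_
  have := fun e e' => sat_crossingTypeIn (G := G) (Ghat := Ghat) (ρ :=
      { ρ with v := (Function.update
    (Function.update (Function.update (Function.update (Function.update (Function.update ρ.v 0
      (.inl a)) 1 (.inl b)) 2 (.inl c)) 3 (.inl d)) 4 (.inr (.inl e))) 5 (.inr (.inl e'))) })
    hS (a := a) (b := b) (c := c) (d := d) rfl rfl rfl rfl
  simp only [this]
  simp only [sat_pair (show 4 < 10 by simp) (show 5 < 10 by simp), Function.update_apply,
    Nat.reduceEqDiff, if_true, if_false, sat_conj, List.mem_cons, List.not_mem_nil, or_false,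
    forall_eq_or_imp, forall_eq, MSOSat, auxGraph_adj_cr, Sum.inr.injEq, Sum.inl.injEq,
    OfNat.ofNat_ne_zero, OfNat.ofNat_ne_one]
  constructor
  · intro h hp
    have h1 := hp.mem_edgeSet
    have h2 := hp.symm.mem_edgeSet
    exact h _ _ ⟨_, _, rfl, rfl, hp⟩ ⟨⟨h1, by simp⟩, ⟨h1, by simp⟩, G.ne_of_adj h1, ⟨h2, by simp⟩,
      ⟨h2, by simp⟩, G.ne_of_adj h2⟩
  · rintro h _ _ ⟨e, e', rfl, rfl, hp⟩ ⟨ha, hb, hab, hc, hd, hcd⟩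
    apply h
    rwa [← (Sym2.mem_and_mem_iff hab).1 ⟨ha.2, hb.2⟩, ← (Sym2.mem_and_mem_iff hcd).1 ⟨hc.2, hd.2⟩]

lemma conn_map {V W : Type*} {G : SimpleGraph V} (f : V ↪ W) {A : Set V} :
    Conn (G.map f) (f '' A) ↔ Conn G A := by
  constructor
  · rintro ⟨h1, h2⟩
    refine ⟨by simpa using h1, fun X hX hc v hv => ?_⟩
    have := h2 (f '' X) ?_ ?_ (f v) ⟨v, hv, rfl⟩
    · simpa using this
    · obtain ⟨u, hu, hX⟩ := hX
      exact ⟨f u, ⟨u, hu, rfl⟩, u, hX, rfl⟩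
    · rintro _ ⟨u, hu, rfl⟩ hux _ ⟨v, hv, rfl⟩ huv
      exact ⟨v, hc u hu (by simpa using hux) v hv (by simpa using huv), rfl⟩
  · rintro ⟨h1, h2⟩
    refine ⟨h1.image f, ?_⟩
    rintro X ⟨_, ⟨u, hu, rfl⟩, hX⟩ hc _ ⟨v, hv, rfl⟩
    exact h2 (f ⁻¹' X) ⟨u, hu, hX⟩ (fun a ha hax b hb hab => hc _ ⟨a, ha, rfl⟩ hax _ ⟨b, hb, rfl⟩
      (by simpa using hab)) v hv

lemma sat_model {k : ℕ} {H : SimpleGraph (Fin k)} :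
    MSOSat (auxGraph G Ghat S) auxLabelOf (.model H) ρ ↔ ∃ B : Fin k → Set (V ⊕ Sym2 V),
      (∀ i, RClosed (FlagPair (selected G Ghat S ρ.sv)) (B i)) ∧
        IsModel H (crossGraph G (FlagPair (selected G Ghat S ρ.sv))) B := by
  classical
  have hsel : ∀ B : ℕ → Set (AuxV V), selected G Ghat S
      (fun j => if 10 ≤ j ∧ j < 10 + k then B (j - 10) else ρ.sv j) = selected G Ghat S ρ.sv :=
    fun B => selected_congr fun j hj => if_neg (by omega)
  have hsat : ∀ (p : Prop) [Decidable p] (φ ψ : MSOFormula AuxLabel) (ρ : MSOAssignment (AuxV V)),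
      MSOSat (auxGraph G Ghat S) auxLabelOf (if p then φ else ψ) ρ ↔
        if p then MSOSat (auxGraph G Ghat S) auxLabelOf φ ρ
        else MSOSat (auxGraph G Ghat S) auxLabelOf ψ ρ := by
    intro p _ φ ψ ρ
    split_ifs <;> rfl
  have h2 : ∀ i : ℕ, 10 + i ≠ 2 := by omega
  simp only [MSOFormula.model, sat_exSets, MSOSat, sat_conj, List.mem_map, List.mem_finRange,
    true_and, forall_exists_index, forall_apply_eq_imp_iff, sat_subset, sat_connected (h2 _),
    sat_closed, hsat, sat_disjoint, sat_touching, hsel, Nat.le_add_right, Nat.add_lt_add_iff_left,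
    Fin.is_lt, and_self, if_true, Nat.add_sub_cancel_left]
  generalize FlagPair (selected G Ghat S ρ.sv) = R
  constructor
  · rintro ⟨B, h1, h2⟩
    have hB : ∀ i : Fin k, auxEmb '' (auxEmb ⁻¹' B i) = B i :=
      fun i => Set.image_preimage_eq_of_subset (h1 i).1
    refine ⟨fun i => auxEmb ⁻¹' B i, fun i => (h1 i).2.2, ?_, fun i => ?_, ?_⟩
    · intro i j v hi hj
      by_contra hij
      have := (h2 i j).1
      rw [if_neg hij] at this
      exact this _ hi hj
    · rw [← conn_map auxEmb, hB]
      exact (h1 i).2.1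
    · intro i j hij
      have := (h2 i j).2
      rw [if_pos hij] at this
      obtain ⟨_, hu, _, hv, h⟩ := this
      obtain ⟨u, v, huv, rfl, rfl⟩ := (SimpleGraph.map_adj _ _ _ _).1 h
      exact ⟨u, hu, v, hv, huv⟩
  · rintro ⟨B, h1, h2⟩
    refine ⟨fun i => if h : i < k then auxEmb '' B ⟨i, h⟩ else ∅, fun i => ?_, fun i j => ?_⟩
    · simp only [Fin.is_lt, dite_true]
      refine ⟨Set.image_subset_range _ _, (conn_map _).2 (h2.conn i), fun e e' h => ?_⟩
      have := h1 i e e' h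
      rw [← auxEmb.injective.mem_set_image, ← auxEmb.injective.mem_set_image (a := .inr e')] at this
      exact this
    · simp only [Fin.is_lt, dite_true]
      constructor
      · split_ifs with hij
        · rintro _ ⟨u, hu, rfl⟩ hv
          rw [auxEmb.injective.mem_set_image] at hv
          exact hij (h2.disj _ _ _ hu hv)
      · split_ifs with hij
        · obtain ⟨u, hu, v, hv, h⟩ := h2.adj _ _ hij
          exact ⟨_, ⟨u, hu, rfl⟩, _, ⟨v, hv, rfl⟩, (SimpleGraph.map_adj _ _ _ _).2 ⟨u, v, h, rfl,
              rfl⟩⟩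

lemma sat_restricted (hS : S ⊆ goodTypes) :
    MSOSat (auxGraph G Ghat S) auxLabelOf (.restricted S) ρ ↔ ∃ D : Bool → Set (CTPData V),
      (∀ i, ∀ q ∈ D i, ValidCTP G Ghat S q) ∧ IsGood G S (FlagPair D) ∧
        ClosedFree G (FlagPair D) := by
  have key : ∀ ρ : MSOAssignment (AuxV V), (∀ φ ∈ [.uniquePair, .disjointPair, .typedPair S,
      .not (.model (⊤ : SimpleGraph (Fin 5))), .not (.model K33)],
      MSOSat (auxGraph G Ghat S) auxLabelOf φ ρ) ↔
      IsGood G S (FlagPair (selected G Ghat S ρ.sv)) ∧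
        ClosedFree G (FlagPair (selected G Ghat S ρ.sv)) := by
    intro ρ
    simp only [List.mem_cons, List.not_mem_nil, or_false, forall_eq_or_imp, forall_eq, MSOSat,
      sat_uniquePair, sat_disjointPair, sat_typedPair hS, sat_model, not_exists, not_and]
    exact ⟨fun h => ⟨⟨⟨fun _ _ => FlagPair.mem_edgeSet, fun _ _ => FlagPair.symm, h.1, h.2.1⟩,
      h.2.2.1⟩, h.2.2.2⟩, fun h => ⟨h.1.unique, h.1.disj, h.1.type, h.2⟩⟩
  simp only [MSOFormula.restricted, MSOSat, sat_conj, key]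
  constructor
  · rintro ⟨A, B, h⟩
    exact ⟨_, fun _ _ hq => hq.1, h⟩
  · rintro ⟨D, hD, h⟩
    refine ⟨(fun q => .inr (.inr (.inl q))) '' D false, (fun q => .inr (.inr (.inl q))) '' D true,
        ?_⟩
    convert h using 3 <;>
    · ext (_ | _) q <;> simp [selected, -Prod.exists] <;> exact hD _ _

theorem models_restricted_iff [Finite V] (hS : S ⊆ goodTypes) (hG : InternallyThreeConnected G)
    (hle : G ≤ Ghat) (hchordal : IsChordal Ghat) :
    MSOModels (auxGraph G Ghat S) auxLabelOf (.restricted S) ↔ SRestricted G S := by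
  simp only [MSOModels, sat_restricted hS]
  constructor
  · intro h
    obtain ⟨v⟩ : Nonempty V := by
      obtain ⟨Ws, -, -, h, -⟩ := hG
      obtain ⟨v⟩ := (Nat.card_pos_iff.1 (by omega : 0 < Nat.card {v : V // v ∉ Ws})).1
      exact ⟨v.1⟩
    obtain ⟨D, -, h⟩ := h ⟨fun _ => .inl v, fun _ => s(.inl v, .inl v), fun _ => ∅, fun _ => ∅⟩
    exact sRestricted_iff.2 ⟨_, h⟩
  · intro h ρ
    exact exists_flagPair hS hG hle hchordal h

end Aux

end Formulas

end OnePlanarity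

namespace OnePlanarity

/-- **A constant MSO₂-formula for `S`-restrictedness.** Fix a nonempty
`S ⊆ {full, almost-full, bowtie}`.  There is a single (hence constant-length) MSO₂-formula
`φ` such that for every internally 3-connected graph `G` and every chordal completion `Ĝ`
of `G`, the labelled auxiliary graph `G̃` satisfies `φ` if and only if `G` is
`S`-restricted. -/
theorem mso_formula_for_srestricted
    (S : Set CrossingType) (hS : S ⊆ goodTypes) (hne : S.Nonempty) :
    ∃ φ : MSOFormula AuxLabel,
      ∀ (n : ℕ) (G Ghat : SimpleGraph (Fin n)),
        InternallyThreeConnected G → G ≤ Ghat → IsChordal Ghat →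
        (MSOModels (auxGraph G Ghat S) auxLabelOf φ ↔ SRestricted G S) := by
  exact ⟨.restricted S, fun n G Ghat hG hle hchordal =>
    models_restricted_iff hS hG hle hchordal⟩

end OnePlanarity
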